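/- Conventions. $(M,g)$ is a smooth real 4-dimensional Lorentzian manifold of signature $(+,-,-,-)$ with Levi-Civita connection $\nabla$ and a smooth spin dyad $(o^A,\iota^A)$, $o_A\iota^A=1$; its null tetrad is $l^a=o^A\bar o^{A'}$, $m^a=o^A\bar\iota^{A'}$, $\bar m^a=\iota^A\bar o^{A'}$, $n^a=\iota^A\bar\iota^{A'}$, so that $g_{ab}=\epsilon_{AB}\bar\epsilon_{A'B'}$, $l^an_a=1=-m^a\bar m_a$. Indices are moved by $\psi^A=\epsilon^{AB}\psi_B$, $\psi_B=\psi^A\epsilon_{AB}$. With $D=l^a\nabla_a$, $\delta=m^a\nabla_a$, $\delta'=\bar m^a\nabla_a$, $D'=n^a\nabla_a$, put $\rho=m^a\delta' l_a$, $\tau=m^aD'l_a$, $\rho'=\bar m^a\delta n_a$, $\tau'=\bar m^aDn_a$, $\sigma'=\bar m^a\delta' n_a$ and $\omega_a=\tfrac12(n^b\nabla_a l_b-\bar m^b\nabla_a m_b)$. On scalars of GHP weight $\{p,q\}$ (relative to the dyad: complex functions) the GHP covariant derivative is $\Theta_a=\nabla_a-p\,\omega_a-q\,\bar\omega_a$,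 with components $þ=l^a\Theta_a$, $ð=m^a\Theta_a$, $ð'=\bar m^a\Theta_a$, $þ'=n^a\Theta_a$. Curvature: $R_{abcd}X^aY^bZ^cW^d=g(\nabla_X\nabla_YZ-\nabla_Y\nabla_XZ-\nabla_{[X,Y]}Z,\,W)$, $R_{ac}=g^{bd}R_{abcd}$, $R=g^{ab}R_{ab}$; the Weyl spinor is $\Psi_{ABCD}=X_{(ABCD)}$, $X_{ABCD}=\tfrac14R_{AA'B}{}^{A'}{}_{CC'D}{}^{C'}$, and $\Psi_k$ is its component with $4-k$ contractions with $o$ and $k$ with $\iota$. Statement. Assume that $(M,g)$ is Einstein, that is, the trace-free part of $R_{ab}$ vanishes and $\Lambda=R/24$ is constant (so the cosmological constant is $6\Lambda$), and of Petrov type II with repeated principal spinor $o^A$, that is, $\Psi_0=\Psi_1=0$ and $\Psi_2\neq0$ everywhere. Let $\Psi_2^{1/3}$ denote a smooth branch of the cube root. Let $\chi$ be a smooth complex scalar of GHP weight $\{-4,0\}$ solving the Debye equation $$\mathcal O^\dagger\chi=2\big[(þ'-\bar\rho')(þ+3\rho)-(ð'-\bar\tau)(ð+3\tau)-3\Psi_2\big]\chi=0,$$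 and let $h_{ab}=\mathcal S^\dagger(\chi)_{ab}$ be the Debye metric $$h_{ab}=h_{nn}\,l_al_b-2h_{n\bar m}\,l_{(a}m_{b)}+h_{\bar m\bar m}\,m_am_b,$$ $$h_{nn}=-(ð+2\tau)ð\chi-\bar\sigma'þ\chi,\quad h_{n\bar m}=-(þ+\rho)ð\chi-(\tau+\bar\tau')þ\chi,\quad h_{\bar m\bar m}=-(þ+2\rho)þ\chi .$$ Let $\dot\Psi_{ABCD}=\tfrac12\nabla_{(A}{}^{A'}\nabla_B{}^{B'}h_{CD)A'B'}+\tfrac14g^{ef}h_{ef}\Psi_{ABCD}$ be its anti-self-dual linearized Weyl spinor and $\dot\Psi_4=\iota^A\iota^B\iota^C\iota^D\dot\Psi_{ABCD}$. Then $$\dot\Psi_{ABCD}=o_Ao_Bo_Co_D\,\dot\Psi_4,\qquad \dot\Psi_4=-\big(\Psi_2^{4/3}\,\xi^a\Theta_a+3\Psi_2^2+6\Psi_2\Lambda\big)\chi,$$ that is, $\dot\Psi_4$ is the only component of $\dot\Psi_{ABCD}$ that can be nonzero. Here $\xi_{AA'}=\nabla^B{}_{A'}K_{AB}$ is the projected Killing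 vector built from the projected Killing spinor $K_{AB}=\Psi_2^{-1/3}o_{(A}\iota_{B)}-\tfrac13\Psi_2^{-4/3}\Psi_3\,o_Ao_B$. -/

import Mathlib

open scoped Manifold ContDiff

noncomputable section

namespace GHP

/-! ### Real and complex vector fields on a real 4-manifold -/

/-- Real vector fields (sections of the tangent bundle) on a 4-manifold. -/
abbrev VF (M : Type*) [TopologicalSpace M] [ChartedSpace (EuclideanSpace ℝ (Fin 4)) M] : Type _ :=
  ∀ x : M, TangentSpace (𝓡 4) x

/-- Complex vector fields `Z = Z.1 + i Z.2` (sections of `TM ⊗ ℂ`). -/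
abbrev CVF (M : Type*) [TopologicalSpace M] [ChartedSpace (EuclideanSpace ℝ (Fin 4)) M] : Type _ :=
  VF M × VF M

section Manifold

variable {M : Type*} [TopologicalSpace M] [ChartedSpace (EuclideanSpace ℝ (Fin 4)) M]

/-- Smoothness of a real vector field. -/
def SmoothVF [IsManifold (𝓡 4) ∞ M] (X : VF M) : Prop :=
  ContMDiff (𝓡 4) (𝓡 4).tangent ∞ (fun x => (⟨x, X x⟩ : TangentBundle (𝓡 4) M))

/-- Smoothness of a complex-valued function. -/
def SmoothFn (f : M → ℂ) : Prop := ContMDiff (𝓡 4) 𝓘(ℝ, ℂ) ∞ f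

/-- Pointwise complex conjugation of a function. -/
def bar (f : M → ℂ) : M → ℂ := fun x => (starRingEnd ℂ) (f x)

/-- The complex conjugate vector field. -/
def CVF.conj (Z : CVF M) : CVF M := (Z.1, -Z.2)

/-- A real vector field regarded as a complex one. -/
def CVF.ofReal (X : VF M) : CVF M := (X, 0)

/-- The derivative `Z(f)` of a complex function along a complex vector field. -/
def CVF.deriv (Z : CVF M) (f : M → ℂ) : M → ℂ := fun x =>
  mvfderiv (𝓡 4) f x (Z.1 x) + Complex.I * mvfderiv (𝓡 4) f x (Z.2 x)

/-- The complex bilinear extension of the Lie bracket. -/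
def CVF.bracket (Z W : CVF M) : CVF M :=
  (VectorField.mlieBracket (𝓡 4) Z.1 W.1 - VectorField.mlieBracket (𝓡 4) Z.2 W.2,
   VectorField.mlieBracket (𝓡 4) Z.1 W.2 + VectorField.mlieBracket (𝓡 4) Z.2 W.1)

end Manifold

/-! ### Lorentzian 4-manifolds -/

/-- A real 4-dimensional Lorentzian manifold: a smooth metric `g` of signature `(+,-,-,-)` together
with its Levi-Civita connection, i.e. the torsion-free connection for which `g` is parallel.
In Mathlib's convention `nabla Y x (X x)` is `(∇_X Y)(x)`. -/
structure Spacetime (M : Type*) [TopologicalSpace M] [ChartedSpace (EuclideanSpace ℝ (Fin 4)) M]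
    [IsManifold (𝓡 4) ∞ M] where
  g : ∀ x : M, TangentSpace (𝓡 4) x →L[ℝ] TangentSpace (𝓡 4) x →L[ℝ] ℝ
  g_symm : ∀ (x : M) (v w : TangentSpace (𝓡 4) x), g x v w = g x w v
  g_lorentzian : ∀ x : M, ∃ b : Module.Basis (Fin 4) ℝ (TangentSpace (𝓡 4) x),
    ∀ i j, g x (b i) (b j) = if i = j then (if i = 0 then 1 else -1) else 0
  g_smooth : ∀ X Y : VF M, ∀ U : Set M, IsOpen U →
    ContMDiffOn (𝓡 4) (𝓡 4).tangent ∞ (fun x => (⟨x, X x⟩ : TangentBundle (𝓡 4) M)) U →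
    ContMDiffOn (𝓡 4) (𝓡 4).tangent ∞ (fun x => (⟨x, Y x⟩ : TangentBundle (𝓡 4) M)) U →
    ContMDiffOn (𝓡 4) 𝓘(ℝ, ℝ) ∞ (fun x => g x (X x) (Y x)) U
  nabla : CovariantDerivative (𝓡 4) (EuclideanSpace ℝ (Fin 4))
    (fun x : M => TangentSpace (𝓡 4) x)
  nabla_torsionFree : ∀ (X Y : VF M) (x : M),
    MDifferentiableAt (𝓡 4) (𝓡 4).tangent (fun y => (⟨y, X y⟩ : TangentBundle (𝓡 4) M)) x →
    MDifferentiableAt (𝓡 4) (𝓡 4).tangent (fun y => (⟨y, Y y⟩ : TangentBundle (𝓡 4) M)) x →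
    nabla Y x (X x) - nabla X x (Y x) = VectorField.mlieBracket (𝓡 4) X Y x
  nabla_metric : ∀ (X Y : VF M) (x : M) (v : TangentSpace (𝓡 4) x),
    MDifferentiableAt (𝓡 4) (𝓡 4).tangent (fun y => (⟨y, X y⟩ : TangentBundle (𝓡 4) M)) x →
    MDifferentiableAt (𝓡 4) (𝓡 4).tangent (fun y => (⟨y, Y y⟩ : TangentBundle (𝓡 4) M)) x →
    mvfderiv (𝓡 4) (fun y => g y (X y) (Y y)) x v
      = g x (nabla X x v) (Y x) + g x (X x) (nabla Y x v)

variable {M : Type*} [TopologicalSpace M] [ChartedSpace (EuclideanSpace ℝ (Fin 4)) M]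
  [IsManifold (𝓡 4) ∞ M]

namespace Spacetime

variable (S : Spacetime M)

/-- The complex bilinear extension of the metric. -/
def gC (Z W : CVF M) : M → ℂ := fun x =>
  ((S.g x (Z.1 x) (W.1 x) - S.g x (Z.2 x) (W.2 x) : ℝ) : ℂ)
    + Complex.I * ((S.g x (Z.1 x) (W.2 x) + S.g x (Z.2 x) (W.1 x) : ℝ) : ℂ)

/-- The complex bilinear extension of the Levi-Civita connection, `∇_Z W`. -/
def covC (Z W : CVF M) : CVF M :=
  (fun x => S.nabla W.1 x (Z.1 x) - S.nabla W.2 x (Z.2 x),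
   fun x => S.nabla W.2 x (Z.1 x) + S.nabla W.1 x (Z.2 x))

/-- The curvature `R(X,Y)Z = ∇_X ∇_Y Z - ∇_Y ∇_X Z - ∇_{[X,Y]} Z`. -/
def curv (X Y Z : CVF M) : CVF M :=
  S.covC X (S.covC Y Z) - S.covC Y (S.covC X Z) - S.covC (X.bracket Y) Z

end Spacetime

/-! ### Spin dyads

A spin dyad `(o, ι)` with `o_A ι^A = 1` trivializes the spin bundle; spinors are represented by their
components in the dyad (index `0` for `o`, index `1` for `ι`), and the identification
`S ⊗ S̄ = TM ⊗ ℂ` is given by the null tetrad `l = o ō`, `m = o ῑ`, `m̄ = ι ō`, `n = ι ῑ`. -/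

/-- The components of `ε_{AB}` (and also of `ε^{AB}`) in a normalized dyad. -/
def eps (A B : Fin 2) : ℂ := if A = 0 ∧ B = 1 then 1 else if A = 1 ∧ B = 0 then -1 else 0

/-- The components of `o_A = o^B ε_{BA}` in the dyad; the same numbers are the components
of `ō_{A'}` in the conjugate dyad. -/
def oLow (A : Fin 2) : ℂ := eps 0 A

/-- The components of `ι_A = ι^B ε_{BA}` in the dyad; the same numbers are the components
of `ῑ_{A'}` in the conjugate dyad. -/
def iotaLow (A : Fin 2) : ℂ := eps 1 A

/-- The complex vector fields `e_{AA'}`: `e_{00'} = l`, `e_{01'} = m`, `e_{10'} = m̄`,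
`e_{11'} = n`. -/
def tetrad (l n : VF M) (m : CVF M) (A A' : Fin 2) : CVF M :=
  if A = 0 then (if A' = 0 then CVF.ofReal l else m)
  else (if A' = 0 then m.conj else CVF.ofReal n)

/-- A smooth spin dyad of a spacetime, given by its null tetrad.  The normalization is
`g_{ab} = ε_{AB} ε̄_{A'B'}`, that is `g(l,n) = 1`, `g(m,m̄) = -1`, all other products zero. -/
structure SpinDyad (S : Spacetime M) where
  l : VF M
  n : VF M
  m : CVF M
  l_smooth : SmoothVF l
  n_smooth : SmoothVF n
  m_re_smooth : SmoothVF m.1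
  m_im_smooth : SmoothVF m.2
  normalized : ∀ (A A' B B' : Fin 2) (x : M),
    S.gC (tetrad l n m A A') (tetrad l n m B B') x = eps A B * eps A' B'

/-- The components, in the dyad, of a spinor field with `k` lower unprimed and `k'` lower primed
indices. -/
abbrev SpinorField (M : Type*) (k k' : ℕ) : Type _ := (Fin k → Fin 2) → (Fin k' → Fin 2) → M → ℂ

namespace SpinDyad

variable {S : Spacetime M} (D : SpinDyad S)

/-- The frame `e_{AA'}`. -/
def e (A A' : Fin 2) : CVF M := tetrad D.l D.n D.m A A'

/-! ### Spin coefficients and the spin connection -/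

/-- `ρ = m^a δ' l_a`. -/
def rho : M → ℂ := S.gC D.m (S.covC D.m.conj (CVF.ofReal D.l))

/-- `τ = m^a D' l_a`. -/
def tau : M → ℂ := S.gC D.m (S.covC (CVF.ofReal D.n) (CVF.ofReal D.l))

/-- `ρ' = m̄^a δ n_a`. -/
def rho' : M → ℂ := S.gC D.m.conj (S.covC D.m (CVF.ofReal D.n))

/-- `τ' = m̄^a D n_a`. -/
def tau' : M → ℂ := S.gC D.m.conj (S.covC (CVF.ofReal D.l) (CVF.ofReal D.n))

/-- `σ' = m̄^a δ' n_a`. -/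
def sigma' : M → ℂ := S.gC D.m.conj (S.covC D.m.conj (CVF.ofReal D.n))

/-- The coefficient of `o` in `∇_{AA'} o`:
`ι^B ∇_{AA'} o_B = ½ (n^b ∇_{AA'} l_b - m̄^b ∇_{AA'} m_b)`.  The four values are the spin
coefficients `ε, β, α = -β', γ = -ε'` for `AA' = 00', 01', 10', 11'`. -/
def omega (A A' : Fin 2) : M → ℂ := fun x =>
  (1 / 2 : ℂ) * (S.gC (CVF.ofReal D.n) (S.covC (D.e A A') (CVF.ofReal D.l)) x
    - S.gC D.m.conj (S.covC (D.e A A') D.m) x)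

/-- The spin connection determined by the Levi-Civita connection:
`∇_{AA'} δ_B = ∑ C, spinConn A A' B C • δ_C`, where `δ_0 = o` and `δ_1 = ι`. Explicitly
`∇_a o = ω_a o - (m^b ∇_a l_b) ι` and `∇_a ι = -(m̄^b ∇_a n_b) o - ω_a ι`. -/
def spinConn (A A' B C : Fin 2) : M → ℂ :=
  if B = 0 then
    (if C = 0 then D.omega A A' else -S.gC D.m (S.covC (D.e A A') (CVF.ofReal D.l)))
  else
    (if C = 0 then -S.gC D.m.conj (S.covC (D.e A A') (CVF.ofReal D.n)) else -D.omega A A')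

/-- The conjugate spin connection on primed spinors; note that `e_{AA'}` has complex conjugate
`e_{A'A}`. -/
def spinConnBar (A A' B' C' : Fin 2) : M → ℂ := bar (D.spinConn A' A B' C')

/-- The spinor covariant derivative
`(∇T)_{A B₁…B_k A' B'₁…B'_k'} = ∇_{AA'} T_{B₁…B_k B'₁…B'_k'}`; the index of the derivative comes
first in both lists. -/
def nablaSp {k k' : ℕ} (T : SpinorField M k k') : SpinorField M (k + 1) (k' + 1) :=
  fun u v x =>
    (D.e (u 0) (v 0)).deriv (T (Fin.tail u) (Fin.tail v)) x
      - ∑ i : Fin k, ∑ C : Fin 2, D.spinConn (u 0) (v 0) (Fin.tail u i) C x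
          * T (Function.update (Fin.tail u) i C) (Fin.tail v) x
      - ∑ i : Fin k', ∑ C : Fin 2, D.spinConnBar (u 0) (v 0) (Fin.tail v i) C x
          * T (Fin.tail u) (Function.update (Fin.tail v) i C) x

/-! ### Weighted derivatives on scalars -/

/-- The components `Θ_{AA'} η` of the GHP covariant derivative of a scalar of weight `{p,q}`. -/
def Theta (p q : ℤ) (A A' : Fin 2) (η : M → ℂ) : M → ℂ := fun x =>
  (D.e A A').deriv η x - p * D.omega A A' x * η x - q * bar (D.omega A' A) x * η x

/-- `þ` on scalars of weight `{p,q}`. -/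
def tho (p q : ℤ) (η : M → ℂ) : M → ℂ := D.Theta p q 0 0 η

/-- `ð` on scalars of weight `{p,q}`. -/
def edt (p q : ℤ) (η : M → ℂ) : M → ℂ := D.Theta p q 0 1 η

/-- `ð'` on scalars of weight `{p,q}`. -/
def edt' (p q : ℤ) (η : M → ℂ) : M → ℂ := D.Theta p q 1 0 η

/-- `þ'` on scalars of weight `{p,q}`. -/
def tho' (p q : ℤ) (η : M → ℂ) : M → ℂ := D.Theta p q 1 1 η

/-! ### Curvature spinors -/

/-- The components of the Riemann tensor, `R_{abcd} X^a Y^b Z^c W^d = g(R(X,Y)Z, W)`. -/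
def riem (A A' B B' C C' E E' : Fin 2) : M → ℂ :=
  S.gC (S.curv (D.e A A') (D.e B B') (D.e C C')) (D.e E E')

/-- The components of the Ricci tensor `R_{ac} = g^{bd} R_{abcd}`. -/
def ricci (A A' C C' : Fin 2) : M → ℂ := fun x =>
  ∑ B : Fin 2, ∑ B' : Fin 2, ∑ E : Fin 2, ∑ E' : Fin 2,
    eps B E * eps B' E' * D.riem A A' B B' C C' E E' x

/-- The scalar curvature `R = g^{ab} R_{ab}`. -/
def scalarCurv : M → ℂ := fun x =>
  ∑ A : Fin 2, ∑ A' : Fin 2, ∑ B : Fin 2, ∑ B' : Fin 2,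
    eps A B * eps A' B' * D.ricci A A' B B' x

/-- The trace-free Ricci spinor `Φ_{ABA'B'} = -½ (R_{ab} - ¼ R g_{ab})`. -/
def Phi (A A' B B' : Fin 2) : M → ℂ := fun x =>
  -(1 / 2 : ℂ) * (D.ricci A A' B B' x - (1 / 4 : ℂ) * D.scalarCurv x * (eps A B * eps A' B'))

/-- Total symmetrization over four unprimed indices. -/
def sym4 (T : (Fin 4 → Fin 2) → M → ℂ) : (Fin 4 → Fin 2) → M → ℂ := fun u x =>
  (1 / 24 : ℂ) * ∑ s : Equiv.Perm (Fin 4), T (u ∘ s) x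

/-- The Weyl spinor `Ψ_{ABCD} = X_{(ABCD)}`, `X_{ABCD} = ¼ R_{AA'B}{}^{A'}{}_{CC'D}{}^{C'}`. -/
def weyl : (Fin 4 → Fin 2) → M → ℂ :=
  sym4 fun u x => (1 / 4 : ℂ) * ∑ A' : Fin 2, ∑ B' : Fin 2, ∑ C' : Fin 2, ∑ E' : Fin 2,
    eps A' B' * eps C' E' * D.riem (u 0) A' (u 1) B' (u 2) C' (u 3) E' x

/-- `Ψ₀ = Ψ_{ABCD} o^A o^B o^C o^D`. -/
def Psi0 : M → ℂ := D.weyl ![0, 0, 0, 0]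

/-- `Ψ₁ = Ψ_{ABCD} o^A o^B o^C ι^D`. -/
def Psi1 : M → ℂ := D.weyl ![0, 0, 0, 1]

/-- `Ψ₂ = Ψ_{ABCD} o^A o^B ι^C ι^D`. -/
def Psi2 : M → ℂ := D.weyl ![0, 0, 1, 1]

/-- `Ψ₃ = Ψ_{ABCD} o^A ι^B ι^C ι^D`. -/
def Psi3 : M → ℂ := D.weyl ![0, 1, 1, 1]

/-- The Einstein condition: `Φ_{ABA'B'} = 0` and `R/24` is the constant `Λ`. -/
def IsEinstein (Λ : ℝ) : Prop :=
  (∀ (A A' B B' : Fin 2) (x : M), D.Phi A A' B B' x = 0) ∧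
    ∀ x : M, D.scalarCurv x / 24 = (Λ : ℂ)

/-- Petrov type II with repeated principal spinor `o`: `Ψ₀ = Ψ₁ = 0` and `Ψ₂ ≠ 0`. -/
def IsTypeII : Prop := ∀ x : M, D.Psi0 x = 0 ∧ D.Psi1 x = 0 ∧ D.Psi2 x ≠ 0

/-! ### Debye potentials and the Debye metric -/

/-- `O†χ = 2[(þ'-ρ̄')(þ+3ρ) - (ð'-τ̄)(ð+3τ) - 3Ψ₂]χ` on scalars of weight `{-4,0}`. -/
def debyeOp (χ : M → ℂ) : M → ℂ :=
  let a := D.tho (-4) 0 χ + 3 * D.rho * χ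
  let b := D.edt (-4) 0 χ + 3 * D.tau * χ
  2 * ((D.tho' (-3) 1 a - bar D.rho' * a) - (D.edt' (-3) (-1) b - bar D.tau * b)
    - 3 * D.Psi2 * χ)

/-- `h_{nn} = -(ð+2τ)ðχ - σ̄'þχ`. -/
def hnn (χ : M → ℂ) : M → ℂ :=
  -(D.edt (-3) (-1) (D.edt (-4) 0 χ) + 2 * D.tau * D.edt (-4) 0 χ)
    - bar D.sigma' * D.tho (-4) 0 χ

/-- `h_{nm̄} = -(þ+ρ)ðχ - (τ+τ̄')þχ`. -/
def hnmb (χ : M → ℂ) : M → ℂ :=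
  -(D.tho (-3) (-1) (D.edt (-4) 0 χ) + D.rho * D.edt (-4) 0 χ)
    - (D.tau + bar D.tau') * D.tho (-4) 0 χ

/-- `h_{m̄m̄} = -(þ+2ρ)þχ`. -/
def hmbmb (χ : M → ℂ) : M → ℂ :=
  -(D.tho (-3) 1 (D.tho (-4) 0 χ) + 2 * D.rho * D.tho (-4) 0 χ)

/-- The components `l_{AA'} = o_A ō_{A'}`. -/
def lLow (A A' : Fin 2) : ℂ := oLow A * oLow A'

/-- The components `m_{AA'} = o_A ῑ_{A'}`. -/
def mLow (A A' : Fin 2) : ℂ := oLow A * iotaLow A'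

/-- The Debye metric `h_{ab} = h_{nn} l_a l_b - 2 h_{nm̄} l_{(a} m_{b)} + h_{m̄m̄} m_a m_b`
as a spinor field `h_{ABA'B'}`. -/
def debyeMetric (χ : M → ℂ) : SpinorField M 2 2 := fun u v x =>
  D.hnn χ x * (lLow (u 0) (v 0) * lLow (u 1) (v 1))
    - D.hnmb χ x * (lLow (u 0) (v 0) * mLow (u 1) (v 1) + mLow (u 0) (v 0) * lLow (u 1) (v 1))
    + D.hmbmb χ x * (mLow (u 0) (v 0) * mLow (u 1) (v 1))

/-- The trace `g^{ef} h_{ef}` of a symmetric tensor `h_{ABA'B'}`. -/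
def trace (h : SpinorField M 2 2) : M → ℂ := fun x =>
  ∑ A : Fin 2, ∑ B : Fin 2, ∑ A' : Fin 2, ∑ B' : Fin 2,
    eps A B * eps A' B' * h ![A, B] ![A', B'] x

/-- The anti-self-dual linearized Weyl spinor
`Ψ̇_{ABCD} = ½ ∇_{(A}{}^{A'} ∇_{B}{}^{B'} h_{CD)A'B'} + ¼ g^{ef} h_{ef} Ψ_{ABCD}`. -/
def linWeyl (h : SpinorField M 2 2) : (Fin 4 → Fin 2) → M → ℂ := fun u x =>
  (1 / 2 : ℂ) * sym4 (fun w y =>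
      ∑ A' : Fin 2, ∑ P' : Fin 2, ∑ B' : Fin 2, ∑ Q' : Fin 2,
        eps A' P' * eps B' Q' * D.nablaSp (D.nablaSp h) w ![P', Q', A', B'] y) u x
    + (1 / 4 : ℂ) * trace h x * D.weyl u x

/-! ### The projected Killing spinor and vector -/

/-- `K_{AB} = φ⁻¹ o_{(A} ι_{B)} - ⅓ φ⁻⁴ Ψ₃ o_A o_B`, where `φ = Ψ₂^{1/3}`. -/
def killingSpinor (φ : M → ℂ) : SpinorField M 2 0 := fun u _ x =>
  (φ x)⁻¹ * ((1 / 2 : ℂ) * (oLow (u 0) * iotaLow (u 1) + iotaLow (u 0) * oLow (u 1)))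
    - (1 / 3 : ℂ) * (φ x ^ 4)⁻¹ * D.Psi3 x * (oLow (u 0) * oLow (u 1))

/-- `ξ_{AA'} = ∇^B{}_{A'} K_{AB} = ε^{BC} ∇_{CA'} K_{AB}`. -/
def xi (φ : M → ℂ) (A A' : Fin 2) : M → ℂ := fun x =>
  ∑ B : Fin 2, ∑ C : Fin 2,
    eps B C * D.nablaSp (D.killingSpinor φ) ![C, A, B] ![A'] x

/-- `ξ^a Θ_a η` for a scalar `η` of weight `{p,q}`. -/
def xiTheta (φ : M → ℂ) (p q : ℤ) (η : M → ℂ) : M → ℂ := fun x =>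
  ∑ A : Fin 2, ∑ A' : Fin 2, ∑ B : Fin 2, ∑ B' : Fin 2,
    eps A B * eps A' B' * D.xi φ B B' x * D.Theta p q A A' η x

end SpinDyad

end GHP

end

open scoped Manifold ContDiff

set_option linter.unusedSimpArgs false

noncomputable section

namespace GHP

variable {M : Type*} [TopologicalSpace M] [ChartedSpace (EuclideanSpace ℝ (Fin 4)) M]

/-! ### The algebra of smooth complex functions -/

namespace SmoothFn

variable {f g : M → ℂ}

theorem mdiffAt (hf : SmoothFn f) (x : M) : MDifferentiableAt (𝓡 4) 𝓘(ℝ, ℂ) f x :=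
  (ContMDiff.mdifferentiable hf (by simp)) x

theorem const (c : ℂ) : SmoothFn (fun _ : M => c) := contMDiff_const

theorem add (hf : SmoothFn f) (hg : SmoothFn g) : SmoothFn (f + g) :=
  ContMDiff.add (I := 𝓘(ℝ, ℂ)) hf hg

theorem mul (hf : SmoothFn f) (hg : SmoothFn g) : SmoothFn (f * g) := by
  have h : ContMDiff (𝓡 4) 𝓘(ℝ, ℂ × ℂ) ∞ (fun x => (f x, g x)) := ContMDiff.prodMk_space hf hg
  exact (contDiff_mul (𝕜 := ℝ) (𝔸 := ℂ) (n := ∞)).comp_contMDiff h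

theorem bar (hf : SmoothFn f) : SmoothFn (bar f) :=
  (Complex.conjCLE.contDiff (n := ∞)).comp_contMDiff hf

theorem inv (hf : SmoothFn f) (h0 : ∀ x, f x ≠ 0) : SmoothFn (fun x => (f x)⁻¹) := fun x =>
  ContDiffAt.comp_contMDiffAt (g := fun z : ℂ => z⁻¹) (contDiffAt_inv ℝ (h0 x)) (hf x)

theorem ofReal {r : M → ℝ} (hr : ContMDiff (𝓡 4) 𝓘(ℝ, ℝ) ∞ r) :
    SmoothFn (fun x => ((r x : ℝ) : ℂ)) :=
  (Complex.ofRealCLM.contDiff (n := ∞)).comp_contMDiff hr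

theorem re (hf : SmoothFn f) : ContMDiff (𝓡 4) 𝓘(ℝ, ℝ) ∞ (fun x => (f x).re) :=
  (Complex.reCLM.contDiff (n := ∞)).comp_contMDiff hf

theorem im (hf : SmoothFn f) : ContMDiff (𝓡 4) 𝓘(ℝ, ℝ) ∞ (fun x => (f x).im) :=
  (Complex.imCLM.contDiff (n := ∞)).comp_contMDiff hf

end SmoothFn

variable (M) in
/-- The algebra of smooth complex functions. -/
def smoothAlg : Subalgebra ℂ (M → ℂ) where
  carrier := {f | SmoothFn f}
  mul_mem' := fun hf hg => SmoothFn.mul hf hg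
  add_mem' := fun hf hg => SmoothFn.add hf hg
  algebraMap_mem' := fun c => SmoothFn.const c

/-- Complex conjugation of smooth functions. -/
def smoothAlg.conj : smoothAlg M →+* smoothAlg M where
  toFun f := ⟨bar f.1, SmoothFn.bar f.2⟩
  map_one' := by ext x; simp [bar]
  map_mul' f g := by ext x; simp [bar]
  map_zero' := by ext x; simp [bar]
  map_add' f g := by ext x; simp [bar]

/-! ### Derivatives along complex vector fields -/

theorem mvfderiv_add_apply {f g : M → ℂ} (hf : SmoothFn f) (hg : SmoothFn g) (x : M)
    (v : TangentSpace (𝓡 4) x) :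
    mvfderiv (𝓡 4) (f + g) x v = mvfderiv (𝓡 4) f x v + mvfderiv (𝓡 4) g x v := by
  rw [mvfderiv_add (hf.mdiffAt x) (hg.mdiffAt x)]; rfl

theorem mvfderiv_mul_apply {f g : M → ℂ} (hf : SmoothFn f) (hg : SmoothFn g) (x : M)
    (v : TangentSpace (𝓡 4) x) :
    mvfderiv (𝓡 4) (f * g) x v = f x * mvfderiv (𝓡 4) g x v + g x * mvfderiv (𝓡 4) f x v := by
  have h := ((hf.mdiffAt x).hasMFDerivAt.mul (hg.mdiffAt x).hasMFDerivAt).mfderiv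
  simp only [mvfderiv]
  erw [h]
  rfl

theorem mvfderiv_clm_comp {F : Type*} [NormedAddCommGroup F] [NormedSpace ℝ F]
    {G : Type*} [NormedAddCommGroup G] [NormedSpace ℝ G] (L : F →L[ℝ] G)
    {f : M → F} {x : M} (hf : MDifferentiableAt (𝓡 4) 𝓘(ℝ, F) f x)
    (v : TangentSpace (𝓡 4) x) :
    mvfderiv (𝓡 4) (fun y => L (f y)) x v = L (mvfderiv (𝓡 4) f x v) := by
  have h := (HasMFDerivAt.comp (I' := 𝓘(ℝ, F)) x (L.hasMFDerivAt (x := f x)) hf.hasMFDerivAt).mfderiv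
  simp only [mvfderiv]
  erw [h]
  rfl

theorem smoothFn_mvfderiv [IsManifold (𝓡 4) ∞ M] {f : M → ℂ} (hf : SmoothFn f) {X : VF M}
    (hX : SmoothVF X) : SmoothFn (fun x => mvfderiv (𝓡 4) f x (X x)) := by
  have : IsManifold (𝓡 4) 1 M := .of_le (n := ∞) (by norm_num)
  have h1 := ContMDiff.contMDiff_tangentMap (m := ∞) hf (by simp)
  have h2 := h1.comp hX
  exact (contMDiff_snd_tangentBundle_modelSpace (n := ∞) ℂ 𝓘(ℝ, ℂ)).comp h2

/-- Smoothness of a complex vector field. -/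
def SmoothCVF [IsManifold (𝓡 4) ∞ M] (Z : CVF M) : Prop := SmoothVF Z.1 ∧ SmoothVF Z.2

namespace CVF

variable (Z : CVF M)

theorem deriv_const (c : ℂ) : Z.deriv (fun _ => c) = 0 := by
  ext x
  simp [CVF.deriv, mvfderiv_const]

theorem deriv_add {f g : M → ℂ} (hf : SmoothFn f) (hg : SmoothFn g) :
    Z.deriv (f + g) = Z.deriv f + Z.deriv g := by
  ext x
  simp only [CVF.deriv, mvfderiv_add_apply hf hg, Pi.add_apply]
  ring

theorem deriv_mul {f g : M → ℂ} (hf : SmoothFn f) (hg : SmoothFn g) :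
    Z.deriv (f * g) = f * Z.deriv g + g * Z.deriv f := by
  ext x
  simp only [CVF.deriv, mvfderiv_mul_apply hf hg, Pi.add_apply, Pi.mul_apply]
  ring

theorem bar_deriv {f : M → ℂ} (hf : SmoothFn f) : bar (Z.deriv f) = Z.conj.deriv (bar f) := by
  ext x
  have h := mvfderiv_clm_comp (Complex.conjCLE : ℂ →L[ℝ] ℂ) (hf.mdiffAt x)
  have h' : ∀ v, mvfderiv (𝓡 4) (bar f) x v = (starRingEnd ℂ) (mvfderiv (𝓡 4) f x v) := h
  simp only [CVF.deriv, bar, CVF.conj, Pi.neg_apply, map_neg, map_add, map_mul, Complex.conj_I]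
  change _ = mvfderiv (𝓡 4) (bar f) x _ + _ * -mvfderiv (𝓡 4) (bar f) x _
  rw [h', h']
  ring

theorem smoothFn_deriv [IsManifold (𝓡 4) ∞ M] {Z : CVF M} (hZ : SmoothCVF Z) {f : M → ℂ}
    (hf : SmoothFn f) : SmoothFn (Z.deriv f) :=
  (smoothFn_mvfderiv hf hZ.1).add ((SmoothFn.const Complex.I).mul (smoothFn_mvfderiv hf hZ.2))

/-- A smooth complex vector field as a derivation of the algebra of smooth functions. -/
def derivation [IsManifold (𝓡 4) ∞ M] (Z : CVF M) (hZ : SmoothCVF Z) :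
    Derivation ℂ (smoothAlg M) (smoothAlg M) :=
  Derivation.mk'
    { toFun := fun f => ⟨Z.deriv f.1, smoothFn_deriv hZ f.2⟩
      map_add' := fun f g => Subtype.ext (Z.deriv_add f.2 g.2)
      map_smul' := fun c f => by
        refine Subtype.ext ?_
        have h := Z.deriv_mul (SmoothFn.const c) f.2
        rw [Z.deriv_const, mul_zero, add_zero] at h
        exact h }
    (fun f g => Subtype.ext (Z.deriv_mul f.2 g.2))

theorem coe_derivation [IsManifold (𝓡 4) ∞ M] {Z : CVF M} (hZ : SmoothCVF Z) (f : smoothAlg M) :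
    (Z.derivation hZ f : M → ℂ) = Z.deriv f := rfl

end CVF

theorem mvfderiv_complex {r i : M → ℝ} (hr : ContMDiff (𝓡 4) 𝓘(ℝ, ℝ) ∞ r)
    (hi : ContMDiff (𝓡 4) 𝓘(ℝ, ℝ) ∞ i) (x : M) (v : TangentSpace (𝓡 4) x) :
    mvfderiv (𝓡 4) (fun y => ((r y : ℝ) : ℂ) + Complex.I * ((i y : ℝ) : ℂ)) x v
      = ((mvfderiv (𝓡 4) r x v : ℝ) : ℂ) + Complex.I * ((mvfderiv (𝓡 4) i x v : ℝ) : ℂ) := by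
  have e1 := mvfderiv_clm_comp Complex.ofRealCLM ((hr.mdifferentiable (by simp)) x) v
  have e2 := mvfderiv_clm_comp Complex.ofRealCLM ((hi.mdifferentiable (by simp)) x) v
  have h1 := SmoothFn.ofReal hr
  have h2 := SmoothFn.ofReal hi
  have h := mvfderiv_add_apply h1 ((SmoothFn.const Complex.I).mul h2) x v
  rw [mvfderiv_mul_apply (SmoothFn.const Complex.I) h2, mvfderiv_const] at h
  simp only [Complex.ofRealCLM_apply] at e1 e2
  rw [e1, e2, _root_.zero_apply, mul_zero, add_zero] at h
  exact h

theorem mvfderiv_re_im {f : M → ℂ} (hf : SmoothFn f) (x : M) (v : TangentSpace (𝓡 4) x) :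
    mvfderiv (𝓡 4) f x v = ((mvfderiv (𝓡 4) (fun y => (f y).re) x v : ℝ) : ℂ)
      + Complex.I * ((mvfderiv (𝓡 4) (fun y => (f y).im) x v : ℝ) : ℂ) := by
  rw [← mvfderiv_complex hf.re hf.im]
  have e : (fun y => (((f y).re : ℝ) : ℂ) + Complex.I * (((f y).im : ℝ) : ℂ)) = f := by
    ext y
    rw [mul_comm]; exact Complex.re_add_im (f y)
  rw [e]

end GHP
end

noncomputable section

namespace GHP

variable {M : Type*} [TopologicalSpace M] [ChartedSpace (EuclideanSpace ℝ (Fin 4)) M]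
  [IsManifold (𝓡 4) ∞ M]

/-! ### Smooth vector fields and their brackets -/

namespace SmoothVF

variable {X Y Z : VF M}

theorem minSmoothness_le (n : ℕ) : minSmoothness ℝ (n : ℕ∞ω) ≤ ∞ := by
  rw [minSmoothness_of_isRCLikeNormedField]; exact mod_cast le_top

theorem isManifold_of_le (n : ℕ) : IsManifold (𝓡 4) n M :=
  .of_le (n := ∞) (mod_cast le_top)

theorem mdiffAt (hX : SmoothVF X) (x : M) :
    MDifferentiableAt (𝓡 4) (𝓡 4).tangent (fun y => (⟨y, X y⟩ : TangentBundle (𝓡 4) M)) x :=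
  (ContMDiff.mdifferentiable hX (by simp)) x

theorem zero : SmoothVF (0 : VF M) :=
  Bundle.contMDiff_zeroSection ℝ (fun x : M => TangentSpace (𝓡 4) x)

theorem add (hX : SmoothVF X) (hY : SmoothVF Y) : SmoothVF (X + Y) := by
  have : IsManifold (𝓡 4) 1 M := .of_le (n := ∞) (by norm_num)
  exact ContMDiff.add_section (F := EuclideanSpace ℝ (Fin 4)) hX hY

theorem smul {f : M → ℝ} (hf : ContMDiff (𝓡 4) 𝓘(ℝ, ℝ) ∞ f) (hX : SmoothVF X) :
    SmoothVF (f • X) := by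
  have : IsManifold (𝓡 4) 1 M := .of_le (n := ∞) (by norm_num)
  exact ContMDiff.smul_section (F := EuclideanSpace ℝ (Fin 4)) hf hX

theorem neg (hX : SmoothVF X) : SmoothVF (-X) := by
  have h := smul (f := fun _ => (-1 : ℝ)) contMDiff_const hX
  have e : (fun _ : M => (-1 : ℝ)) • X = -X := by ext1 x; simp
  rwa [e] at h

theorem sub (hX : SmoothVF X) (hY : SmoothVF Y) : SmoothVF (X - Y) := by
  rw [sub_eq_add_neg]; exact hX.add hY.neg

theorem bracket (hX : SmoothVF X) (hY : SmoothVF Y) :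
    SmoothVF (VectorField.mlieBracket (𝓡 4) X Y) := by
  have : IsManifold (𝓡 4) (minSmoothness ℝ 2) M := .of_le (n := ∞) (minSmoothness_le 2)
  have : IsManifold (𝓡 4) (((⊤ : ℕ∞) : ℕ∞ω) + 1) M := .of_le (n := ∞) (by simp)
  exact ContDiff.mlieBracket_vectorField (m := ⊤) (n := ⊤) hX hY (by simp)

theorem jacobi (hX : SmoothVF X) (hY : SmoothVF Y) (hZ : SmoothVF Z) :
    VectorField.mlieBracket (𝓡 4) X (VectorField.mlieBracket (𝓡 4) Y Z)
      = VectorField.mlieBracket (𝓡 4) (VectorField.mlieBracket (𝓡 4) X Y) Z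
        + VectorField.mlieBracket (𝓡 4) Y (VectorField.mlieBracket (𝓡 4) X Z) := by
  have : IsManifold (𝓡 4) (minSmoothness ℝ 3) M := .of_le (n := ∞) (minSmoothness_le 3)
  ext1 x
  have h : minSmoothness ℝ 2 ≤ (∞ : ℕ∞ω) := minSmoothness_le 2
  exact VectorField.leibniz_identity_mlieBracket_apply ((hX x).of_le h) ((hY x).of_le h)
    ((hZ x).of_le h)

theorem bracket_add_left (hX : SmoothVF X) (hY : SmoothVF Y) :
    VectorField.mlieBracket (𝓡 4) (X + Y) Z
      = VectorField.mlieBracket (𝓡 4) X Z + VectorField.mlieBracket (𝓡 4) Y Z := by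
  have : IsManifold (𝓡 4) 2 M := isManifold_of_le 2
  have : IsManifold (𝓡 4) (minSmoothness ℝ 2) M := .of_le (n := ∞) (minSmoothness_le 2)
  ext1 x
  exact VectorField.mlieBracket_add_left (hX.mdiffAt x) (hY.mdiffAt x)

theorem bracket_smul_right {f : M → ℝ} (hf : ContMDiff (𝓡 4) 𝓘(ℝ, ℝ) ∞ f) (hY : SmoothVF Y) :
    VectorField.mlieBracket (𝓡 4) X (f • Y)
      = (fun x => mvfderiv (𝓡 4) f x (X x)) • Y + f • VectorField.mlieBracket (𝓡 4) X Y := by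
  have : IsManifold (𝓡 4) 2 M := isManifold_of_le 2
  ext1 x
  exact VectorField.mlieBracket_smul_right ((hf.mdifferentiable (by simp)) x) (hY.mdiffAt x)

end SmoothVF

theorem contMDiff_mvfderiv {f : M → ℝ} (hf : ContMDiff (𝓡 4) 𝓘(ℝ, ℝ) ∞ f) {X : VF M}
    (hX : SmoothVF X) : ContMDiff (𝓡 4) 𝓘(ℝ, ℝ) ∞ (fun x => mvfderiv (𝓡 4) f x (X x)) := by
  have : IsManifold (𝓡 4) 1 M := .of_le (n := ∞) (by norm_num)
  have h1 := ContMDiff.contMDiff_tangentMap (m := ∞) hf (by simp)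
  exact (contMDiff_snd_tangentBundle_modelSpace (n := ∞) ℝ 𝓘(ℝ, ℝ)).comp (h1.comp hX)

/-- The Lie bracket acts on functions as the commutator, as soon as there is a
nowhere vanishing smooth vector field. -/
theorem mvfderiv_bracket {X Y Z : VF M} (hX : SmoothVF X) (hY : SmoothVF Y) (hZ : SmoothVF Z)
    (hZ0 : ∀ x, Z x ≠ 0) {f : M → ℝ} (hf : ContMDiff (𝓡 4) 𝓘(ℝ, ℝ) ∞ f) (x : M) :
    mvfderiv (𝓡 4) f x (VectorField.mlieBracket (𝓡 4) X Y x)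
      = mvfderiv (𝓡 4) (fun y => mvfderiv (𝓡 4) f y (Y y)) x (X x)
        - mvfderiv (𝓡 4) (fun y => mvfderiv (𝓡 4) f y (X y)) x (Y x) := by
  have hXf := contMDiff_mvfderiv hf hX
  have hYf := contMDiff_mvfderiv hf hY
  have swap (A B : VF M) : VectorField.mlieBracket (𝓡 4) A B
      = -VectorField.mlieBracket (𝓡 4) B A := VectorField.mlieBracket_swap
  have add_right {A B C : VF M} (hA : SmoothVF A) (hB : SmoothVF B) :
      VectorField.mlieBracket (𝓡 4) C (A + B)
        = VectorField.mlieBracket (𝓡 4) C A + VectorField.mlieBracket (𝓡 4) C B := by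
    rw [swap, SmoothVF.bracket_add_left hA hB, swap A, swap B]; abel
  have h1 := congrFun (SmoothVF.jacobi hX hY (hZ.smul hf)) x
  have h2 := congrFun (SmoothVF.jacobi hX hY hZ) x
  rw [SmoothVF.bracket_smul_right hf hZ, SmoothVF.bracket_smul_right hf hZ,
    SmoothVF.bracket_smul_right hf hZ,
    add_right (hZ.smul hYf) ((hY.bracket hZ).smul hf),
    add_right (hZ.smul hXf) ((hX.bracket hZ).smul hf),
    SmoothVF.bracket_smul_right hYf hZ, SmoothVF.bracket_smul_right hf (hY.bracket hZ),
    SmoothVF.bracket_smul_right hXf hZ, SmoothVF.bracket_smul_right hf (hX.bracket hZ)] at h1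
  simp only [Pi.add_apply, Pi.smul_apply'] at h1 h2
  rw [h2] at h1
  have h3 : (mvfderiv (𝓡 4) f x (VectorField.mlieBracket (𝓡 4) X Y x)
      - (mvfderiv (𝓡 4) (fun y => mvfderiv (𝓡 4) f y (Y y)) x (X x)
        - mvfderiv (𝓡 4) (fun y => mvfderiv (𝓡 4) f y (X y)) x (Y x))) • Z x = 0 := by
    rw [← neg_eq_zero, ← sub_eq_zero.2 h1]
    module
  exact sub_eq_zero.1 ((smul_eq_zero.1 h3).resolve_right (hZ0 x))

end GHP
end

noncomputable section

namespace GHP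

variable {M : Type*} [TopologicalSpace M] [ChartedSpace (EuclideanSpace ℝ (Fin 4)) M]
  [IsManifold (𝓡 4) ∞ M]

/-! ### Complexified calculus -/

namespace SmoothCVF

variable {Z W : CVF M}

theorem ofReal {X : VF M} (hX : SmoothVF X) : SmoothCVF (CVF.ofReal X) := ⟨hX, SmoothVF.zero⟩

theorem conj (hZ : SmoothCVF Z) : SmoothCVF Z.conj := ⟨hZ.1, hZ.2.neg⟩

theorem bracket (hZ : SmoothCVF Z) (hW : SmoothCVF W) : SmoothCVF (Z.bracket W) :=
  ⟨(hZ.1.bracket hW.1).sub (hZ.2.bracket hW.2), (hZ.1.bracket hW.2).add (hZ.2.bracket hW.1)⟩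

end SmoothCVF

theorem SmoothVF.bracket_add_right {X Y Z : VF M} (hX : SmoothVF X) (hY : SmoothVF Y) :
    VectorField.mlieBracket (𝓡 4) Z (X + Y)
      = VectorField.mlieBracket (𝓡 4) Z X + VectorField.mlieBracket (𝓡 4) Z Y := by
  have swap (A B : VF M) : VectorField.mlieBracket (𝓡 4) A B
      = -VectorField.mlieBracket (𝓡 4) B A := VectorField.mlieBracket_swap
  rw [swap, SmoothVF.bracket_add_left hX hY, swap X, swap Y]; abel

theorem SmoothVF.bracket_neg_right {X Z : VF M} (hX : SmoothVF X) :
    VectorField.mlieBracket (𝓡 4) Z (-X) = -VectorField.mlieBracket (𝓡 4) Z X := by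
  have h := SmoothVF.bracket_add_right (Z := Z) hX hX.neg
  rw [add_neg_cancel, VectorField.mlieBracket_zero_right] at h
  exact (neg_eq_of_add_eq_zero_right h.symm).symm

theorem SmoothVF.bracket_sub_right {X Y Z : VF M} (hX : SmoothVF X) (hY : SmoothVF Y) :
    VectorField.mlieBracket (𝓡 4) Z (X - Y)
      = VectorField.mlieBracket (𝓡 4) Z X - VectorField.mlieBracket (𝓡 4) Z Y := by
  rw [sub_eq_add_neg, bracket_add_right hX hY.neg, bracket_neg_right hY, sub_eq_add_neg]

theorem CVF.jacobi {X Y Z : CVF M} (hX : SmoothCVF X) (hY : SmoothCVF Y) (hZ : SmoothCVF Z) :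
    X.bracket (Y.bracket Z) + Y.bracket (Z.bracket X) + Z.bracket (X.bracket Y) = 0 := by
  have swap (A B : VF M) : VectorField.mlieBracket (𝓡 4) A B
      = -VectorField.mlieBracket (𝓡 4) B A := VectorField.mlieBracket_swap
  have J {A B C : VF M} (hA : SmoothVF A) (hB : SmoothVF B) (hC : SmoothVF C) :
      VectorField.mlieBracket (𝓡 4) A (VectorField.mlieBracket (𝓡 4) B C)
        = -VectorField.mlieBracket (𝓡 4) B (VectorField.mlieBracket (𝓡 4) C A)
          -VectorField.mlieBracket (𝓡 4) C (VectorField.mlieBracket (𝓡 4) A B) := by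
    rw [SmoothVF.jacobi hA hB hC, swap _ C, swap C A, SmoothVF.bracket_neg_right (hA.bracket hC)]
    abel
  obtain ⟨a, a'⟩ := hX; obtain ⟨b, b'⟩ := hY; obtain ⟨c, c'⟩ := hZ
  simp only [CVF.bracket, Prod.mk_add_mk, Prod.mk_eq_zero]
  constructor
  · rw [SmoothVF.bracket_sub_right (b.bracket c) (b'.bracket c'),
      SmoothVF.bracket_sub_right (c.bracket a) (c'.bracket a'),
      SmoothVF.bracket_sub_right (a.bracket b) (a'.bracket b'),
      SmoothVF.bracket_add_right (b.bracket c') (b'.bracket c),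
      SmoothVF.bracket_add_right (c.bracket a') (c'.bracket a),
      SmoothVF.bracket_add_right (a.bracket b') (a'.bracket b),
      J a b c, J a b' c', J a' b c', J a' b' c]
    abel
  · rw [SmoothVF.bracket_sub_right (b.bracket c) (b'.bracket c'),
      SmoothVF.bracket_sub_right (c.bracket a) (c'.bracket a'),
      SmoothVF.bracket_sub_right (a.bracket b) (a'.bracket b'),
      SmoothVF.bracket_add_right (b.bracket c') (b'.bracket c),
      SmoothVF.bracket_add_right (c.bracket a') (c'.bracket a),
      SmoothVF.bracket_add_right (a.bracket b') (a'.bracket b),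
      J a b c', J a b' c, J a' b c, J a' b' c']
    abel

theorem mvfderiv_bracket_complex {X Y Z : VF M} (hX : SmoothVF X) (hY : SmoothVF Y)
    (hZ : SmoothVF Z) (hZ0 : ∀ x, Z x ≠ 0) {f : M → ℂ} (hf : SmoothFn f) (x : M) :
    mvfderiv (𝓡 4) f x (VectorField.mlieBracket (𝓡 4) X Y x)
      = mvfderiv (𝓡 4) (fun y => mvfderiv (𝓡 4) f y (Y y)) x (X x)
        - mvfderiv (𝓡 4) (fun y => mvfderiv (𝓡 4) f y (X y)) x (Y x) := by
  simp only [mvfderiv_re_im hf, mvfderiv_bracket hX hY hZ hZ0 hf.re,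
    mvfderiv_bracket hX hY hZ hZ0 hf.im]
  rw [mvfderiv_complex (contMDiff_mvfderiv hf.re hY) (contMDiff_mvfderiv hf.im hY),
    mvfderiv_complex (contMDiff_mvfderiv hf.re hX) (contMDiff_mvfderiv hf.im hX)]
  push_cast
  ring

theorem CVF.bracket_deriv {Z W : CVF M} (hZ : SmoothCVF Z) (hW : SmoothCVF W) {V : VF M}
    (hV : SmoothVF V) (hV0 : ∀ x, V x ≠ 0) {f : M → ℂ} (hf : SmoothFn f) :
    (Z.bracket W).deriv f = Z.deriv (W.deriv f) - W.deriv (Z.deriv f) := by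
  have key {B : CVF M} (hB : SmoothCVF B) (x : M) (v : TangentSpace (𝓡 4) x) :
      mvfderiv (𝓡 4) (B.deriv f) x v
        = mvfderiv (𝓡 4) (fun y => mvfderiv (𝓡 4) f y (B.1 y)) x v
          + Complex.I * mvfderiv (𝓡 4) (fun y => mvfderiv (𝓡 4) f y (B.2 y)) x v := by
    have h := mvfderiv_add_apply (smoothFn_mvfderiv hf hB.1)
      ((SmoothFn.const Complex.I).mul (smoothFn_mvfderiv hf hB.2)) x v
    rw [mvfderiv_mul_apply (SmoothFn.const Complex.I) (smoothFn_mvfderiv hf hB.2),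
      mvfderiv_const, _root_.zero_apply, mul_zero, add_zero] at h
    exact h
  ext x
  have e (B : CVF M) (h : M → ℂ) (y : M) : B.deriv h y
    = mvfderiv (𝓡 4) h y (B.1 y) + Complex.I * mvfderiv (𝓡 4) h y (B.2 y) := rfl
  rw [Pi.sub_apply, e, e Z, e W]
  simp only [CVF.bracket, Pi.sub_apply, Pi.add_apply, map_sub, map_add]
  rw [key hW, key hW, key hZ, key hZ,
    mvfderiv_bracket_complex hZ.1 hW.1 hV hV0 hf, mvfderiv_bracket_complex hZ.2 hW.2 hV hV0 hf,
    mvfderiv_bracket_complex hZ.1 hW.2 hV hV0 hf, mvfderiv_bracket_complex hZ.2 hW.1 hV hV0 hf]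
  linear_combination -(mvfderiv (𝓡 4) (fun y => mvfderiv (𝓡 4) f y (W.2 y)) x (Z.2 x)
    - mvfderiv (𝓡 4) (fun y => mvfderiv (𝓡 4) f y (Z.2 y)) x (W.2 x)) * Complex.I_mul_I

namespace Spacetime

variable (S : Spacetime M)

theorem smooth_g {X Y : VF M} (hX : SmoothVF X) (hY : SmoothVF Y) :
    ContMDiff (𝓡 4) 𝓘(ℝ, ℝ) ∞ (fun x => S.g x (X x) (Y x)) := by
  rw [← contMDiffOn_univ]
  exact S.g_smooth X Y Set.univ isOpen_univ (contMDiffOn_univ.2 hX) (contMDiffOn_univ.2 hY)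

theorem gC_symm (Z W : CVF M) : S.gC Z W = S.gC W Z := by
  ext x
  simp only [gC]
  rw [S.g_symm x (Z.1 x), S.g_symm x (Z.2 x) (W.2 x), S.g_symm x (Z.1 x) (W.2 x),
    S.g_symm x (Z.2 x) (W.1 x)]
  push_cast
  ring

theorem gC_add_left (Z Z' W : CVF M) : S.gC (Z + Z') W = S.gC Z W + S.gC Z' W := by
  ext x
  simp only [gC, Prod.fst_add, Prod.snd_add, Pi.add_apply, map_add, _root_.add_apply]
  push_cast
  ring

theorem gC_sub_left (Z Z' W : CVF M) : S.gC (Z - Z') W = S.gC Z W - S.gC Z' W := by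
  ext x
  simp only [gC, Prod.fst_sub, Prod.snd_sub, Pi.sub_apply, map_sub, _root_.sub_apply]
  push_cast
  ring

theorem gC_zero_left (W : CVF M) : S.gC 0 W = 0 := by
  ext x; simp [gC]

theorem gC_conj (Z W : CVF M) : S.gC Z.conj W.conj = bar (S.gC Z W) := by
  ext x
  simp only [gC, CVF.conj, bar, Pi.neg_apply, map_neg, _root_.neg_apply, map_add,
    map_mul, Complex.conj_ofReal, Complex.conj_I]
  push_cast
  ring

theorem smoothFn_gC {Z W : CVF M} (hZ : SmoothCVF Z) (hW : SmoothCVF W) : SmoothFn (S.gC Z W) :=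
  (SmoothFn.ofReal ((S.smooth_g hZ.1 hW.1).sub (S.smooth_g hZ.2 hW.2))).add
    ((SmoothFn.const Complex.I).mul
      (SmoothFn.ofReal ((S.smooth_g hZ.1 hW.2).add (S.smooth_g hZ.2 hW.1))))

theorem nabla_sub {X Y : VF M} (hX : SmoothVF X) (hY : SmoothVF Y) (x : M) :
    S.nabla (X - Y) x = S.nabla X x - S.nabla Y x := by
  have h := S.nabla.isCovariantDerivativeOnUniv.add ((hX.sub hY).mdiffAt x) (hY.mdiffAt x)
  rw [sub_add_cancel] at h
  exact eq_sub_of_add_eq h.symm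

theorem nabla_neg {X : VF M} (hX : SmoothVF X) (x : M) : S.nabla (-X) x = -S.nabla X x := by
  have h := S.nabla_sub SmoothVF.zero hX x
  rw [zero_sub] at h
  rw [h, S.nabla.zero]
  simp

theorem covC_conj {Z W : CVF M} (hW : SmoothCVF W) :
    S.covC Z.conj W.conj = (S.covC Z W).conj := by
  simp only [covC, CVF.conj, Pi.neg_apply, map_neg, Prod.mk.injEq]
  constructor
  · ext1 x; rw [S.nabla_neg hW.2]; simp
  · ext1 x; rw [S.nabla_neg hW.2]; simp [add_comm]

theorem torsion {Z W : CVF M} (hZ : SmoothCVF Z) (hW : SmoothCVF W) :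
    S.covC Z W - S.covC W Z = Z.bracket W := by
  have t {X Y : VF M} (hX : SmoothVF X) (hY : SmoothVF Y) (x : M) :=
    S.nabla_torsionFree X Y x (hX.mdiffAt x) (hY.mdiffAt x)
  simp only [covC, CVF.bracket, Prod.mk_sub_mk, Prod.mk.injEq]
  constructor
  · ext1 x
    simp only [Pi.sub_apply]
    rw [← t hZ.1 hW.1, ← t hZ.2 hW.2]; abel
  · ext1 x
    simp only [Pi.sub_apply, Pi.add_apply]
    rw [← t hZ.1 hW.2, ← t hZ.2 hW.1]; abel

theorem deriv_gC {X Y : CVF M} (Z : CVF M) (hX : SmoothCVF X) (hY : SmoothCVF Y) :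
    Z.deriv (S.gC X Y) = S.gC (S.covC Z X) Y + S.gC X (S.covC Z Y) := by
  have m {A B : VF M} (hA : SmoothVF A) (hB : SmoothVF B) (x : M) (v : TangentSpace (𝓡 4) x) :=
    S.nabla_metric A B x v (hA.mdiffAt x) (hB.mdiffAt x)
  have d {A B : VF M} (hA : SmoothVF A) (hB : SmoothVF B) (x : M) :=
    ((S.smooth_g hA hB).mdifferentiable (by simp)) x
  have key (x : M) (v : TangentSpace (𝓡 4) x) : mvfderiv (𝓡 4) (S.gC X Y) x v
      = ((S.g x (S.nabla X.1 x v) (Y.1 x) + S.g x (X.1 x) (S.nabla Y.1 x v)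
          - (S.g x (S.nabla X.2 x v) (Y.2 x) + S.g x (X.2 x) (S.nabla Y.2 x v)) : ℝ) : ℂ)
        + Complex.I * ((S.g x (S.nabla X.1 x v) (Y.2 x) + S.g x (X.1 x) (S.nabla Y.2 x v)
          + (S.g x (S.nabla X.2 x v) (Y.1 x) + S.g x (X.2 x) (S.nabla Y.1 x v)) : ℝ) : ℂ) := by
    have h := mvfderiv_complex ((S.smooth_g hX.1 hY.1).sub (S.smooth_g hX.2 hY.2))
      ((S.smooth_g hX.1 hY.2).add (S.smooth_g hX.2 hY.1)) x v
    have e1 := congrArg (fun L => L v) (mvfderiv_sub (d hX.1 hY.1 x) (d hX.2 hY.2 x))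
    have e2 := congrArg (fun L => L v) (mvfderiv_add (d hX.1 hY.2 x) (d hX.2 hY.1 x))
    simp only [_root_.sub_apply, _root_.add_apply, m hX.1 hY.1,
      m hX.2 hY.2, m hX.1 hY.2, m hX.2 hY.1] at e1 e2
    rw [← e1, ← e2]
    exact h
  ext x
  simp only [CVF.deriv, key, gC, covC, Pi.add_apply, map_add, map_sub,
    _root_.add_apply, _root_.sub_apply]
  push_cast
  linear_combination ((S.g x (S.nabla X.1 x (Z.2 x)) (Y.2 x) : ℂ)
    + (S.g x (X.1 x) (S.nabla Y.2 x (Z.2 x)) : ℂ) + (S.g x (S.nabla X.2 x (Z.2 x)) (Y.1 x) : ℂ)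
    + (S.g x (X.2 x) (S.nabla Y.1 x (Z.2 x)) : ℂ)) * Complex.I_mul_I

end Spacetime

end GHP
end

noncomputable section

namespace GHP

variable {M : Type*} [TopologicalSpace M] [ChartedSpace (EuclideanSpace ℝ (Fin 4)) M]
  [IsManifold (𝓡 4) ∞ M]

namespace SpinDyad

variable {S : Spacetime M} (D : SpinDyad S)

/-! ### The null tetrad as a frame -/

theorem smooth_e (A A' : Fin 2) : SmoothCVF (D.e A A') := by
  have hm : SmoothCVF D.m := ⟨D.m_re_smooth, D.m_im_smooth⟩
  fin_cases A <;> fin_cases A'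
  · exact .ofReal D.l_smooth
  · exact hm
  · exact hm.conj
  · exact .ofReal D.n_smooth

theorem gC_e (A A' B B' : Fin 2) : S.gC (D.e A A') (D.e B B') = fun _ => eps A B * eps A' B' :=
  funext (D.normalized A A' B B')

theorem e_conj (A A' : Fin 2) : (D.e A A').conj = D.e A' A := by
  fin_cases A <;> fin_cases A' <;> simp [e, tetrad, CVF.conj, CVF.ofReal]

/-- The scalar products of the real frame `l, n, Re m, Im m`. -/
theorem gram (x : M) :
    (S.g x (D.l x) (D.l x) = 0 ∧ S.g x (D.n x) (D.n x) = 0 ∧ S.g x (D.l x) (D.n x) = 1) ∧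
    (S.g x (D.l x) (D.m.1 x) = 0 ∧ S.g x (D.l x) (D.m.2 x) = 0 ∧
      S.g x (D.n x) (D.m.1 x) = 0 ∧ S.g x (D.n x) (D.m.2 x) = 0) ∧
    S.g x (D.m.1 x) (D.m.1 x) = -1 / 2 ∧ S.g x (D.m.2 x) (D.m.2 x) = -1 / 2 ∧
      S.g x (D.m.1 x) (D.m.2 x) = 0 := by
  have h1 := D.normalized 0 0 0 0 x
  have h2 := D.normalized 1 1 1 1 x
  have h3 := D.normalized 0 0 1 1 x
  have h4 := D.normalized 0 0 0 1 x
  have h5 := D.normalized 1 1 0 1 x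
  have h6 := D.normalized 0 1 0 1 x
  have h7 := D.normalized 0 1 1 0 x
  simp [Spacetime.gC, tetrad, eps, CVF.ofReal, CVF.conj, Complex.ext_iff] at h1 h2 h3 h4 h5 h6 h7
  have hs := S.g_symm x (D.m.1 x) (D.m.2 x)
  refine ⟨⟨h1, h2, h3⟩, ⟨h4.1, h4.2, h5.1, h5.2⟩, ?_, ?_, ?_⟩ <;> linarith [h6.1, h6.2, h7.1, h7.2]

theorem l_ne_zero (x : M) : D.l x ≠ 0 := by
  intro h
  have := (D.gram x).1.2.2
  rw [h] at this
  simp at this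

theorem real_expand (x : M) (v : TangentSpace (𝓡 4) x) :
    v = S.g x v (D.n x) • D.l x + S.g x v (D.l x) • D.n x
      + (-2 * S.g x v (D.m.1 x)) • D.m.1 x + (-2 * S.g x v (D.m.2 x)) • D.m.2 x := by
  obtain ⟨⟨ll, nn, ln⟩, ⟨lm, lm', nm, nm'⟩, mm, mm', m12⟩ := D.gram x
  have nl := S.g_symm x (D.n x) (D.l x) ▸ ln
  have ml := S.g_symm x (D.m.1 x) (D.l x) ▸ lm
  have ml' := S.g_symm x (D.m.2 x) (D.l x) ▸ lm'
  have mn := S.g_symm x (D.m.1 x) (D.n x) ▸ nm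
  have mn' := S.g_symm x (D.m.2 x) (D.n x) ▸ nm'
  have m21 := S.g_symm x (D.m.2 x) (D.m.1 x) ▸ m12
  have key (c : Fin 4 → ℝ) (w : TangentSpace (𝓡 4) x)
      (hw : w = c 0 • D.l x + c 1 • D.n x + c 2 • D.m.1 x + c 3 • D.m.2 x) :
      S.g x w (D.n x) = c 0 ∧ S.g x w (D.l x) = c 1 ∧ -2 * S.g x w (D.m.1 x) = c 2 ∧
        -2 * S.g x w (D.m.2 x) = c 3 := by
    subst hw
    simp only [map_add, map_smul, _root_.add_apply, _root_.smul_apply, smul_eq_mul, ll, nn, ln,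
      lm, lm', nm, nm', mm, mm', m12, nl, ml, ml', mn, mn', m21]
    refine ⟨?_, ?_, ?_, ?_⟩ <;> ring
  have li : LinearIndependent ℝ ![D.l x, D.n x, D.m.1 x, D.m.2 x] := by
    rw [Fintype.linearIndependent_iff]
    intro c hc
    have hw : (0 : TangentSpace (𝓡 4) x)
        = c 0 • D.l x + c 1 • D.n x + c 2 • D.m.1 x + c 3 • D.m.2 x := by
      rw [← hc, Fin.sum_univ_four]; rfl
    have h := key c 0 hw
    simp only [map_zero, _root_.zero_apply, mul_zero] at h
    intro i
    fin_cases i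
    exacts [h.1.symm, h.2.1.symm, h.2.2.1.symm, h.2.2.2.symm]
  have hfr : Fintype.card (Fin 4) = Module.finrank ℝ (TangentSpace (𝓡 4) x) := by
    change _ = Module.finrank ℝ (EuclideanSpace ℝ (Fin 4))
    simp
  have : FiniteDimensional ℝ (TangentSpace (𝓡 4) x) :=
    inferInstanceAs (FiniteDimensional ℝ (EuclideanSpace ℝ (Fin 4)))
  have hs : v ∈ Submodule.span ℝ (Set.range ![D.l x, D.n x, D.m.1 x, D.m.2 x]) := by
    rw [li.span_eq_top_of_card_eq_finrank' hfr]; trivial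
  obtain ⟨c, hc⟩ := (Submodule.mem_span_range_iff_exists_fun ℝ).1 hs
  have hw : v = c 0 • D.l x + c 1 • D.n x + c 2 • D.m.1 x + c 3 • D.m.2 x := by
    rw [← hc, Fin.sum_univ_four]; rfl
  obtain ⟨e0, e1, e2, e3⟩ := key c v hw
  rw [e0, e1, e2, e3]
  exact hw

/-- The components `V^{AA'}` of a complex vector field in the null tetrad. -/
def comp (V : CVF M) (A A' : Fin 2) : M → ℂ := fun x =>
  ∑ B : Fin 2, ∑ B' : Fin 2, eps A B * eps A' B' * S.gC V (D.e B B') x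

theorem linear_expand (V : CVF M) (x : M) (T : TangentSpace (𝓡 4) x →ₗ[ℝ] ℂ) :
    T (V.1 x) + Complex.I * T (V.2 x)
      = ∑ A : Fin 2, ∑ A' : Fin 2,
        D.comp V A A' x * (T ((D.e A A').1 x) + Complex.I * T ((D.e A A').2 x)) := by
  conv_lhs => rw [D.real_expand x (V.1 x), D.real_expand x (V.2 x)]
  simp [comp, e, tetrad, Spacetime.gC, eps, CVF.ofReal, CVF.conj, Fin.sum_univ_two]
  linear_combination (-2 * ((S.g x (V.1 x) (D.m.2 x) : ℂ) * T (D.m.2 x))) * Complex.I_mul_I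

theorem gC_expand (V W : CVF M) (x : M) :
    S.gC V W x = ∑ A : Fin 2, ∑ A' : Fin 2, D.comp V A A' x * S.gC (D.e A A') W x := by
  let T : TangentSpace (𝓡 4) x →ₗ[ℝ] ℂ :=
    { toFun := fun v => ((S.g x v (W.1 x) : ℝ) : ℂ) + Complex.I * ((S.g x v (W.2 x) : ℝ) : ℂ)
      map_add' := fun v w => by simp; ring
      map_smul' := fun c v => by simp; ring }
  have hT (V : CVF M) : S.gC V W x = T (V.1 x) + Complex.I * T (V.2 x) := by
    simp only [Spacetime.gC, T, LinearMap.coe_mk, AddHom.coe_mk]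
    push_cast
    linear_combination -(S.g x (V.2 x) (W.2 x) : ℂ) * Complex.I_mul_I
  simp only [hT]
  exact D.linear_expand V x T

theorem covC_expand (V W U : CVF M) (x : M) :
    S.gC (S.covC V W) U x
      = ∑ A : Fin 2, ∑ A' : Fin 2, D.comp V A A' x * S.gC (S.covC (D.e A A') W) U x := by
  let T : TangentSpace (𝓡 4) x →ₗ[ℝ] ℂ :=
    { toFun := fun v => ((S.g x (S.nabla W.1 x v) (U.1 x) - S.g x (S.nabla W.2 x v) (U.2 x) : ℝ) : ℂ)
        + Complex.I * ((S.g x (S.nabla W.1 x v) (U.2 x) + S.g x (S.nabla W.2 x v) (U.1 x) : ℝ) : ℂ)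
      map_add' := fun v w => by simp; ring
      map_smul' := fun c v => by simp; ring }
  have hT (V : CVF M) : S.gC (S.covC V W) U x = T (V.1 x) + Complex.I * T (V.2 x) := by
    simp only [Spacetime.gC, Spacetime.covC, T, LinearMap.coe_mk, AddHom.coe_mk, map_add, map_sub,
      _root_.add_apply, _root_.sub_apply]
    push_cast
    linear_combination -((S.g x (S.nabla W.1 x (V.2 x)) (U.2 x) : ℂ)
      + (S.g x (S.nabla W.2 x (V.2 x)) (U.1 x) : ℂ)) * Complex.I_mul_I
  simp only [hT]
  exact D.linear_expand V x T

theorem deriv_expand (V : CVF M) (f : M → ℂ) (x : M) :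
    V.deriv f x = ∑ A : Fin 2, ∑ A' : Fin 2, D.comp V A A' x * (D.e A A').deriv f x :=
  D.linear_expand V x (mvfderiv (𝓡 4) f x).toLinearMap

theorem smoothVF_of_gram {X : VF M}
    (hl : ContMDiff (𝓡 4) 𝓘(ℝ, ℝ) ∞ (fun x => S.g x (X x) (D.l x)))
    (hn : ContMDiff (𝓡 4) 𝓘(ℝ, ℝ) ∞ (fun x => S.g x (X x) (D.n x)))
    (h1 : ContMDiff (𝓡 4) 𝓘(ℝ, ℝ) ∞ (fun x => S.g x (X x) (D.m.1 x)))
    (h2 : ContMDiff (𝓡 4) 𝓘(ℝ, ℝ) ∞ (fun x => S.g x (X x) (D.m.2 x))) : SmoothVF X := by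
  have c2 : ContMDiff (𝓡 4) 𝓘(ℝ, ℝ) ∞ (fun _ : M => (-2 : ℝ)) := contMDiff_const
  have h := (((D.l_smooth.smul hn).add (D.n_smooth.smul hl)).add
    (D.m_re_smooth.smul (c2.mul h1))).add (D.m_im_smooth.smul (c2.mul h2))
  convert h using 1
  ext1 x
  exact D.real_expand x (X x)

theorem smoothCVF_of_gC {V : CVF M} (h : ∀ B B', SmoothFn (S.gC V (D.e B B'))) :
    SmoothCVF V := by
  have hc : ContMDiff (𝓡 4) 𝓘(ℝ, ℝ) ∞ (fun _ : M => (1 / 2 : ℝ)) := contMDiff_const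
  have h00 := h 0 0
  have h11 := h 1 1
  have h01 := h 0 1
  have h10 := h 1 0
  constructor
  · refine D.smoothVF_of_gram ?_ ?_ ?_ ?_
    · convert h00.re using 2; simp [Spacetime.gC, e, tetrad, CVF.ofReal]
    · convert h11.re using 2; simp [Spacetime.gC, e, tetrad, CVF.ofReal]
    · convert hc.mul (h01.re.add h10.re) using 2
      simp [Spacetime.gC, e, tetrad, CVF.conj]; ring
    · convert hc.mul (h01.im.sub h10.im) using 2
      simp [Spacetime.gC, e, tetrad, CVF.conj]; ring
  · refine D.smoothVF_of_gram ?_ ?_ ?_ ?_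
    · convert h00.im using 2; simp [Spacetime.gC, e, tetrad, CVF.ofReal]
    · convert h11.im using 2; simp [Spacetime.gC, e, tetrad, CVF.ofReal]
    · convert hc.mul (h01.im.add h10.im) using 2
      simp [Spacetime.gC, e, tetrad, CVF.conj]; ring
    · convert hc.mul (h10.re.sub h01.re) using 2
      simp [Spacetime.gC, e, tetrad, CVF.conj]; ring

/-! ### Connection coefficients -/

theorem gC_covC_antisymm (Z : CVF M) (B B' C C' : Fin 2) (x : M) :
    S.gC (S.covC Z (D.e B B')) (D.e C C') x = -S.gC (S.covC Z (D.e C C')) (D.e B B') x := by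
  have h := congrFun (S.deriv_gC Z (D.smooth_e B B') (D.smooth_e C C')) x
  rw [D.gC_e, CVF.deriv_const, S.gC_symm (D.e B B')] at h
  exact eq_neg_of_add_eq_zero_left h.symm

theorem koszul (A A' B B' C C' : Fin 2) (x : M) :
    S.gC (S.covC (D.e A A') (D.e B B')) (D.e C C') x
      = (1 / 2 : ℂ) * (S.gC ((D.e A A').bracket (D.e B B')) (D.e C C') x
        - S.gC ((D.e A A').bracket (D.e C C')) (D.e B B') x
        - S.gC ((D.e B B').bracket (D.e C C')) (D.e A A') x) := by
  simp only [← S.torsion (D.smooth_e _ _) (D.smooth_e _ _), Spacetime.gC_sub_left, Pi.sub_apply]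
  rw [D.gC_covC_antisymm _ C C' B B', D.gC_covC_antisymm (D.e C C') A A' B B',
    D.gC_covC_antisymm (D.e B B') C C' A A']
  ring

theorem smooth_gC_covC (A A' B B' C C' : Fin 2) :
    SmoothFn (S.gC (S.covC (D.e A A') (D.e B B')) (D.e C C')) := by
  have hb (A A' B B' C C' : Fin 2) : SmoothFn (S.gC ((D.e A A').bracket (D.e B B')) (D.e C C')) :=
    S.smoothFn_gC ((D.smooth_e A A').bracket (D.smooth_e B B')) (D.smooth_e C C')
  have h := (SmoothFn.const (1 / 2)).mul ((hb A A' B B' C C').add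
    ((SmoothFn.const (-1)).mul ((hb A A' C C' B B').add (hb B B' C C' A A'))))
  convert h using 1
  ext x
  rw [D.koszul]
  simp only [Pi.mul_apply, Pi.add_apply]
  ring

theorem smooth_covC (A A' B B' : Fin 2) : SmoothCVF (S.covC (D.e A A') (D.e B B')) :=
  D.smoothCVF_of_gC fun C C' => D.smooth_gC_covC A A' B B' C C'

theorem bar_gC_covC (A A' B B' C C' : Fin 2) (x : M) :
    (starRingEnd ℂ) (S.gC (S.covC (D.e A A') (D.e B B')) (D.e C C') x)
      = S.gC (S.covC (D.e A' A) (D.e B' B)) (D.e C' C) x := by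
  rw [← D.e_conj A A', ← D.e_conj B B', ← D.e_conj C C', S.covC_conj (D.smooth_e B B'), S.gC_conj]
  rfl

/-- The connection coefficients of the tetrad split into the spin connection and its conjugate. -/
theorem gC_covC_eq (A A' B B' E E' : Fin 2) (x : M) :
    S.gC (S.covC (D.e A A') (D.e B B')) (D.e E E') x
      = ∑ C : Fin 2, (D.spinConn A A' B C x * eps C E * eps B' E'
        + D.spinConnBar A A' B' C x * eps C E' * eps B E) := by
  have el : CVF.ofReal D.l = D.e 0 0 := rfl
  have en : CVF.ofReal D.n = D.e 1 1 := rfl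
  have em : D.m = D.e 0 1 := rfl
  have emb : D.m.conj = D.e 1 0 := rfl
  have z (C C' : Fin 2) : S.gC (S.covC (D.e A A') (D.e C C')) (D.e C C') x = 0 := by
    have h := D.gC_covC_antisymm (D.e A A') C C' C C' x
    exact self_eq_neg.1 h
  have a1 := D.gC_covC_antisymm (D.e A A') 1 1 0 0 x
  have a2 := D.gC_covC_antisymm (D.e A A') 0 1 0 0 x
  have a3 := D.gC_covC_antisymm (D.e A A') 1 0 0 0 x
  have a4 := D.gC_covC_antisymm (D.e A A') 1 1 0 1 x
  have a5 := D.gC_covC_antisymm (D.e A A') 1 1 1 0 x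
  have a6 := D.gC_covC_antisymm (D.e A A') 1 0 0 1 x
  simp only [spinConnBar, spinConn, bar, emb]
  rw [el, en, em]
  simp only [S.gC_symm (D.e _ _) (S.covC _ _)]
  fin_cases B <;> fin_cases B' <;> fin_cases E <;> fin_cases E' <;>
    simp [eps, Fin.sum_univ_two, omega, Complex.conj_ofNat, bar_gC_covC, el, en, emb, S.gC_symm (D.e _ _) (S.covC _ _)] <;>
    simp only [em, bar_gC_covC, z, a1, a2, a3, a4, a5, a6] <;> ring

end SpinDyad

end GHP
end

/-! ### Spin frames over a commutative ring of scalars -/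

namespace GHP

/-- The algebraic content of a torsion-free metric connection in a normalized spin frame:
four derivations `d A A'` of a ring of scalars with conjugation, the matrices of the spin
connection, and the commutator and Jacobi identities with the structure functions that
vanishing torsion prescribes. -/
structure SpinFrame (R : Type*) [CommRing R] [Algebra ℂ R] where
  d : Fin 2 → Fin 2 → Derivation ℂ R R
  conj : R →+* R
  conj_conj : ∀ f, conj (conj f) = f
  conj_d : ∀ A A' f, conj (d A A' f) = d A' A (conj f)
  conn : Fin 2 → Fin 2 → Fin 2 → Fin 2 → R
  conn_trace : ∀ A A', conn A A' 1 1 = -conn A A' 0 0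
  /-- The coefficients of the vector connection, `∇_{AA'} e_{BB'} = ∑ Γ e_{CC'}`. -/
  Γ : Fin 2 → Fin 2 → Fin 2 → Fin 2 → Fin 2 → Fin 2 → R
  Γ_eq : ∀ A A' B B' C C', Γ A A' B B' C C'
    = (if B' = C' then conn A A' B C else 0) + (if B = C then conj (conn A' A B' C') else 0)
  comm : ∀ A A' B B' f, d A A' (d B B' f) - d B B' (d A A' f)
    = ∑ C, ∑ C', (Γ A A' B B' C C' - Γ B B' A A' C C') * d C C' f
  jacobi : ∀ A A' B B' C C' E E',
    d A A' (Γ B B' C C' E E' - Γ C C' B B' E E')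
      + d B B' (Γ C C' A A' E E' - Γ A A' C C' E E')
      + d C C' (Γ A A' B B' E E' - Γ B B' A A' E E')
      + ∑ F, ∑ F', ((Γ B B' C C' F F' - Γ C C' B B' F F') * (Γ A A' F F' E E' - Γ F F' A A' E E')
        + (Γ C C' A A' F F' - Γ A A' C C' F F') * (Γ B B' F F' E E' - Γ F F' B B' E E')
        + (Γ A A' B B' F F' - Γ B B' A A' F F') * (Γ C C' F F' E E' - Γ F F' C C' E E')) = 0

namespace SpinFrame

variable {R : Type*} [CommRing R] [Algebra ℂ R] (N : SpinFrame R)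

/-- The structure functions `[e_{AA'}, e_{BB'}] = ∑ c e_{CC'}`. -/
def c (A A' B B' C C' : Fin 2) : R := N.Γ A A' B B' C C' - N.Γ B B' A A' C C'

/-- The curvature of the spin connection. -/
def F (A A' B B' C E : Fin 2) : R :=
  N.d A A' (N.conn B B' C E) - N.d B B' (N.conn A A' C E)
    + ∑ K, (N.conn B B' C K * N.conn A A' K E - N.conn A A' C K * N.conn B B' K E)
    - ∑ K, ∑ K', N.c A A' B B' K K' * N.conn K K' C E

/-- The curvature of the vector connection. -/
def riemUp (A A' B B' C C' E E' : Fin 2) : R :=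
  N.d A A' (N.Γ B B' C C' E E') - N.d B B' (N.Γ A A' C C' E E')
    + ∑ K, ∑ K', (N.Γ B B' C C' K K' * N.Γ A A' K K' E E'
      - N.Γ A A' C C' K K' * N.Γ B B' K K' E E')
    - ∑ K, ∑ K', N.c A A' B B' K K' * N.Γ K K' C C' E E'

theorem conj_Γ (A A' B B' C C' : Fin 2) :
    N.conj (N.Γ A A' B B' C C') = N.Γ A' A B' B C' C := by
  simp only [N.Γ_eq, map_add, apply_ite N.conj, map_zero, N.conj_conj]
  ring

theorem conj_c (A A' B B' C C' : Fin 2) :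
    N.conj (N.c A A' B B' C C') = N.c A' A B' B C' C := by
  simp only [c, map_sub, conj_Γ]

theorem riemUp_eq (A A' B B' C C' E E' : Fin 2) :
    N.riemUp A A' B B' C C' E E'
      = (if C' = E' then N.F A A' B B' C E else 0)
        + (if C = E then N.conj (N.F A' A B' B C' E') else 0) := by
  have t := N.conn_trace
  simp only [riemUp, F, map_add, map_sub, map_sum, map_mul, N.conj_d, conj_c]
  fin_cases C <;> fin_cases C' <;> fin_cases E <;> fin_cases E' <;>
    simp [Fin.sum_univ_two, N.Γ_eq, t] <;> ring

theorem F_antisymm (A A' B B' C E : Fin 2) : N.F B B' A A' C E = -N.F A A' B B' C E := by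
  simp only [F, c, Fin.sum_univ_two]; ring

theorem F_trace (A A' B B' : Fin 2) : N.F A A' B B' 1 1 = -N.F A A' B B' 0 0 := by
  simp only [F, Fin.sum_univ_two, N.conn_trace, map_neg]; ring

theorem riemUp_cyclic (A A' B B' C C' E E' : Fin 2) :
    N.riemUp A A' B B' C C' E E' + N.riemUp B B' C C' A A' E E' + N.riemUp C C' A A' B B' E E'
      = 0 := by
  have h := N.jacobi A A' B B' C C' E E'
  simp only [riemUp, c, Fin.sum_univ_two, map_sub] at h ⊢
  linear_combination h

end SpinFrame

end GHP

noncomputable section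

namespace GHP

variable {M : Type*} [TopologicalSpace M] [ChartedSpace (EuclideanSpace ℝ (Fin 4)) M]
  [IsManifold (𝓡 4) ∞ M]

namespace SpinDyad

variable {S : Spacetime M} (D : SpinDyad S)

/-! ### The spin frame of a spin dyad -/

theorem smooth_spinConn (A A' B C : Fin 2) : SmoothFn (D.spinConn A A' B C) := by
  have el : CVF.ofReal D.l = D.e 0 0 := rfl
  have en : CVF.ofReal D.n = D.e 1 1 := rfl
  have em : D.m = D.e 0 1 := rfl
  have emb : D.m.conj = D.e 1 0 := rfl
  have h (B B' C C' : Fin 2) : SmoothFn (S.gC (D.e C C') (S.covC (D.e A A') (D.e B B'))) := by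
    rw [S.gC_symm]; exact D.smooth_gC_covC A A' B B' C C'
  have neg {f : M → ℂ} (hf : SmoothFn f) : SmoothFn (-f) := by
    have := (SmoothFn.const (M := M) (-1)).mul hf
    convert this using 1
    ext x; simp
  have hω : SmoothFn (D.omega A A') := by
    have := (SmoothFn.const (M := M) (1 / 2)).mul ((h 0 0 1 1).add (neg (h 0 1 1 0)))
    convert this using 1
    ext x
    simp only [omega, emb, Pi.mul_apply, Pi.add_apply, Pi.neg_apply]
    rw [el, en, em]; ring
  have h1 := neg (h 0 0 0 1)
  have h2 := neg (h 1 1 1 0)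
  have h3 := neg hω
  fin_cases B <;> fin_cases C
  exacts [hω, h1, h2, h3]

theorem comp_covC_e (A A' B B' C C' : Fin 2) (x : M) :
    D.comp (S.covC (D.e A A') (D.e B B')) C C' x
      = (if B' = C' then D.spinConn A A' B C x else 0)
        + (if B = C then D.spinConnBar A A' B' C' x else 0) := by
  simp only [comp, gC_covC_eq]
  fin_cases B <;> fin_cases B' <;> fin_cases C <;> fin_cases C' <;>
    (simp [eps, Fin.sum_univ_two]; try ring)

theorem smooth_comp {V : CVF M} (hV : SmoothCVF V) (A A' : Fin 2) : SmoothFn (D.comp V A A') := by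
  have h (B B' : Fin 2) : SmoothFn (fun x => eps A B * eps A' B' * S.gC V (D.e B B') x) :=
    (SmoothFn.const (eps A B * eps A' B')).mul (S.smoothFn_gC hV (D.smooth_e B B'))
  have h' := ((h 0 0).add (h 0 1)).add ((h 1 0).add (h 1 1))
  convert h' using 1
  ext x
  simp only [comp, Fin.sum_univ_two, Pi.add_apply]

theorem comp_sub (V W : CVF M) (A A' : Fin 2) :
    D.comp (V - W) A A' = D.comp V A A' - D.comp W A A' := by
  ext x
  simp only [comp, S.gC_sub_left, Pi.sub_apply, Fin.sum_univ_two]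
  ring

theorem comp_covC_left (V W : CVF M) (C C' : Fin 2) (x : M) :
    D.comp (S.covC V W) C C' x
      = ∑ F, ∑ F', D.comp V F F' x * D.comp (S.covC (D.e F F') W) C C' x := by
  have h (B B' : Fin 2) := D.covC_expand V W (D.e B B') x
  simp only [Fin.sum_univ_two] at h
  simp only [comp, Fin.sum_univ_two] at h ⊢
  simp only [h]
  ring

theorem comp_covC_right {V : CVF M} (hV : SmoothCVF V) (A A' C C' : Fin 2) (x : M) :
    D.comp (S.covC (D.e A A') V) C C' x
      = (D.e A A').deriv (D.comp V C C') x
        + ∑ F, ∑ F', D.comp V F F' x * D.comp (S.covC (D.e A A') (D.e F F')) C C' x := by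
  have hd (B B' : Fin 2) : S.gC (S.covC (D.e A A') V) (D.e B B') x
      = (D.e A A').deriv (S.gC V (D.e B B')) x
        + ∑ F, ∑ F', D.comp V F F' x * S.gC (S.covC (D.e A A') (D.e F F')) (D.e B B') x := by
    have h1 := congrFun (S.deriv_gC (D.e A A') hV (D.smooth_e B B')) x
    have h2 := D.gC_expand V (S.covC (D.e A A') (D.e B B')) x
    simp only [S.gC_symm (D.e _ _) (S.covC (D.e A A') (D.e B B')),
      D.gC_covC_antisymm (D.e A A') B B', Fin.sum_univ_two, Pi.add_apply] at h1 h2 ⊢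
    rw [h1, h2]
    ring
  have hs (B B' : Fin 2) := S.smoothFn_gC hV (D.smooth_e B B')
  have hc (k : ℂ) (B B' : Fin 2) (y : M) :
      (D.e A A').deriv ((fun _ => k) * S.gC V (D.e B B')) y
        = k * (D.e A A').deriv (S.gC V (D.e B B')) y := by
    rw [CVF.deriv_mul _ (SmoothFn.const k) (hs B B'), CVF.deriv_const]
    simp
  have he : D.comp V C C' = ((fun _ => eps C 0 * eps C' 0) * S.gC V (D.e 0 0)
      + (fun _ => eps C 0 * eps C' 1) * S.gC V (D.e 0 1))
      + ((fun _ => eps C 1 * eps C' 0) * S.gC V (D.e 1 0)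
      + (fun _ => eps C 1 * eps C' 1) * S.gC V (D.e 1 1)) := by
    ext y
    simp only [comp, Fin.sum_univ_two, Pi.add_apply, Pi.mul_apply]
  have hm (k : ℂ) (B B' : Fin 2) := (SmoothFn.const k).mul (hs B B')
  have e2 : (D.e A A').deriv (D.comp V C C') x
      = ∑ B, ∑ B', eps C B * eps C' B' * (D.e A A').deriv (S.gC V (D.e B B')) x := by
    rw [he, CVF.deriv_add _ ((hm _ _ _).add (hm _ _ _)) ((hm _ _ _).add (hm _ _ _)),
      CVF.deriv_add _ (hm _ _ _) (hm _ _ _), CVF.deriv_add _ (hm _ _ _) (hm _ _ _)]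
    simp only [Pi.add_apply, hc, Fin.sum_univ_two]
  have e1 : D.comp (S.covC (D.e A A') V) C C' x
      = ∑ B, ∑ B', eps C B * eps C' B' * S.gC (S.covC (D.e A A') V) (D.e B B') x := rfl
  have e3 (F F' : Fin 2) : D.comp (S.covC (D.e A A') (D.e F F')) C C' x
      = ∑ B, ∑ B', eps C B * eps C' B' * S.gC (S.covC (D.e A A') (D.e F F')) (D.e B B') x := rfl
  rw [e1, e2]
  simp only [e3, hd, Fin.sum_univ_two]
  ring

theorem comp_bracket {V : CVF M} (hV : SmoothCVF V) (A A' C C' : Fin 2) (x : M) :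
    D.comp ((D.e A A').bracket V) C C' x = (D.e A A').deriv (D.comp V C C') x
      + ∑ F, ∑ F', D.comp V F F' x * (D.comp (S.covC (D.e A A') (D.e F F')) C C' x
        - D.comp (S.covC (D.e F F') (D.e A A')) C C' x) := by
  rw [← S.torsion (D.smooth_e A A') hV, comp_sub, Pi.sub_apply, D.comp_covC_right hV,
    D.comp_covC_left V]
  simp only [Fin.sum_univ_two]
  ring

/-- The spin frame of a spin dyad. -/
def frame : SpinFrame (smoothAlg M) where
  d A A' := (D.e A A').derivation (D.smooth_e A A')
  conj := smoothAlg.conj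
  conj_conj f := by
    ext x; exact Complex.conj_conj _
  conj_d A A' f := by
    refine Subtype.ext ?_
    change bar ((D.e A A').deriv f.1) = (D.e A' A).deriv (bar f.1)
    rw [CVF.bar_deriv _ f.2, e_conj]
  conn A A' B C := ⟨D.spinConn A A' B C, D.smooth_spinConn A A' B C⟩
  conn_trace A A' := by
    refine Subtype.ext ?_
    simp [spinConn]
  Γ A A' B B' C C' := ⟨D.comp (S.covC (D.e A A') (D.e B B')) C C',
    D.smooth_comp (D.smooth_covC A A' B B') C C'⟩
  Γ_eq A A' B B' C C' := by
    ext x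
    change D.comp (S.covC (D.e A A') (D.e B B')) C C' x = _
    rw [comp_covC_e]
    split_ifs <;> rfl
  comm A A' B B' f := by
    ext x
    have h := congrFun (CVF.bracket_deriv (D.smooth_e A A') (D.smooth_e B B') D.l_smooth
      D.l_ne_zero f.2) x
    rw [D.deriv_expand, ← S.torsion (D.smooth_e A A') (D.smooth_e B B')] at h
    simp only [comp_sub] at h
    simp only [Fin.sum_univ_two] at h ⊢
    exact h.symm
  jacobi A A' B B' C C' E E' := by
    ext x
    have hJ := CVF.jacobi (D.smooth_e A A') (D.smooth_e B B') (D.smooth_e C C')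
    have h0 : D.comp (0 : CVF M) E E' x = 0 := by simp [comp, S.gC_zero_left]
    rw [← hJ] at h0
    have hadd (V W : CVF M) : D.comp (V + W) E E' x = D.comp V E E' x + D.comp W E E' x := by
      simp only [comp, S.gC_add_left, Pi.add_apply, Fin.sum_univ_two]
      ring
    have sb (A A' B B' : Fin 2) := (D.smooth_e A A').bracket (D.smooth_e B B')
    rw [hadd, hadd, D.comp_bracket (sb _ _ _ _), D.comp_bracket (sb _ _ _ _),
      D.comp_bracket (sb _ _ _ _)] at h0
    simp only [← S.torsion (D.smooth_e _ _) (D.smooth_e _ _), comp_sub] at h0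
    simp only [Fin.sum_univ_two] at h0 ⊢
    refine Eq.trans ?_ h0
    simp only [CVF.coe_derivation, AddMemClass.coe_add, MulMemClass.coe_mul,
      AddSubgroupClass.coe_sub, Pi.add_apply, Pi.sub_apply, Pi.mul_apply]
    ring

theorem riem_eq (A A' B B' C C' E E' : Fin 2) (x : M) :
    D.riem A A' B B' C C' E E' x
      = ∑ K, ∑ K', (D.frame.riemUp A A' B B' C C' K K' : M → ℂ) x * (eps K E * eps K' E') := by
  have h (K K' : Fin 2) : D.comp (S.curv (D.e A A') (D.e B B') (D.e C C')) K K' x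
      = (D.frame.riemUp A A' B B' C C' K K' : M → ℂ) x := by
    rw [Spacetime.curv, comp_sub, comp_sub, Pi.sub_apply, Pi.sub_apply,
      D.comp_covC_right (D.smooth_covC B B' C C'), D.comp_covC_right (D.smooth_covC A A' C C'),
      D.comp_covC_left (CVF.bracket _ _), ← S.torsion (D.smooth_e A A') (D.smooth_e B B')]
    simp only [comp_sub, SpinFrame.riemUp, SpinFrame.c, frame, CVF.coe_derivation,
      AddMemClass.coe_add, MulMemClass.coe_mul, AddSubgroupClass.coe_sub, Pi.add_apply,
      Pi.sub_apply, Pi.mul_apply, Fin.sum_univ_two]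
    ring
  rw [riem, D.gC_expand]
  simp only [h, gC_e]

end SpinDyad

end GHP
end

noncomputable section

namespace GHP

/-! ### Symmetrization -/

theorem sum_perm_fin_four (H : Fin 4 → Fin 4 → Fin 4 → Fin 4 → ℂ) :
    ∑ s : Equiv.Perm (Fin 4), H (s 0) (s 1) (s 2) (s 3)
      = (H 0 1 2 3 + H 0 1 3 2 + H 0 2 1 3 + H 0 2 3 1 + H 0 3 1 2 + H 0 3 2 1)
        + (H 1 0 2 3 + H 1 0 3 2 + H 1 2 0 3 + H 1 2 3 0 + H 1 3 0 2 + H 1 3 2 0)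
        + (H 2 0 1 3 + H 2 0 3 1 + H 2 1 0 3 + H 2 1 3 0 + H 2 3 0 1 + H 2 3 1 0)
        + (H 3 0 1 2 + H 3 0 2 1 + H 3 1 0 2 + H 3 1 2 0 + H 3 2 0 1 + H 3 2 1 0) := by
  have hval : (Finset.univ : Finset (Equiv.Perm (Fin 4))).val.map (fun s => (s 0, s 1, s 2, s 3))
      = {(0, 1, 2, 3), (0, 1, 3, 2), (0, 2, 1, 3), (0, 2, 3, 1), (0, 3, 1, 2), (0, 3, 2, 1),
        (1, 0, 2, 3), (1, 0, 3, 2), (1, 2, 0, 3), (1, 2, 3, 0), (1, 3, 0, 2), (1, 3, 2, 0),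
        (2, 0, 1, 3), (2, 0, 3, 1), (2, 1, 0, 3), (2, 1, 3, 0), (2, 3, 0, 1), (2, 3, 1, 0),
        (3, 0, 1, 2), (3, 0, 2, 1), (3, 1, 0, 2), (3, 1, 2, 0), (3, 2, 0, 1), (3, 2, 1, 0)} := by
    decide
  have h : ∑ s : Equiv.Perm (Fin 4), H (s 0) (s 1) (s 2) (s 3)
      = (((Finset.univ : Finset (Equiv.Perm (Fin 4))).val.map
        (fun s => (s 0, s 1, s 2, s 3))).map (fun t => H t.1 t.2.1 t.2.2.1 t.2.2.2)).sum := by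
    rw [Multiset.map_map]; rfl
  rw [h, hval]
  simp only [Multiset.insert_eq_cons, Multiset.map_cons, Multiset.map_singleton,
    Multiset.sum_cons, Multiset.sum_singleton]
  ring

theorem SpinDyad.sym4_apply {M : Type*} (T : (Fin 4 → Fin 2) → M → ℂ) (a b c d : Fin 2) (x : M) :
    SpinDyad.sym4 T ![a, b, c, d] x = (1 / 24 : ℂ) *
      ((T ![a, b, c, d] x + T ![a, b, d, c] x + T ![a, c, b, d] x + T ![a, c, d, b] x
          + T ![a, d, b, c] x + T ![a, d, c, b] x)
        + (T ![b, a, c, d] x + T ![b, a, d, c] x + T ![b, c, a, d] x + T ![b, c, d, a] x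
          + T ![b, d, a, c] x + T ![b, d, c, a] x)
        + (T ![c, a, b, d] x + T ![c, a, d, b] x + T ![c, b, a, d] x + T ![c, b, d, a] x
          + T ![c, d, a, b] x + T ![c, d, b, a] x)
        + (T ![d, a, b, c] x + T ![d, a, c, b] x + T ![d, b, a, c] x + T ![d, b, c, a] x
          + T ![d, c, a, b] x + T ![d, c, b, a] x)) := by
  have h := sum_perm_fin_four (fun i j k l => T ![![a, b, c, d] i, ![a, b, c, d] j,
    ![a, b, c, d] k, ![a, b, c, d] l] x)
  have e (s : Equiv.Perm (Fin 4)) : ![a, b, c, d] ∘ s = ![![a, b, c, d] (s 0),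
      ![a, b, c, d] (s 1), ![a, b, c, d] (s 2), ![a, b, c, d] (s 3)] := by
    ext i; fin_cases i <;> rfl
  simp only [SpinDyad.sym4, e]
  rw [h]
  rfl

variable {M : Type*} [TopologicalSpace M] [ChartedSpace (EuclideanSpace ℝ (Fin 4)) M]
  [IsManifold (𝓡 4) ∞ M]

namespace SpinDyad

variable {S : Spacetime M} (D : SpinDyad S)

/-! ### The curvature of Einstein metrics -/

theorem riemUp_apply (A A' B B' C C' E E' : Fin 2) (x : M) :
    (D.frame.riemUp A A' B B' C C' E E' : M → ℂ) x
      = (if C' = E' then (D.frame.F A A' B B' C E : M → ℂ) x else 0)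
        + (if C = E then (starRingEnd ℂ) ((D.frame.F A' A B' B C' E' : M → ℂ) x) else 0) := by
  rw [SpinFrame.riemUp_eq]
  split_ifs <;> rfl

set_option maxHeartbeats 800000 in
-- the Finset sums in the curvature contractions are expanded completely
theorem einstein_curvature {Λ : ℝ} (hE : D.IsEinstein Λ) (x : M) :
    let f := fun A A' B B' C E => (D.frame.F A A' B B' C E : M → ℂ) x
    (f 0 0 0 1 0 1 = -D.Psi0 x ∧ f 0 0 0 1 0 0 = D.Psi1 x ∧
      f 0 0 0 1 1 0 = D.Psi2 x + 2 * Λ) ∧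
    (f 0 0 1 1 0 1 = -D.Psi1 x ∧ f 0 0 1 1 0 0 = D.Psi2 x - Λ ∧ f 0 0 1 1 1 0 = D.Psi3 x) ∧
    (f 0 1 1 0 0 1 = D.Psi1 x ∧ f 0 1 1 0 0 0 = -D.Psi2 x + Λ ∧ f 0 1 1 0 1 0 = -D.Psi3 x) ∧
    (f 0 0 1 0 0 1 = 0 ∧ f 0 0 1 0 0 0 = 0 ∧ f 0 0 1 0 1 0 = 0) ∧
    (f 0 1 1 1 0 1 = 0 ∧ f 0 1 1 1 0 0 = 0 ∧ f 0 1 1 1 1 0 = 0) ∧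
    f 1 0 1 1 0 1 = -D.Psi2 x - 2 * Λ ∧ f 1 0 1 1 0 0 = D.Psi3 x := by
  intro f
  set g : Fin 2 → Fin 2 → Fin 2 → Fin 2 → Fin 2 → Fin 2 → ℂ :=
    fun A A' B B' C E => (starRingEnd ℂ) (f A' A B' B C E)
  have hup (A A' B B' C C' E E' : Fin 2) : (D.frame.riemUp A A' B B' C C' E E' : M → ℂ) x
      = (if C' = E' then f A A' B B' C E else 0) + (if C = E then g A A' B B' C' E' else 0) :=
    D.riemUp_apply A A' B B' C C' E E' x
  have fs (A A' B B' C E : Fin 2) : f B B' A A' C E = -f A A' B B' C E := by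
    simp only [f, D.frame.F_antisymm A A' B B']; rfl
  have gs (A A' B B' C E : Fin 2) : g B B' A A' C E = -g A A' B B' C E := by
    simp only [g, fs A' A B' B, map_neg]
  have ft (A A' B B' : Fin 2) : f A A' B B' 1 1 = -f A A' B B' 0 0 := by
    simp only [f, D.frame.F_trace A A' B B']; rfl
  have gt (A A' B B' : Fin 2) : g A A' B B' 1 1 = -g A A' B B' 0 0 := by
    simp only [g, ft, map_neg]
  have fz (A A' C E : Fin 2) : f A A' A A' C E = 0 := self_eq_neg.1 (fs A A' A A' C E)
  have gz (A A' C E : Fin 2) : g A A' A A' C E = 0 := self_eq_neg.1 (gs A A' A A' C E)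
  have hric (A A' C C' : Fin 2) : D.ricci A A' C C' x = ∑ B, ∑ B', ∑ E, ∑ E',
      eps B E * eps B' E' * ∑ K, ∑ K', (D.frame.riemUp A A' B B' C C' K K' : M → ℂ) x
        * (eps K E * eps K' E') := by
    simp only [ricci, riem_eq]
  have cyc (A A' B B' C C' E E' : Fin 2) := congrFun (congrArg Subtype.val
    (D.frame.riemUp_cyclic A A' B B' C C' E E')) x
  have hX (k : Fin 4 → Fin 2) : (1 / 4 : ℂ) * ∑ A' : Fin 2, ∑ B' : Fin 2, ∑ C' : Fin 2,
      ∑ E' : Fin 2, eps A' B' * eps C' E' * D.riem (k 0) A' (k 1) B' (k 2) C' (k 3) E' x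
      = (1 / 2 : ℂ) * ∑ K, (f (k 0) 0 (k 1) 1 (k 2) K - f (k 0) 1 (k 1) 0 (k 2) K) * eps K (k 3) := by
    generalize k 0 = a
    generalize k 1 = b
    generalize k 2 = c
    generalize k 3 = e
    simp only [riem_eq, hup, Fin.sum_univ_two]
    fin_cases c <;> fin_cases e <;> simp [eps, ft, gt] <;> ring
  have hw (a b c e : Fin 2) := sym4_apply (fun u x => (1 / 4 : ℂ) * ∑ A' : Fin 2, ∑ B' : Fin 2,
      ∑ C' : Fin 2, ∑ E' : Fin 2,
      eps A' B' * eps C' E' * D.riem (u 0) A' (u 1) B' (u 2) C' (u 3) E' x) a b c e x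
  simp only [hX] at hw
  clear_value g
  clear hX
  clear_value f
  have q0 : D.Psi0 x = _ := hw 0 0 0 0
  have q1 : D.Psi1 x = _ := hw 0 0 0 1
  have q2 : D.Psi2 x = _ := hw 0 0 1 1
  have q3 : D.Psi3 x = _ := hw 0 1 1 1
  have hs := hE.2 x
  have c00011000 := cyc 0 0 0 1 1 0 0 0
  have c00011010 := cyc 0 0 0 1 1 0 1 0
  have c00011011 := cyc 0 0 0 1 1 0 1 1
  have c00011101 := cyc 0 0 0 1 1 1 0 1
  have c00011110 := cyc 0 0 0 1 1 1 1 0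
  have c00011111 := cyc 0 0 0 1 1 1 1 1
  have c00101100 := cyc 0 0 1 0 1 1 0 0
  have c00101101 := cyc 0 0 1 0 1 1 0 1
  have c00101110 := cyc 0 0 1 0 1 1 1 0
  have c00101111 := cyc 0 0 1 0 1 1 1 1
  have c01101100 := cyc 0 1 1 0 1 1 0 0
  have c01101101 := cyc 0 1 1 0 1 1 0 1
  have c01101110 := cyc 0 1 1 0 1 1 1 0
  have c01101111 := cyc 0 1 1 0 1 1 1 1
  have p0000 := hE.1 0 0 0 0 x
  have p0001 := hE.1 0 0 0 1 x
  have p0010 := hE.1 0 0 1 0 x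
  have p0011 := hE.1 0 0 1 1 x
  have p0101 := hE.1 0 1 0 1 x
  have p0111 := hE.1 0 1 1 1 x
  have p1010 := hE.1 1 0 1 0 x
  have p1011 := hE.1 1 0 1 1 x
  have p1111 := hE.1 1 1 1 1 x
  have sw := And.intro (fs 0 0 0 1) (And.intro (fs 0 0 1 0) (And.intro (fs 0 0 1 1)
    (And.intro (fs 0 1 1 0) (And.intro (fs 0 1 1 1) (fs 1 0 1 1)))))
  have sg := And.intro (gs 0 0 0 1) (And.intro (gs 0 0 1 0) (And.intro (gs 0 0 1 1)
    (And.intro (gs 0 1 1 0) (And.intro (gs 0 1 1 1) (gs 1 0 1 1)))))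
  simp only [Matrix.cons_val, Fin.sum_univ_two, eps, Fin.isValue, and_self, and_true,
    and_false, zero_ne_one, one_ne_zero, reduceIte, ft, fz, sw, mul_zero, zero_mul,
    mul_one, one_mul, add_zero, zero_add, neg_zero, mul_neg, neg_mul, neg_neg, sub_zero]
    at q0 q1 q2 q3
  simp only [scalarCurv] at hs
  simp only [Phi, scalarCurv] at p0000 p0001 p0010 p0011 p0101 p0111 p1010 p1011 p1111
  simp only [hric, hup, Fin.sum_univ_two, eps, Fin.isValue, and_self, and_true, and_false,
    zero_ne_one, one_ne_zero, reduceIte, ft, gt, fz, gz, sw, sg, mul_zero, zero_mul,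
    mul_one, one_mul, add_zero, zero_add, neg_zero, mul_neg, neg_mul, neg_neg, sub_zero]
    at hs p0000 p0001 p0010 p0011 p0101 p0111 p1010 p1011 p1111
  simp only [AddMemClass.coe_add, ZeroMemClass.coe_zero, Pi.add_apply, Pi.zero_apply, hup,
    Fin.isValue, zero_ne_one, one_ne_zero, reduceIte, ft, gt, fz, gz, sw, sg]
    at c00011000 c00011010 c00011011 c00011101 c00011110 c00011111 c00101100
  simp only [AddMemClass.coe_add, ZeroMemClass.coe_zero, Pi.add_apply, Pi.zero_apply, hup,
    Fin.isValue, zero_ne_one, one_ne_zero, reduceIte, ft, gt, fz, gz, sw, sg]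
    at c00101101 c00101110 c00101111 c01101100 c01101101 c01101110 c01101111
  refine ⟨⟨?_, ?_, ?_⟩, ⟨?_, ?_, ?_⟩, ⟨?_, ?_, ?_⟩, ⟨?_, ?_, ?_⟩, ⟨?_, ?_, ?_⟩, ?_, ?_⟩
  · linear_combination q0
  · linear_combination -1/4 * c00011010 - 1/4 * c00011111 - q1
  · linear_combination 1/3 * c00011000 + 1/3 * c00011101 + 1/6 * c00101110 + 1/6 * c01101111 + 2
      * hs - q2
  · linear_combination 1/4 * c00011010 - 1/4 * c00011111 - p0001 + q1
  · linear_combination 1/12 * c00011000 + 1/12 * c00011101 + 5/12 * c00101110 - 1/12 * c01101111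
      + p0011 - hs - q2
  · linear_combination -3/4 * c00101100 - 1/4 * c01101101 + p1011 - q3
  · linear_combination 3/4 * c00011010 + 1/4 * c00011111 - p0001 - q1
  · linear_combination 1/6 * c00011000 + 1/6 * c00011101 + 1/3 * c00101110 - 1/6 * c01101111 +
      p0011 + hs + q2
  · linear_combination -1/4 * c00101100 + 1/4 * c01101101 + p1011 + q3
  · linear_combination -1/2 * c00011011 - p0000
  · linear_combination -1/2 * c00101111 + p0010
  · linear_combination 1/2 * c00101101 + p1010
  · linear_combination 1/2 * c00011110 - p0101
  · linear_combination 1/2 * c01101110 + p0111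
  · linear_combination -1/2 * c01101100 + p1111
  · linear_combination 1/6 * c00011000 + 1/6 * c00011101 + 1/3 * c00101110 + 1/3 * c01101111 - 2
      * hs + q2
  · linear_combination 1/4 * c00101100 + 1/4 * c01101101 - q3

end SpinDyad
end GHP
end

namespace GHP

namespace SpinFrame

variable {R : Type*} [CommRing R] [Algebra ℂ R] (N : SpinFrame R)

theorem comm_c (A A' B B' : Fin 2) (f : R) : N.d A A' (N.d B B' f) - N.d B B' (N.d A A' f)
    = ∑ C, ∑ C', N.c A A' B B' C C' * N.d C C' f := N.comm A A' B B' f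

theorem jacobi_c (A A' B B' C C' E E' : Fin 2) :
    N.d A A' (N.c B B' C C' E E') + N.d B B' (N.c C C' A A' E E') + N.d C C' (N.c A A' B B' E E')
      + ∑ K, ∑ K', (N.c B B' C C' K K' * N.c A A' K K' E E'
        + N.c C C' A A' K K' * N.c B B' K K' E E' + N.c A A' B B' K K' * N.c C C' K K' E E')
      = 0 := N.jacobi A A' B B' C C' E E'

theorem c_antisymm (A A' B B' C C' : Fin 2) : N.c B B' A A' C C' = -N.c A A' B B' C C' := by
  simp only [c]; ring

/-- The Bianchi identity for the curvature of the spin connection. -/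
theorem bianchi (A A' B B' C C' I J : Fin 2) :
    (N.d A A' (N.F B B' C C' I J) + N.d B B' (N.F C C' A A' I J) + N.d C C' (N.F A A' B B' I J))
      + ∑ K, ((N.F B B' C C' I K * N.conn A A' K J - N.conn A A' I K * N.F B B' C C' K J)
        + (N.F C C' A A' I K * N.conn B B' K J - N.conn B B' I K * N.F C C' A A' K J)
        + (N.F A A' B B' I K * N.conn C C' K J - N.conn C C' I K * N.F A A' B B' K J))
      - ∑ K, ∑ K', (N.c A A' B B' K K' * N.F K K' C C' I J + N.c B B' C C' K K' * N.F K K' A A' I J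
        + N.c C C' A A' K K' * N.F K K' B B' I J) = 0 := by
  have h1 := N.comm_c A A' B B' (N.conn C C' I J)
  have h2 := N.comm_c B B' C C' (N.conn A A' I J)
  have h3 := N.comm_c C C' A A' (N.conn B B' I J)
  have j (E E' : Fin 2) := N.jacobi_c A A' B B' C C' E E'
  have j00 := j 0 0
  have j01 := j 0 1
  have j10 := j 1 0
  have j11 := j 1 1
  have ac (K K' E E' : Fin 2) := N.c_antisymm A A' K K' E E'
  have bc (K K' E E' : Fin 2) := N.c_antisymm B B' K K' E E'
  have cc (K K' E E' : Fin 2) := N.c_antisymm C C' K K' E E'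
  simp only [F, Fin.sum_univ_two, map_add, map_sub, Derivation.leibniz, smul_eq_mul]
    at h1 h2 h3 j00 j01 j10 j11 ⊢
  simp only [ac 0 0, ac 0 1, ac 1 0, ac 1 1, bc 0 0, bc 0 1, bc 1 0, bc 1 1, cc 0 0, cc 0 1,
    cc 1 0, cc 1 1]
  linear_combination h1 + h2 + h3 - N.conn 0 0 I J * j00 - N.conn 0 1 I J * j01
    - N.conn 1 0 I J * j10 - N.conn 1 1 I J * j11

end SpinFrame

end GHP

namespace GHP

namespace SpinFrame

variable {R : Type*} [CommRing R] [Algebra ℂ R] (N : SpinFrame R)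

/-! ### Spin coefficients and weighted derivatives -/

/-- `κ = m^a D l_a`. -/
def kap : R := -N.conn 0 0 0 1
/-- `σ = m^a δ l_a`. -/
def sig : R := -N.conn 0 1 0 1
/-- `ρ = m^a δ' l_a`. -/
def rho : R := -N.conn 1 0 0 1
/-- `τ = m^a D' l_a`. -/
def tau : R := -N.conn 1 1 0 1
/-- `τ' = m̄^a D n_a`. -/
def tau' : R := -N.conn 0 0 1 0
/-- `ρ' = m̄^a δ n_a`. -/
def rho' : R := -N.conn 0 1 1 0
/-- `σ' = m̄^a δ' n_a`. -/
def sig' : R := -N.conn 1 0 1 0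
/-- `κ' = m̄^a D' n_a`. -/
def kap' : R := -N.conn 1 1 1 0
/-- The coefficient of `o` in `∇_{AA'} o`. -/
def om (A A' : Fin 2) : R := N.conn A A' 0 0

/-- The weighted derivative of a scalar of weight `{p,q}`. -/
def Th (p q : ℤ) (A A' : Fin 2) (f : R) : R :=
  N.d A A' f - p * N.om A A' * f - q * N.conj (N.om A' A) * f

theorem conj_Th (p q : ℤ) (A A' : Fin 2) (f : R) :
    N.conj (N.Th p q A A' f) = N.Th q p A' A (N.conj f) := by
  simp only [Th, map_sub, map_mul, map_intCast, N.conj_d, N.conj_conj]; ring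

theorem F_self (A A' C E : Fin 2) : N.F A A' A A' C E = 0 := by
  simp only [F, c, Fin.sum_univ_two]; ring

theorem conn_00 (A A' : Fin 2) : N.conn A A' 0 0 = N.om A A' := rfl
theorem conn_11 (A A' : Fin 2) : N.conn A A' 1 1 = -N.om A A' := N.conn_trace A A'
theorem conn_0001 : N.conn 0 0 0 1 = -N.kap := (neg_neg _).symm
theorem conn_0101 : N.conn 0 1 0 1 = -N.sig := (neg_neg _).symm
theorem conn_1001 : N.conn 1 0 0 1 = -N.rho := (neg_neg _).symm
theorem conn_1101 : N.conn 1 1 0 1 = -N.tau := (neg_neg _).symm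
theorem conn_0010 : N.conn 0 0 1 0 = -N.tau' := (neg_neg _).symm
theorem conn_0110 : N.conn 0 1 1 0 = -N.rho' := (neg_neg _).symm
theorem conn_1010 : N.conn 1 0 1 0 = -N.sig' := (neg_neg _).symm
theorem conn_1110 : N.conn 1 1 1 0 = -N.kap' := (neg_neg _).symm

/-- Einstein spin frames of Petrov type II with repeated principal spinor `o`. -/
structure IsTypeII (Ψ₂ Ψ₃ : R) (Λ : ℂ) : Prop where
  cancel : ∀ f, Ψ₂ * f = 0 → f = 0
  conj_Λ : N.conj (algebraMap ℂ R Λ) = algebraMap ℂ R Λ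
  lm01 : N.F 0 0 0 1 0 1 = 0
  lm00 : N.F 0 0 0 1 0 0 = 0
  lm10 : N.F 0 0 0 1 1 0 = Ψ₂ + 2 * algebraMap ℂ R Λ
  ln01 : N.F 0 0 1 1 0 1 = 0
  ln00 : N.F 0 0 1 1 0 0 = Ψ₂ - algebraMap ℂ R Λ
  ln10 : N.F 0 0 1 1 1 0 = Ψ₃
  mb01 : N.F 0 1 1 0 0 1 = 0
  mb00 : N.F 0 1 1 0 0 0 = -Ψ₂ + algebraMap ℂ R Λ
  mb10 : N.F 0 1 1 0 1 0 = -Ψ₃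
  lb01 : N.F 0 0 1 0 0 1 = 0
  lb00 : N.F 0 0 1 0 0 0 = 0
  lb10 : N.F 0 0 1 0 1 0 = 0
  mn01 : N.F 0 1 1 1 0 1 = 0
  mn00 : N.F 0 1 1 1 0 0 = 0
  mn10 : N.F 0 1 1 1 1 0 = 0
  bn01 : N.F 1 0 1 1 0 1 = -Ψ₂ - 2 * algebraMap ℂ R Λ
  bn00 : N.F 1 0 1 1 0 0 = Ψ₃

namespace IsTypeII

variable {N} {Ψ₂ Ψ₃ : R} {Λ : ℂ} (H : N.IsTypeII Ψ₂ Ψ₃ Λ)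
include H

theorem bianchi_eqs : N.kap = 0 ∧ N.sig = 0 ∧ N.d 0 0 Ψ₂ = 3 * N.rho * Ψ₂
    ∧ N.d 0 1 Ψ₂ = 3 * N.tau * Ψ₂
    ∧ N.d 0 0 Ψ₃ = N.d 1 0 Ψ₂ - 3 * N.tau' * Ψ₂ + 2 * N.rho * Ψ₃ - 2 * N.om 0 0 * Ψ₃
    ∧ N.d 0 1 Ψ₃ = N.d 1 1 Ψ₂ - 3 * N.rho' * Ψ₂ + 2 * N.tau * Ψ₃ - 2 * N.om 0 1 * Ψ₃ := by
  have h1 := N.bianchi 0 0 0 1 1 0 0 1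
  have h2 := N.bianchi 0 0 0 1 1 1 0 1
  have h3 := N.bianchi 0 0 0 1 1 0 0 0
  have h4 := N.bianchi 0 0 0 1 1 1 0 0
  have h5 := N.bianchi 0 0 1 0 1 1 0 0
  have h6 := N.bianchi 0 1 1 0 1 1 0 0
  simp only [
    Fin.sum_univ_two, Fin.isValue, F_self, N.F_trace, N.F_antisymm 0 0 0 1, N.F_antisymm 0 0 1 0,
    N.F_antisymm 0 0 1 1, N.F_antisymm 0 1 1 0, N.F_antisymm 0 1 1 1, N.F_antisymm 1 0 1 1,
    H.lm01, H.lm00, H.lm10, H.ln01, H.ln00, H.ln10, H.mb01, H.mb00, H.mb10, H.lb01, H.lb00,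
    H.lb10, H.mn01, H.mn00, H.mn10, H.bn01, H.bn00] at h1 h2 h3 h4 h5 h6
  simp only [
    c, N.Γ_eq, Fin.sum_univ_two, reduceIte, Fin.isValue, zero_ne_one, one_ne_zero, map_neg,
    map_zero, conn_00, conn_11, conn_0001, conn_0101, conn_1001, conn_1101, conn_0010, conn_0110,
    conn_1010, conn_1110, map_sub, map_add, Derivation.map_algebraMap] at h1 h2 h3 h4 h5 h6
  have k : N.kap = 0 := H.cancel _ (by
    have : (3 : R) * (Ψ₂ * N.kap) = 0 := by linear_combination h1
    have := congrArg (algebraMap ℂ R (1 / 3) * ·) this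
    simpa [← mul_assoc, ← map_ofNat (algebraMap ℂ R) 3, ← map_mul] using this)
  have s : N.sig = 0 := H.cancel _ (by
    have : (3 : R) * (Ψ₂ * N.sig) = 0 := by linear_combination h2
    have := congrArg (algebraMap ℂ R (1 / 3) * ·) this
    simpa [← mul_assoc, ← map_ofNat (algebraMap ℂ R) 3, ← map_mul] using this)
  simp only [k, s, map_zero] at h3 h4 h5 h6
  exact ⟨k, s, by linear_combination -h3, by linear_combination -h4, by linear_combination h5,
    by linear_combination h6⟩

/-- The Ricci identities for the spin coefficients. -/
theorem ricci_eqs :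
    N.Th 1 1 0 0 N.rho = N.rho ^ 2 ∧
    N.Th 1 1 0 1 N.rho = N.tau * (N.rho - N.conj N.rho) ∧
    N.Th 1 (-1) 0 0 N.tau = N.rho * (N.tau - N.conj N.tau') ∧
    N.Th 1 (-1) 0 1 N.tau = N.tau ^ 2 - N.rho * N.conj N.sig' ∧
    N.Th 1 1 1 1 N.rho
      = N.Th 1 (-1) 1 0 N.tau + N.rho * N.conj N.rho' - N.tau * N.conj N.tau - Ψ₂
        - 2 * algebraMap ℂ R Λ ∧
    N.Th (-1) (-1) 0 0 N.rho'
      = N.Th (-1) 1 0 1 N.tau' + N.rho' * N.conj N.rho - N.tau' * N.conj N.tau' - Ψ₂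
        - 2 * algebraMap ℂ R Λ ∧
    N.Th (-3) 1 0 0 N.sig' = N.Th (-1) 1 1 0 N.tau' + N.rho * N.sig' - N.tau' ^ 2 ∧
    N.Th (-1) (-1) 1 0 N.rho'
      = N.Th (-3) 1 0 1 N.sig' + N.tau' * (N.rho' - N.conj N.rho') + N.kap' * (N.conj N.rho
        - N.rho) - Ψ₃ := by
  obtain ⟨k, s, -⟩ := H.bianchi_eqs
  have h0 := H.lb01
  have h1 := H.mb01
  have h2 := H.ln01
  have h3 := H.mn01
  have h4 := H.bn01
  have h5 := H.lm10
  have h6 := H.lb10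
  have h7 := H.mb10
  simp only [
    F, c, N.Γ_eq, Fin.sum_univ_two, reduceIte, Fin.isValue, zero_ne_one, one_ne_zero, map_neg,
    map_zero, conn_00, conn_11, conn_0001, conn_0101, conn_1001, conn_1101, conn_0010, conn_0110,
    conn_1010, conn_1110, k, s, neg_zero, zero_mul, mul_zero] at h0 h1 h2 h3 h4 h5 h6 h7
  simp only [Th, Int.cast_one, Int.cast_neg, Int.cast_ofNat]
  exact ⟨by linear_combination -h0,
    by linear_combination -h1,
    by linear_combination -h2,
    by linear_combination -h3,
    by linear_combination h4,
    by linear_combination -h5,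
    by linear_combination -h6,
    by linear_combination h7⟩

theorem tho_Ψ₂ : N.Th 0 0 0 0 Ψ₂ = 3 * N.rho * Ψ₂ := by
  simp [Th, H.bianchi_eqs.2.2.1]

theorem edt_Ψ₂ : N.Th 0 0 0 1 Ψ₂ = 3 * N.tau * Ψ₂ := by
  simp [Th, H.bianchi_eqs.2.2.2.1]

theorem tho_Ψ₃ : N.Th (-2) 0 0 0 Ψ₃ = N.Th 0 0 1 0 Ψ₂ - 3 * N.tau' * Ψ₂ + 2 * N.rho * Ψ₃ := by
  simp only [Th, H.bianchi_eqs.2.2.2.2.1, Int.cast_zero, Int.cast_neg, Int.cast_ofNat]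
  ring

theorem edt_Ψ₃ : N.Th (-2) 0 0 1 Ψ₃ = N.Th 0 0 1 1 Ψ₂ - 3 * N.rho' * Ψ₂ + 2 * N.tau * Ψ₃ := by
  simp only [Th, H.bianchi_eqs.2.2.2.2.2, Int.cast_zero, Int.cast_neg, Int.cast_ofNat]
  ring

/-- The commutators of the weighted derivatives. -/
theorem comm_eqs (p q : ℤ) (f : R) :
    N.Th (p - 1) (q - 1) 0 0 (N.Th p q 1 1 f)
      - N.Th (p + 1) (q + 1) 1 1 (N.Th p q 0 0 f)
      = (N.conj N.tau - N.tau') * N.Th p q 0 1 f + (N.tau - N.conj N.tau') * N.Th p q 1 0 f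
      - (p * (-(N.tau * N.tau') + Ψ₂ - algebraMap ℂ R Λ)
        + q * N.conj (-(N.tau * N.tau') + Ψ₂ - algebraMap ℂ R Λ)) * f ∧
    N.Th (p + 1) (q - 1) 0 0 (N.Th p q 0 1 f)
      - N.Th (p + 1) (q + 1) 0 1 (N.Th p q 0 0 f)
      = N.conj N.rho * N.Th p q 0 1 f - N.conj N.tau' * N.Th p q 0 0 f
      + q * N.conj (N.rho * N.tau') * f ∧
    N.Th (p - 1) (q + 1) 0 0 (N.Th p q 1 0 f)
      - N.Th (p + 1) (q + 1) 1 0 (N.Th p q 0 0 f)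
      = N.rho * N.Th p q 1 0 f - N.tau' * N.Th p q 0 0 f + p * (N.rho * N.tau') * f ∧
    N.Th (p - 1) (q + 1) 0 1 (N.Th p q 1 0 f)
      - N.Th (p + 1) (q - 1) 1 0 (N.Th p q 0 1 f)
      = (N.conj N.rho' - N.rho') * N.Th p q 0 0 f + (N.rho - N.conj N.rho) * N.Th p q 1 1 f
      + (p * (N.rho * N.rho' + Ψ₂ - algebraMap ℂ R Λ)
        - q * N.conj (N.rho * N.rho' + Ψ₂ - algebraMap ℂ R Λ)) * f ∧
    N.Th (p - 1) (q + 1) 1 1 (N.Th p q 1 0 f)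
      - N.Th (p - 1) (q - 1) 1 0 (N.Th p q 1 1 f)
      = N.conj N.rho' * N.Th p q 1 0 f + N.sig' * N.Th p q 0 1 f - N.conj N.tau * N.Th p q 1 1 f
      - N.kap' * N.Th p q 0 0 f + p * (N.rho * N.kap' - N.tau * N.sig' + Ψ₃) * f
      - q * N.conj (N.rho' * N.tau) * f ∧
    N.Th (p + 1) (q - 1) 1 1 (N.Th p q 0 1 f)
      - N.Th (p - 1) (q - 1) 0 1 (N.Th p q 1 1 f)
      = N.rho' * N.Th p q 0 1 f + N.conj N.sig' * N.Th p q 1 0 f - N.tau * N.Th p q 1 1 f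
      - N.conj N.kap' * N.Th p q 0 0 f + q * N.conj (N.rho * N.kap' - N.tau * N.sig' + Ψ₃) * f
      - p * (N.rho' * N.tau) * f := by
  obtain ⟨k, s, -⟩ := H.bianchi_eqs
  have ln := H.ln00
  have ln' := congrArg N.conj H.ln00
  have lm := H.lm00
  have lm' := congrArg N.conj H.lm00
  have lb := H.lb00
  have lb' := congrArg N.conj H.lb00
  have mb := H.mb00
  have mb' := congrArg N.conj H.mb00
  have bn := H.bn00
  have bn' := congrArg N.conj H.bn00
  have mn := H.mn00
  have mn' := congrArg N.conj H.mn00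
  have c0 := N.comm 0 0 1 1 f
  have c1 := N.comm 0 0 0 1 f
  have c2 := N.comm 0 0 1 0 f
  have c3 := N.comm 0 1 1 0 f
  have c4 := N.comm 1 1 1 0 f
  have c5 := N.comm 1 1 0 1 f
  simp only [
    F, c, N.Γ_eq, Fin.sum_univ_two, reduceIte, Fin.isValue, zero_ne_one, one_ne_zero, map_neg,
    map_zero, conn_00, conn_11, conn_0001, conn_0101, conn_1001, conn_1101, conn_0010, conn_0110,
    conn_1010, conn_1110, k, s, neg_zero, zero_mul, mul_zero, N.conj_d, N.conj_conj, map_add,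
    map_sub, map_mul, H.conj_Λ] at ln ln' lm lm' lb lb' mb mb' bn bn' mn mn' c0 c1 c2 c3 c4 c5
  simp only [Th, map_sub, map_add, map_neg, map_mul, Derivation.leibniz, smul_eq_mul, N.conj_conj,
    Derivation.map_intCast, N.conj_d, H.conj_Λ, Int.cast_add, Int.cast_sub, Int.cast_one]
  exact ⟨by linear_combination c0 - p * f * ln - q * f * ln',
    by linear_combination c1 - p * f * lm - q * f * lb',
    by linear_combination c2 - p * f * lb - q * f * lm',
    by linear_combination c3 - p * f * mb + q * f * mb',
    by linear_combination c4 + p * f * bn + q * f * mn',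
    by linear_combination c5 + p * f * mn + q * f * bn'⟩

end IsTypeII
end SpinFrame
end GHP

namespace GHP

/-! ### GHP calculus in a bigraded ring -/

/-- The GHP calculus of an Einstein spacetime of Petrov type II on the ring of all weighted
scalars.  The derivations `p` and `q` multiply a scalar of weight `{p,q}` by `p` and `q`;
the letter `b` marks complex conjugates. -/
structure GHPAlgebra (A : Type*) [CommRing A] [Algebra ℂ A] where
  þ : Derivation ℂ A A
  ð : Derivation ℂ A A
  ð' : Derivation ℂ A A
  þ' : Derivation ℂ A A
  p : Derivation ℂ A A
  q : Derivation ℂ A A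
  (ρ τ ρ' τ' σ' κ' ρb τb ρb' τb' σb' κb' Ψ₂ Ψ₃ Ψb₂ Ψb₃ : A)
  Λ : ℂ
  p_ρ : p ρ = ρ
  p_τ : p τ = τ
  p_ρ' : p ρ' = -ρ'
  p_τ' : p τ' = -τ'
  p_σ' : p σ' = -3 * σ'
  p_κ' : p κ' = -3 * κ'
  p_ρb : p ρb = ρb
  p_τb : p τb = -τb
  p_ρb' : p ρb' = -ρb'
  p_τb' : p τb' = τb'
  p_σb' : p σb' = σb'
  p_κb' : p κb' = -κb'
  p_Ψ₂ : p Ψ₂ = 0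
  p_Ψ₃ : p Ψ₃ = -2 * Ψ₃
  p_Ψb₂ : p Ψb₂ = 0
  p_Ψb₃ : p Ψb₃ = 0
  p_þ : ∀ x, p (þ x) = þ (p x) + þ x
  p_ð : ∀ x, p (ð x) = ð (p x) + ð x
  p_ð' : ∀ x, p (ð' x) = ð' (p x) - ð' x
  p_þ' : ∀ x, p (þ' x) = þ' (p x) - þ' x
  q_ρ : q ρ = ρ
  q_τ : q τ = -τ
  q_ρ' : q ρ' = -ρ'
  q_τ' : q τ' = τ'
  q_σ' : q σ' = σ'
  q_κ' : q κ' = -κ'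
  q_ρb : q ρb = ρb
  q_τb : q τb = τb
  q_ρb' : q ρb' = -ρb'
  q_τb' : q τb' = -τb'
  q_σb' : q σb' = -3 * σb'
  q_κb' : q κb' = -3 * κb'
  q_Ψ₂ : q Ψ₂ = 0
  q_Ψ₃ : q Ψ₃ = 0
  q_Ψb₂ : q Ψb₂ = 0
  q_Ψb₃ : q Ψb₃ = -2 * Ψb₃
  q_þ : ∀ x, q (þ x) = þ (q x) + þ x
  q_ð : ∀ x, q (ð x) = ð (q x) - ð x
  q_ð' : ∀ x, q (ð' x) = ð' (q x) + ð' x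
  q_þ' : ∀ x, q (þ' x) = þ' (q x) - þ' x
  þ_ρ : þ ρ = ρ ^ 2
  ð_ρ : ð ρ = τ * (ρ - ρb)
  þ_τ : þ τ = ρ * (τ - τb')
  ð_τ : ð τ = τ ^ 2 - ρ * σb'
  þ'_ρ : þ' ρ = ð' τ + ρ * ρb' - τ * τb - Ψ₂ - 2 * algebraMap ℂ A Λ
  þ_ρb : þ ρb = ρb ^ 2
  ð'_ρb : ð' ρb = τb * (ρb - ρ)
  þ'_ρb : þ' ρb = ð τb + ρb * ρ' - τb * τ - Ψb₂ - 2 * algebraMap ℂ A Λ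
  þ_τb : þ τb = ρb * (τb - τ')
  ð'_τb : ð' τb = τb ^ 2 - ρb * σ'
  þ_ρb' : þ ρb' = ð' τb' + ρb' * ρ - τb' * τ' - Ψb₂ - 2 * algebraMap ℂ A Λ
  ð_ρb' : ð ρb' = ð' σb' + τb' * (ρb' - ρ') + κb' * (ρ - ρb) - Ψb₃
  þ_σb' : þ σb' = ð τb' + ρb * σb' - τb' ^ 2
  þ_Ψ₂ : þ Ψ₂ = 3 * ρ * Ψ₂
  ð_Ψ₂ : ð Ψ₂ = 3 * τ * Ψ₂
  þ_Ψ₃ : þ Ψ₃ = ð' Ψ₂ - 3 * τ' * Ψ₂ + 2 * ρ * Ψ₃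
  ð_Ψ₃ : ð Ψ₃ = þ' Ψ₂ - 3 * ρ' * Ψ₂ + 2 * τ * Ψ₃
  comm_þ_þ' : ∀ x, þ (þ' x) - þ' (þ x) = (τb - τ') * ð x + (τ - τb') * ð' x
    - (-(τ * τ') + Ψ₂ - algebraMap ℂ A Λ) * p x - (-(τb * τb') + Ψb₂ - algebraMap ℂ A Λ) * q x
  comm_þ_ð : ∀ x, þ (ð x) - ð (þ x) = ρb * ð x - τb' * þ x + ρb * τb' * q x
  comm_þ_ð' : ∀ x, þ (ð' x) - ð' (þ x) = ρ * ð' x - τ' * þ x + ρ * τ' * p x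
  comm_ð_ð' : ∀ x, ð (ð' x) - ð' (ð x) = (ρb' - ρ') * þ x + (ρ - ρb) * þ' x
    + (ρ * ρ' + Ψ₂ - algebraMap ℂ A Λ) * p x - (ρb * ρb' + Ψb₂ - algebraMap ℂ A Λ) * q x
  comm_þ'_ð' : ∀ x, þ' (ð' x) - ð' (þ' x) = ρb' * ð' x + σ' * ð x - τb * þ' x - κ' * þ x
    + (ρ * κ' - τ * σ' + Ψ₃) * p x - ρb' * τb * q x
  comm_þ'_ð : ∀ x, þ' (ð x) - ð (þ' x) = ρ' * ð x + σb' * ð' x - τ * þ' x - κb' * þ x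
    + (ρb * κb' - τb * σb' + Ψb₃) * q x - ρ' * τ * p x

end GHP

namespace GHP

namespace GHPAlgebra

variable {A : Type*} [CommRing A] [Algebra ℂ A] (G : GHPAlgebra A)

theorem þ_þ' (x : A) : G.þ (G.þ' x) = G.þ' (G.þ x)
    + ((G.τb - G.τ') * G.ð x + (G.τ - G.τb') * G.ð' x
      - (-(G.τ * G.τ') + G.Ψ₂ - algebraMap ℂ A G.Λ) * G.p x - (-(G.τb * G.τb') + G.Ψb₂ - algebraMap ℂ A G.Λ) * G.q x) :=
  eq_add_of_sub_eq' (G.comm_þ_þ' x)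

theorem þ_ð (x : A) : G.þ (G.ð x) = G.ð (G.þ x)
    + (G.ρb * G.ð x - G.τb' * G.þ x + G.ρb * G.τb' * G.q x) :=
  eq_add_of_sub_eq' (G.comm_þ_ð x)

theorem þ_ð' (x : A) : G.þ (G.ð' x) = G.ð' (G.þ x)
    + (G.ρ * G.ð' x - G.τ' * G.þ x + G.ρ * G.τ' * G.p x) :=
  eq_add_of_sub_eq' (G.comm_þ_ð' x)

theorem ð_ð' (x : A) : G.ð (G.ð' x) = G.ð' (G.ð x)
    + ((G.ρb' - G.ρ') * G.þ x + (G.ρ - G.ρb) * G.þ' x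
      + (G.ρ * G.ρ' + G.Ψ₂ - algebraMap ℂ A G.Λ) * G.p x - (G.ρb * G.ρb' + G.Ψb₂ - algebraMap ℂ A G.Λ) * G.q x) :=
  eq_add_of_sub_eq' (G.comm_ð_ð' x)

theorem ð'_þ' (x : A) : G.ð' (G.þ' x) = G.þ' (G.ð' x)
    - (G.ρb' * G.ð' x + G.σ' * G.ð x - G.τb * G.þ' x - G.κ' * G.þ x
      + (G.ρ * G.κ' - G.τ * G.σ' + G.Ψ₃) * G.p x - G.ρb' * G.τb * G.q x) :=
  eq_sub_of_add_eq (by rw [← G.comm_þ'_ð']; ring)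

theorem ð_þ' (x : A) : G.ð (G.þ' x) = G.þ' (G.ð x)
    - (G.ρ' * G.ð x + G.σb' * G.ð' x - G.τ * G.þ' x - G.κb' * G.þ x
      + (G.ρb * G.κb' - G.τb * G.σb' + G.Ψb₃) * G.q x - G.ρ' * G.τ * G.p x) :=
  eq_sub_of_add_eq (by rw [← G.comm_þ'_ð]; ring)

/-- The Debye equation solved for `þ'þχ`. -/
structure IsDebye (χ : A) : Prop where
  p_χ : G.p χ = -4 * χ
  q_χ : G.q χ = 0
  þ'_þ : G.þ' (G.þ χ) = 6 * algebraMap ℂ A G.Λ * χ + 6 * G.Ψ₂ * χ - G.τb * G.ð χ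
    + 3 * G.τ * G.ð' χ + G.ð' (G.ð χ) + G.ρb' * G.þ χ - 3 * G.ρ * G.þ' χ

/-- The component `h_{m̄m̄}` of the Debye metric. -/
def hmm (χ : A) : A := -(G.þ (G.þ χ) + 2 * G.ρ * G.þ χ)

/-- The component `h_{nm̄}` of the Debye metric. -/
def hnm (χ : A) : A := -(G.þ (G.ð χ) + G.ρ * G.ð χ) - (G.τ + G.τb') * G.þ χ

/-- The component `h_{nn}` of the Debye metric. -/
def hnn (χ : A) : A := -(G.ð (G.ð χ) + 2 * G.τ * G.ð χ) - G.σb' * G.þ χ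

/-- The sum of the components with `BCD = 011, 101, 110`, `A' = 0` of `∇_B{}^{B'} h_{CDA'B'}`. -/
def div20 (χ : A) : A := G.ð (G.hmm χ) + 2 * G.ρb * G.hnm χ - G.þ (G.hnm χ) - G.τb' * G.hmm χ
  + 2 * G.τ * G.hmm χ - 2 * G.ρ * G.hnm χ

/-- The sum of the components with `BCD = 011, 101, 110`, `A' = 1` of `∇_B{}^{B'} h_{CDA'B'}`. -/
def div21 (χ : A) : A := G.ð (G.hnm χ) + G.σb' * G.hmm χ + G.ρb * G.hnn χ - G.þ (G.hnn χ)
  - 2 * G.τb' * G.hnm χ + 2 * G.τ * G.hnm χ - 2 * G.ρ * G.hnn χ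

/-- The component with `BCD = 111`, `A' = 0` of `∇_B{}^{B'} h_{CDA'B'}`. -/
def div30 (χ : A) : A := G.þ' (G.hmm χ) + 2 * G.τb * G.hnm χ - G.ð' (G.hnm χ) - G.ρb' * G.hmm χ

/-- The component with `BCD = 111`, `A' = 1` of `∇_B{}^{B'} h_{CDA'B'}`. -/
def div31 (χ : A) : A := G.þ' (G.hnm χ) + G.κb' * G.hmm χ + G.τb * G.hnn χ - G.ð' (G.hnn χ)
  - 2 * G.ρb' * G.hnm χ

variable (χ : A)

theorem þ'_þ_þ : G.þ' (G.þ (G.þ χ)) = G.þ (G.þ' (G.þ χ))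
    - ((G.τb - G.τ') * G.ð (G.þ χ) + (G.τ - G.τb') * G.ð' (G.þ χ)
      - (-(G.τ * G.τ') + G.Ψ₂ - algebraMap ℂ A G.Λ) * G.p (G.þ χ)
      - (-(G.τb * G.τb') + G.Ψb₂ - algebraMap ℂ A G.Λ) * G.q (G.þ χ)) := by
  rw [← G.comm_þ_þ']; ring

theorem þ'_ð_þ : G.þ' (G.ð (G.þ χ)) = G.ð (G.þ' (G.þ χ))
    + (G.ρ' * G.ð (G.þ χ) + G.σb' * G.ð' (G.þ χ) - G.τ * G.þ' (G.þ χ) - G.κb' * G.þ (G.þ χ)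
      + (G.ρb * G.κb' - G.τb * G.σb' + G.Ψb₃) * G.q (G.þ χ) - G.ρ' * G.τ * G.p (G.þ χ)) := by
  rw [← G.comm_þ'_ð]; ring

theorem þ'_ð'_þ : G.þ' (G.ð' (G.þ χ)) = G.ð' (G.þ' (G.þ χ))
    + (G.ρb' * G.ð' (G.þ χ) + G.σ' * G.ð (G.þ χ) - G.τb * G.þ' (G.þ χ) - G.κ' * G.þ (G.þ χ)
      + (G.ρ * G.κ' - G.τ * G.σ' + G.Ψ₃) * G.p (G.þ χ) - G.ρb' * G.τb * G.q (G.þ χ)) := by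
  rw [← G.comm_þ'_ð']; ring

theorem þ'_ð'_ρ : G.þ' (G.ð' G.ρ) = G.ð' (G.þ' G.ρ)
    + (G.ρb' * G.ð' G.ρ + G.σ' * G.ð G.ρ - G.τb * G.þ' G.ρ - G.κ' * G.þ G.ρ
      + (G.ρ * G.κ' - G.τ * G.σ' + G.Ψ₃) * G.p G.ρ - G.ρb' * G.τb * G.q G.ρ) := by
  rw [← G.comm_þ'_ð']; ring

end GHPAlgebra

end GHP

namespace GHP
namespace GHPAlgebra
variable {A : Type*} [CommRing A] [Algebra ℂ A] {G : GHPAlgebra A}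
theorem derivation_ofNat (D : Derivation ℂ A A) (n : ℕ) [n.AtLeastTwo] :
    D (no_index (OfNat.ofNat n : A)) = 0 :=
  D.map_natCast n
namespace IsDebye
variable {χ : A} (h : G.IsDebye χ)
include h

/-- The symmetrized divergence of the Debye metric. -/
theorem div_eq :
    G.div20 χ
      = 3 * G.ρ ^ 2 * G.ð χ + G.ρ * G.ρb * G.ð χ + G.ρ * G.ð (G.þ χ) - 3 * G.ρ * G.τ * G.þ χ
      - G.τ * G.þ (G.þ χ) ∧
    G.div21 χ
      = 3 * G.ρ * G.τ * G.ð χ - G.ρb * G.τ * G.ð χ + G.ρ * G.ð (G.ð χ) - G.τ * G.ð (G.þ χ)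
      + G.ρ * G.σb' * G.þ χ - 3 * G.τ ^ 2 * G.þ χ ∧
    G.div30 χ
      = -6 * algebraMap ℂ A G.Λ * G.ρ * χ - 2 * algebraMap ℂ A G.Λ * G.þ χ - G.Ψ₂ * G.þ χ + G.ð χ * G.ð' G.ρ
      - G.ð' G.τ * G.þ χ + G.ρ * G.ð' (G.ð χ) - G.τ * G.ð' (G.þ χ) ∧
    G.div31 χ
      = -12 * algebraMap ℂ A G.Λ * G.τ * χ - 4 * algebraMap ℂ A G.Λ * G.ð χ - 6 * G.Ψ₂ * G.τ * χ - 2 * G.Ψ₂ * G.ð χ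
      + G.ð χ * G.ð' G.τ + G.ρ * G.ρb' * G.ð χ - 3 * G.τ ^ 2 * G.ð' χ - G.τ * G.ð' (G.ð χ)
      - G.þ χ * G.þ' G.τ - G.ρb' * G.τ * G.þ χ + 3 * G.ρ * G.τ * G.þ' χ + G.ρ * G.þ' (G.ð χ) := by
  simp only [div20, div21, div30, div31, hmm, hnm, hnn]
  refine ⟨?_, ?_, ?_, ?_⟩ <;> simp only [
    map_add, map_sub, map_neg, map_zero, map_mul, Derivation.leibniz, Derivation.leibniz_pow,
    smul_eq_mul, nsmul_eq_mul, Derivation.map_algebraMap, derivation_ofNat, G.p_ρ, G.p_τ, G.p_ρ',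
    G.p_τ', G.p_σ', G.p_κ', G.p_ρb, G.p_τb, G.p_ρb', G.p_τb', G.p_σb', G.p_κb', G.p_Ψ₂, G.p_Ψ₃,
    G.p_Ψb₂, G.p_Ψb₃, G.p_þ, G.p_ð, G.p_ð', G.p_þ', G.q_ρ, G.q_τ, G.q_ρ', G.q_τ', G.q_σ', G.q_κ',
    G.q_ρb, G.q_τb, G.q_ρb', G.q_τb', G.q_σb', G.q_κb', G.q_Ψ₂, G.q_Ψ₃, G.q_Ψb₂, G.q_Ψb₃, G.q_þ,
    G.q_ð, G.q_ð', G.q_þ', G.þ_ρ, G.ð_ρ, G.þ_τ, G.ð_τ, G.þ'_ρ, G.þ_ρb, G.ð'_ρb, G.þ'_ρb, G.þ_τb,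
    G.ð'_τb, G.þ_ρb', G.ð_ρb', G.þ_σb', G.þ_Ψ₂, G.ð_Ψ₂, G.þ_Ψ₃, G.ð_Ψ₃, G.þ_þ', G.þ_ð, G.þ_ð',
    G.ð_ð', G.ð'_þ', G.ð_þ', h.þ'_þ, G.þ'_þ_þ χ, G.þ'_ð_þ χ, G.þ'_ð'_þ χ, G.þ'_ð'_ρ, h.p_χ,
    h.q_χ] <;> ring

end IsDebye
end GHPAlgebra
end GHP

namespace GHP
namespace GHPAlgebra
variable {A : Type*} [CommRing A] [Algebra ℂ A] {G : GHPAlgebra A}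
namespace IsDebye
variable {χ : A} (h : G.IsDebye χ)
include h

/-- The symmetrized second divergence of the Debye metric. -/
theorem weyl_eq :
    G.ð (G.div20 χ) + G.ρb * G.div21 χ - G.þ (G.div21 χ) - G.τb' * G.div20 χ
    + 2 * G.τ * G.div20 χ - 2 * G.ρ * G.div21 χ
      = 0 ∧
    G.þ' (G.div20 χ) + G.τb * G.div21 χ - G.ð' (G.div21 χ) - G.ρb' * G.div20 χ
    + 3 * (G.τ * G.div30 χ - G.ρ * G.div31 χ)
    + G.ð (G.div30 χ) + G.ρb * G.div31 χ - G.þ (G.div31 χ) - G.τb' * G.div30 χ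
    + G.ρ' * G.div20 χ - G.τ' * G.div21 χ
      = 0 ∧
    G.þ' (G.div30 χ) + G.τb * G.div31 χ - G.ð' (G.div31 χ) - G.ρb' * G.div30 χ
    + G.κ' * G.div20 χ - G.σ' * G.div21 χ
      = -12 * algebraMap ℂ A G.Λ * G.Ψ₂ * χ - 3 * G.Ψ₂ * G.τ * G.ð' χ + 3 * G.Ψ₂ * G.ρ * G.þ' χ
      - 6 * G.Ψ₂ ^ 2 * χ - 2 * G.Ψ₃ * G.ρ * G.ð χ + 2 * G.Ψ₃ * G.τ * G.þ χ
      + G.ð χ * G.ð' G.Ψ₂ - G.þ χ * G.þ' G.Ψ₂ := by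
  simp only [h.div_eq.1, h.div_eq.2.1, h.div_eq.2.2.1, h.div_eq.2.2.2]
  refine ⟨?_, ?_, ?_⟩ <;> simp only [
    map_add, map_sub, map_neg, map_zero, map_mul, Derivation.leibniz, Derivation.leibniz_pow,
    smul_eq_mul, nsmul_eq_mul, Derivation.map_algebraMap, derivation_ofNat, G.p_ρ, G.p_τ, G.p_ρ',
    G.p_τ', G.p_σ', G.p_κ', G.p_ρb, G.p_τb, G.p_ρb', G.p_τb', G.p_σb', G.p_κb', G.p_Ψ₂, G.p_Ψ₃,
    G.p_Ψb₂, G.p_Ψb₃, G.p_þ, G.p_ð, G.p_ð', G.p_þ', G.q_ρ, G.q_τ, G.q_ρ', G.q_τ', G.q_σ', G.q_κ',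
    G.q_ρb, G.q_τb, G.q_ρb', G.q_τb', G.q_σb', G.q_κb', G.q_Ψ₂, G.q_Ψ₃, G.q_Ψb₂, G.q_Ψb₃, G.q_þ,
    G.q_ð, G.q_ð', G.q_þ', G.þ_ρ, G.ð_ρ, G.þ_τ, G.ð_τ, G.þ'_ρ, G.þ_ρb, G.ð'_ρb, G.þ'_ρb, G.þ_τb,
    G.ð'_τb, G.þ_ρb', G.ð_ρb', G.þ_σb', G.þ_Ψ₂, G.ð_Ψ₂, G.þ_Ψ₃, G.ð_Ψ₃, G.þ_þ', G.þ_ð, G.þ_ð',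
    G.ð_ð', G.ð'_þ', G.ð_þ', h.þ'_þ, G.þ'_þ_þ χ, G.þ'_ð_þ χ, G.þ'_ð'_þ χ, G.þ'_ð'_ρ, h.p_χ,
    h.q_χ] <;> ring

end IsDebye
end GHPAlgebra
end GHP

noncomputable section

namespace GHP

/-! ### The bigraded ring of weighted scalars -/

/-- The ring of weighted scalars: finite sums of scalars of weights `{p,q}`. -/
abbrev Weighted (R : Type*) [CommRing R] : Type _ := AddMonoidAlgebra R (ℤ × ℤ)

namespace Weighted

variable {R : Type*} [CommRing R]

/-- A scalar `f` regarded as having weight `{p,q}`. -/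
def hom (p q : ℤ) (f : R) : Weighted R := AddMonoidAlgebra.single (p, q) f

theorem hom_mul (p q p' q' : ℤ) (f g : R) :
    hom p q f * hom p' q' g = hom (p' + p) (q' + q) (f * g) := by
  simp [hom, AddMonoidAlgebra.single_mul_single, add_comm]

theorem hom_add (p q : ℤ) (f g : R) : hom p q f + hom p q g = hom p q (f + g) :=
  (AddMonoidAlgebra.single_add _ _ _).symm

theorem hom_zero (p q : ℤ) : hom p q (0 : R) = 0 := AddMonoidAlgebra.single_zero _

theorem hom_neg (p q : ℤ) (f : R) : -hom p q f = hom p q (-f) := by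
  rw [neg_eq_iff_add_eq_zero, hom_add, add_neg_cancel, hom_zero]

theorem hom_sub (p q : ℤ) (f g : R) : hom p q f - hom p q g = hom p q (f - g) := by
  rw [sub_eq_add_neg, hom_neg, hom_add, sub_eq_add_neg]

theorem zsmul_hom (n p q : ℤ) (f : R) : n • hom p q f = hom p q (n * f) := by
  rw [hom, AddMonoidAlgebra.smul_single, zsmul_eq_mul, hom]

theorem induction_hom {P : Weighted R → Prop} (x : Weighted R) (zero : P 0)
    (add : ∀ x y, P x → P y → P (x + y)) (hom : ∀ p q f, P (hom p q f)) : P x :=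
  AddMonoidAlgebra.induction_linear x zero add fun g f => hom g.1 g.2 f

/-- The projection that forgets weights. -/
def forget : Weighted R →ₐ[R] R := AddMonoidAlgebra.lift R R (ℤ × ℤ) 1

theorem forget_hom (p q : ℤ) (f : R) : forget (hom p q f) = f := by
  simp [forget, hom, AddMonoidAlgebra.lift_single]

variable [Algebra ℂ R]

theorem algebraMap_eq (z : ℂ) : algebraMap ℂ (Weighted R) z = hom 0 0 (algebraMap ℂ R z) := rfl

theorem ofNat_eq (n : ℕ) [n.AtLeastTwo] : (no_index (OfNat.ofNat n : Weighted R))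
    = hom 0 0 (OfNat.ofNat n) := by
  rw [← map_ofNat (algebraMap ℂ (Weighted R)), algebraMap_eq, map_ofNat]

/-- The linear map that acts on scalars of weight `{p,q}` by `D p q` and shifts weights by
`{i,j}`. -/
def linearMap (i j : ℤ) (D : ℤ → ℤ → R →ₗ[ℂ] R) : Weighted R →ₗ[ℂ] Weighted R where
  toFun x := x.coeff.sum fun g f => hom (g.1 + i) (g.2 + j) (D g.1 g.2 f)
  map_add' x y := by
    rw [AddMonoidAlgebra.coeff_add, Finsupp.sum_add_index']
    · intro g; rw [map_zero, hom_zero]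
    · intro g a b; rw [map_add, hom_add]
  map_smul' c x := by
    rw [AddMonoidAlgebra.coeff_smul, Finsupp.sum_smul_index', Finsupp.smul_sum]
    · simp only [map_smul, hom, AddMonoidAlgebra.smul_single, RingHom.id_apply]
    · intro g; rw [map_zero, hom_zero]

theorem linearMap_hom (i j : ℤ) (D : ℤ → ℤ → R →ₗ[ℂ] R) (p q : ℤ) (f : R) :
    linearMap i j D (hom p q f) = hom (p + i) (q + j) (D p q f) := by
  simp [linearMap, hom, Finsupp.sum_single_index]

/-- The derivation of weight `{i,j}` that acts on scalars of weight `{p,q}` by `D p q`. -/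
def derivation (i j : ℤ) (D : ℤ → ℤ → R →ₗ[ℂ] R)
    (hD : ∀ p q p' q' f g, D (p + p') (q + q') (f * g) = f * D p' q' g + g * D p q f) :
    Derivation ℂ (Weighted R) (Weighted R) :=
  Derivation.mk' (linearMap i j D) fun x y => by
    induction x using induction_hom with
    | zero => simp
    | add a b ha hb => rw [add_mul, map_add, ha, hb, map_add, add_smul, smul_add]; abel
    | hom p q f =>
      induction y using induction_hom with
      | zero => simp
      | add a b ha hb => rw [mul_add, map_add, ha, hb, map_add, add_smul, smul_add]; abel
      | hom p' q' g =>
        rw [hom_mul, linearMap_hom, linearMap_hom, linearMap_hom, smul_eq_mul, smul_eq_mul, hom_mul,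
          hom_mul, add_comm p', add_comm q', hD, ← hom_add]
        congr 2 <;> ring

theorem derivation_hom (i j : ℤ) (D : ℤ → ℤ → R →ₗ[ℂ] R) (hD) (p q : ℤ) (f : R) :
    derivation i j D hD (hom p q f) = hom (p + i) (q + j) (D p q f) := linearMap_hom i j D p q f

end Weighted

end GHP

end

noncomputable section

namespace GHP

namespace SpinFrame

open Weighted

variable {R : Type*} [CommRing R] [Algebra ℂ R] (N : SpinFrame R)

/-- The weighted derivatives on the ring of weighted scalars; the index pair determines the
weight of the operator. -/
def wd (A A' : Fin 2) (i j : ℤ) : Derivation ℂ (Weighted R) (Weighted R) :=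
  Weighted.derivation i j
    (fun p q => (N.d A A').toLinearMap
      - LinearMap.mulLeft ℂ ((p : R) * N.om A A' + (q : R) * N.conj (N.om A' A)))
    fun p q p' q' f g => by
      simp only [LinearMap.sub_apply, Derivation.coeFn_coe,
        LinearMap.mulLeft_apply, Derivation.leibniz, smul_eq_mul, Int.cast_add]
      ring

theorem wd_hom (A A' : Fin 2) (i j p q : ℤ) (f : R) :
    N.wd A A' i j (hom p q f) = hom (p + i) (q + j) (N.Th p q A A' f) := by
  rw [wd, derivation_hom]
  congr 1
  simp only [LinearMap.sub_apply, Derivation.coeFn_coe,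
    LinearMap.mulLeft_apply, Th]
  ring

end SpinFrame

namespace Weighted

variable {R : Type*} [CommRing R] [Algebra ℂ R]

/-- Multiplication by the first weight. -/
def wtp : Derivation ℂ (Weighted R) (Weighted R) :=
  Weighted.derivation 0 0 (fun p _ => LinearMap.mulLeft ℂ (p : R))
    fun p q p' q' f g => by simp only [LinearMap.mulLeft_apply, Int.cast_add]; ring

/-- Multiplication by the second weight. -/
def wtq : Derivation ℂ (Weighted R) (Weighted R) :=
  Weighted.derivation 0 0 (fun _ q => LinearMap.mulLeft ℂ (q : R))
    fun p q p' q' f g => by simp only [LinearMap.mulLeft_apply, Int.cast_add]; ring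

theorem wtp_hom (p q : ℤ) (f : R) : wtp (hom p q f) = hom p q (p * f) := by
  simp [wtp, derivation_hom]

theorem wtq_hom (p q : ℤ) (f : R) : wtq (hom p q f) = hom p q (q * f) := by
  simp [wtq, derivation_hom]

end Weighted

namespace SpinFrame

open Weighted

variable {R : Type*} [CommRing R] [Algebra ℂ R] (N : SpinFrame R)

theorem wtp_wd (A A' : Fin 2) (i j : ℤ) (x : Weighted R) :
    wtp (N.wd A A' i j x) = N.wd A A' i j (wtp x) + i • N.wd A A' i j x := by
  induction x using induction_hom with
  | zero => simp
  | add x y hx hy => simp only [map_add, hx, hy, smul_add]; ring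
  | hom p q f =>
    simp only [wd_hom, wtp_hom, zsmul_hom, hom_add, Th, Derivation.leibniz, Derivation.map_intCast,
      smul_eq_mul]
    congr 1; push_cast; ring

theorem wtq_wd (A A' : Fin 2) (i j : ℤ) (x : Weighted R) :
    wtq (N.wd A A' i j x) = N.wd A A' i j (wtq x) + j • N.wd A A' i j x := by
  induction x using induction_hom with
  | zero => simp
  | add x y hx hy => simp only [map_add, hx, hy, smul_add]; ring
  | hom p q f =>
    simp only [wd_hom, wtq_hom, zsmul_hom, hom_add, Th, Derivation.leibniz, Derivation.map_intCast,
      smul_eq_mul]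
    congr 1; push_cast; ring

variable {N} {Ψ₂ Ψ₃ : R} {Λ : ℂ}

/-- The GHP calculus of an Einstein spin frame of Petrov type II. -/
def IsTypeII.ghp (H : N.IsTypeII Ψ₂ Ψ₃ Λ) : GHPAlgebra (Weighted R) where
  þ := N.wd 0 0 1 1
  ð := N.wd 0 1 1 (-1)
  ð' := N.wd 1 0 (-1) 1
  þ' := N.wd 1 1 (-1) (-1)
  p := wtp
  q := wtq
  ρ := hom 1 1 N.rho
  τ := hom 1 (-1) N.tau
  ρ' := hom (-1) (-1) N.rho'
  τ' := hom (-1) 1 N.tau'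
  σ' := hom (-3) 1 N.sig'
  κ' := hom (-3) (-1) N.kap'
  ρb := hom 1 1 (N.conj N.rho)
  τb := hom (-1) 1 (N.conj N.tau)
  ρb' := hom (-1) (-1) (N.conj N.rho')
  τb' := hom 1 (-1) (N.conj N.tau')
  σb' := hom 1 (-3) (N.conj N.sig')
  κb' := hom (-1) (-3) (N.conj N.kap')
  Ψ₂ := hom 0 0 Ψ₂
  Ψ₃ := hom (-2) 0 Ψ₃
  Ψb₂ := hom 0 0 (N.conj Ψ₂)
  Ψb₃ := hom 0 (-2) (N.conj Ψ₃)
  Λ := Λ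
  p_ρ := by simp [wtp_hom, wtq_hom, hom_neg, hom_mul, hom_zero, ofNat_eq]
  p_τ := by simp [wtp_hom, wtq_hom, hom_neg, hom_mul, hom_zero, ofNat_eq]
  p_ρ' := by simp [wtp_hom, wtq_hom, hom_neg, hom_mul, hom_zero, ofNat_eq]
  p_τ' := by simp [wtp_hom, wtq_hom, hom_neg, hom_mul, hom_zero, ofNat_eq]
  p_σ' := by simp [wtp_hom, wtq_hom, hom_neg, hom_mul, hom_zero, ofNat_eq]
  p_κ' := by simp [wtp_hom, wtq_hom, hom_neg, hom_mul, hom_zero, ofNat_eq]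
  p_ρb := by simp [wtp_hom, wtq_hom, hom_neg, hom_mul, hom_zero, ofNat_eq]
  p_τb := by simp [wtp_hom, wtq_hom, hom_neg, hom_mul, hom_zero, ofNat_eq]
  p_ρb' := by simp [wtp_hom, wtq_hom, hom_neg, hom_mul, hom_zero, ofNat_eq]
  p_τb' := by simp [wtp_hom, wtq_hom, hom_neg, hom_mul, hom_zero, ofNat_eq]
  p_σb' := by simp [wtp_hom, wtq_hom, hom_neg, hom_mul, hom_zero, ofNat_eq]
  p_κb' := by simp [wtp_hom, wtq_hom, hom_neg, hom_mul, hom_zero, ofNat_eq]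
  p_Ψ₂ := by simp [wtp_hom, wtq_hom, hom_neg, hom_mul, hom_zero, ofNat_eq]
  p_Ψ₃ := by simp [wtp_hom, wtq_hom, hom_neg, hom_mul, hom_zero, ofNat_eq]
  p_Ψb₂ := by simp [wtp_hom, wtq_hom, hom_neg, hom_mul, hom_zero, ofNat_eq]
  p_Ψb₃ := by simp [wtp_hom, wtq_hom, hom_neg, hom_mul, hom_zero, ofNat_eq]
  p_þ x := by simp [wtp_wd, sub_eq_add_neg]
  p_ð x := by simp [wtp_wd, sub_eq_add_neg]
  p_ð' x := by simp [wtp_wd, sub_eq_add_neg]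
  p_þ' x := by simp [wtp_wd, sub_eq_add_neg]
  q_ρ := by simp [wtp_hom, wtq_hom, hom_neg, hom_mul, hom_zero, ofNat_eq]
  q_τ := by simp [wtp_hom, wtq_hom, hom_neg, hom_mul, hom_zero, ofNat_eq]
  q_ρ' := by simp [wtp_hom, wtq_hom, hom_neg, hom_mul, hom_zero, ofNat_eq]
  q_τ' := by simp [wtp_hom, wtq_hom, hom_neg, hom_mul, hom_zero, ofNat_eq]
  q_σ' := by simp [wtp_hom, wtq_hom, hom_neg, hom_mul, hom_zero, ofNat_eq]
  q_κ' := by simp [wtp_hom, wtq_hom, hom_neg, hom_mul, hom_zero, ofNat_eq]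
  q_ρb := by simp [wtp_hom, wtq_hom, hom_neg, hom_mul, hom_zero, ofNat_eq]
  q_τb := by simp [wtp_hom, wtq_hom, hom_neg, hom_mul, hom_zero, ofNat_eq]
  q_ρb' := by simp [wtp_hom, wtq_hom, hom_neg, hom_mul, hom_zero, ofNat_eq]
  q_τb' := by simp [wtp_hom, wtq_hom, hom_neg, hom_mul, hom_zero, ofNat_eq]
  q_σb' := by simp [wtp_hom, wtq_hom, hom_neg, hom_mul, hom_zero, ofNat_eq]
  q_κb' := by simp [wtp_hom, wtq_hom, hom_neg, hom_mul, hom_zero, ofNat_eq]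
  q_Ψ₂ := by simp [wtp_hom, wtq_hom, hom_neg, hom_mul, hom_zero, ofNat_eq]
  q_Ψ₃ := by simp [wtp_hom, wtq_hom, hom_neg, hom_mul, hom_zero, ofNat_eq]
  q_Ψb₂ := by simp [wtp_hom, wtq_hom, hom_neg, hom_mul, hom_zero, ofNat_eq]
  q_Ψb₃ := by simp [wtp_hom, wtq_hom, hom_neg, hom_mul, hom_zero, ofNat_eq]
  q_þ x := by simp [wtq_wd, sub_eq_add_neg]
  q_ð x := by simp [wtq_wd, sub_eq_add_neg]
  q_ð' x := by simp [wtq_wd, sub_eq_add_neg]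
  q_þ' x := by simp [wtq_wd, sub_eq_add_neg]
  þ_ρ := by
    simp only [wd_hom, wtp_hom, wtq_hom, hom_mul, hom_add, hom_sub, hom_neg, algebraMap_eq,
      ofNat_eq, pow_two, Int.reduceAdd, Int.reduceNeg, add_assoc, add_zero, zero_add, H.ricci_eqs.1]
  ð_ρ := by
    simp only [wd_hom, wtp_hom, wtq_hom, hom_mul, hom_add, hom_sub, hom_neg, algebraMap_eq,
      ofNat_eq, pow_two, Int.reduceAdd, Int.reduceNeg, add_assoc, add_zero, zero_add, H.ricci_eqs.2.1]
  þ_τ := by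
    simp only [wd_hom, wtp_hom, wtq_hom, hom_mul, hom_add, hom_sub, hom_neg, algebraMap_eq,
      ofNat_eq, pow_two, Int.reduceAdd, Int.reduceNeg, add_assoc, add_zero, zero_add, H.ricci_eqs.2.2.1]
  ð_τ := by
    simp only [wd_hom, wtp_hom, wtq_hom, hom_mul, hom_add, hom_sub, hom_neg, algebraMap_eq,
      ofNat_eq, pow_two, Int.reduceAdd, Int.reduceNeg, add_assoc, add_zero, zero_add, H.ricci_eqs.2.2.2.1]
  þ'_ρ := by
    simp only [wd_hom, wtp_hom, wtq_hom, hom_mul, hom_add, hom_sub, hom_neg, algebraMap_eq,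
      ofNat_eq, pow_two, Int.reduceAdd, Int.reduceNeg, add_assoc, add_zero, zero_add, H.ricci_eqs.2.2.2.2.1]
  þ_ρb := by
    have h := congrArg N.conj H.ricci_eqs.1
    simp only [conj_Th, map_add, map_sub, map_mul, map_pow, map_ofNat, N.conj_conj, H.conj_Λ,
      pow_two] at h
    simp only [wd_hom, wtp_hom, wtq_hom, hom_mul, hom_add, hom_sub, hom_neg, algebraMap_eq,
      ofNat_eq, pow_two, Int.reduceAdd, Int.reduceNeg, add_assoc, add_zero, zero_add, h]
  ð'_ρb := by
    have h := congrArg N.conj H.ricci_eqs.2.1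
    simp only [conj_Th, map_add, map_sub, map_mul, map_pow, map_ofNat, N.conj_conj, H.conj_Λ,
      pow_two] at h
    simp only [wd_hom, wtp_hom, wtq_hom, hom_mul, hom_add, hom_sub, hom_neg, algebraMap_eq,
      ofNat_eq, pow_two, Int.reduceAdd, Int.reduceNeg, add_assoc, add_zero, zero_add, h]
  þ'_ρb := by
    have h := congrArg N.conj H.ricci_eqs.2.2.2.2.1
    simp only [conj_Th, map_add, map_sub, map_mul, map_pow, map_ofNat, N.conj_conj, H.conj_Λ,
      pow_two] at h
    simp only [wd_hom, wtp_hom, wtq_hom, hom_mul, hom_add, hom_sub, hom_neg, algebraMap_eq,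
      ofNat_eq, pow_two, Int.reduceAdd, Int.reduceNeg, add_assoc, add_zero, zero_add, h]
  þ_τb := by
    have h := congrArg N.conj H.ricci_eqs.2.2.1
    simp only [conj_Th, map_add, map_sub, map_mul, map_pow, map_ofNat, N.conj_conj, H.conj_Λ,
      pow_two] at h
    simp only [wd_hom, wtp_hom, wtq_hom, hom_mul, hom_add, hom_sub, hom_neg, algebraMap_eq,
      ofNat_eq, pow_two, Int.reduceAdd, Int.reduceNeg, add_assoc, add_zero, zero_add, h]
  ð'_τb := by
    have h := congrArg N.conj H.ricci_eqs.2.2.2.1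
    simp only [conj_Th, map_add, map_sub, map_mul, map_pow, map_ofNat, N.conj_conj, H.conj_Λ,
      pow_two] at h
    simp only [wd_hom, wtp_hom, wtq_hom, hom_mul, hom_add, hom_sub, hom_neg, algebraMap_eq,
      ofNat_eq, pow_two, Int.reduceAdd, Int.reduceNeg, add_assoc, add_zero, zero_add, h]
  þ_ρb' := by
    have h := congrArg N.conj H.ricci_eqs.2.2.2.2.2.1
    simp only [conj_Th, map_add, map_sub, map_mul, map_pow, map_ofNat, N.conj_conj, H.conj_Λ,
      pow_two] at h
    simp only [wd_hom, wtp_hom, wtq_hom, hom_mul, hom_add, hom_sub, hom_neg, algebraMap_eq,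
      ofNat_eq, pow_two, Int.reduceAdd, Int.reduceNeg, add_assoc, add_zero, zero_add, h]
  ð_ρb' := by
    have h := congrArg N.conj H.ricci_eqs.2.2.2.2.2.2.2
    simp only [conj_Th, map_add, map_sub, map_mul, map_pow, map_ofNat, N.conj_conj, H.conj_Λ,
      pow_two] at h
    simp only [wd_hom, wtp_hom, wtq_hom, hom_mul, hom_add, hom_sub, hom_neg, algebraMap_eq,
      ofNat_eq, pow_two, Int.reduceAdd, Int.reduceNeg, add_assoc, add_zero, zero_add, h]
  þ_σb' := by
    have h := congrArg N.conj H.ricci_eqs.2.2.2.2.2.2.1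
    simp only [conj_Th, map_add, map_sub, map_mul, map_pow, map_ofNat, N.conj_conj, H.conj_Λ,
      pow_two] at h
    simp only [wd_hom, wtp_hom, wtq_hom, hom_mul, hom_add, hom_sub, hom_neg, algebraMap_eq,
      ofNat_eq, pow_two, Int.reduceAdd, Int.reduceNeg, add_assoc, add_zero, zero_add, h]
  þ_Ψ₂ := by
    simp only [wd_hom, wtp_hom, wtq_hom, hom_mul, hom_add, hom_sub, hom_neg, algebraMap_eq,
      ofNat_eq, pow_two, Int.reduceAdd, Int.reduceNeg, add_assoc, add_zero, zero_add, H.tho_Ψ₂]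
  ð_Ψ₂ := by
    simp only [wd_hom, wtp_hom, wtq_hom, hom_mul, hom_add, hom_sub, hom_neg, algebraMap_eq,
      ofNat_eq, pow_two, Int.reduceAdd, Int.reduceNeg, add_assoc, add_zero, zero_add, H.edt_Ψ₂]
  þ_Ψ₃ := by
    simp only [wd_hom, wtp_hom, wtq_hom, hom_mul, hom_add, hom_sub, hom_neg, algebraMap_eq,
      ofNat_eq, pow_two, Int.reduceAdd, Int.reduceNeg, add_assoc, add_zero, zero_add, H.tho_Ψ₃]
  ð_Ψ₃ := by
    simp only [wd_hom, wtp_hom, wtq_hom, hom_mul, hom_add, hom_sub, hom_neg, algebraMap_eq,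
      ofNat_eq, pow_two, Int.reduceAdd, Int.reduceNeg, add_assoc, add_zero, zero_add, H.edt_Ψ₃]
  comm_þ_þ' x := by
    induction x using induction_hom with
    | zero => simp
    | add x y hx hy => simp only [map_add, mul_add]; linear_combination hx + hy
    | hom p q f =>
      have h := (H.comm_eqs p q f).1
      simp only [sub_eq_add_neg, Int.reduceNeg] at h
      simp only [sub_eq_add_neg, wd_hom, wtp_hom, wtq_hom, hom_mul, hom_add, hom_sub, hom_neg,
        algebraMap_eq, ofNat_eq, pow_two, Int.reduceAdd, Int.reduceNeg, add_assoc, add_zero, zero_add]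
      rw [h]
      congr 1
      simp only [map_mul, map_add, map_neg, H.conj_Λ]
      ring
  comm_þ_ð x := by
    induction x using induction_hom with
    | zero => simp
    | add x y hx hy => simp only [map_add, mul_add]; linear_combination hx + hy
    | hom p q f =>
      have h := (H.comm_eqs p q f).2.1
      simp only [sub_eq_add_neg, Int.reduceNeg] at h
      simp only [sub_eq_add_neg, wd_hom, wtp_hom, wtq_hom, hom_mul, hom_add, hom_sub, hom_neg,
        algebraMap_eq, ofNat_eq, pow_two, Int.reduceAdd, Int.reduceNeg, add_assoc, add_zero, zero_add]
      rw [h]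
      congr 1
      simp only [map_mul, map_add, map_neg, H.conj_Λ]
      ring
  comm_þ_ð' x := by
    induction x using induction_hom with
    | zero => simp
    | add x y hx hy => simp only [map_add, mul_add]; linear_combination hx + hy
    | hom p q f =>
      have h := (H.comm_eqs p q f).2.2.1
      simp only [sub_eq_add_neg, Int.reduceNeg] at h
      simp only [sub_eq_add_neg, wd_hom, wtp_hom, wtq_hom, hom_mul, hom_add, hom_sub, hom_neg,
        algebraMap_eq, ofNat_eq, pow_two, Int.reduceAdd, Int.reduceNeg, add_assoc, add_zero, zero_add]
      rw [h]
      congr 1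
      ring
  comm_ð_ð' x := by
    induction x using induction_hom with
    | zero => simp
    | add x y hx hy => simp only [map_add, mul_add]; linear_combination hx + hy
    | hom p q f =>
      have h := (H.comm_eqs p q f).2.2.2.1
      simp only [sub_eq_add_neg, Int.reduceNeg] at h
      simp only [sub_eq_add_neg, wd_hom, wtp_hom, wtq_hom, hom_mul, hom_add, hom_sub, hom_neg,
        algebraMap_eq, ofNat_eq, pow_two, Int.reduceAdd, Int.reduceNeg, add_assoc, add_zero, zero_add]
      rw [h]
      congr 1
      simp only [map_mul, map_add, map_neg, H.conj_Λ]
      ring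
  comm_þ'_ð' x := by
    induction x using induction_hom with
    | zero => simp
    | add x y hx hy => simp only [map_add, mul_add]; linear_combination hx + hy
    | hom p q f =>
      have h := (H.comm_eqs p q f).2.2.2.2.1
      simp only [sub_eq_add_neg, Int.reduceNeg] at h
      simp only [sub_eq_add_neg, wd_hom, wtp_hom, wtq_hom, hom_mul, hom_add, hom_sub, hom_neg,
        algebraMap_eq, ofNat_eq, pow_two, Int.reduceAdd, Int.reduceNeg, add_assoc, add_zero, zero_add]
      rw [h]
      congr 1
      simp only [map_mul, map_add, map_neg, H.conj_Λ]
      ring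
  comm_þ'_ð x := by
    induction x using induction_hom with
    | zero => simp
    | add x y hx hy => simp only [map_add, mul_add]; linear_combination hx + hy
    | hom p q f =>
      have h := (H.comm_eqs p q f).2.2.2.2.2
      simp only [sub_eq_add_neg, Int.reduceNeg] at h
      simp only [sub_eq_add_neg, wd_hom, wtp_hom, wtq_hom, hom_mul, hom_add, hom_sub, hom_neg,
        algebraMap_eq, ofNat_eq, pow_two, Int.reduceAdd, Int.reduceNeg, add_assoc, add_zero, zero_add]
      rw [h]
      congr 1
      simp only [map_mul, map_add, map_neg, H.conj_Λ]
      ring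

end SpinFrame

end GHP

end

noncomputable section

namespace GHP

namespace SpinFrame

variable {R : Type*} [CommRing R] [Algebra ℂ R] (N : SpinFrame R)

/-! ### The spinor covariant derivative -/

/-- The covariant derivative of a spinor field with components in `R`. -/
def nabla {k k' : ℕ} (T : (Fin k → Fin 2) → (Fin k' → Fin 2) → R)
    (u : Fin (k + 1) → Fin 2) (v : Fin (k' + 1) → Fin 2) : R :=
  N.d (u 0) (v 0) (T (Fin.tail u) (Fin.tail v))
    - ∑ i : Fin k, ∑ C : Fin 2, N.conn (u 0) (v 0) (Fin.tail u i) C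
        * T (Function.update (Fin.tail u) i C) (Fin.tail v)
    - ∑ i : Fin k', ∑ C : Fin 2, N.conj (N.conn (v 0) (u 0) (Fin.tail v i) C)
        * T (Fin.tail u) (Function.update (Fin.tail v) i C)

theorem tail_two (a b : Fin 2) : Fin.tail ![a, b] = ![b] := rfl
theorem tail_three (a b c : Fin 2) : Fin.tail ![a, b, c] = ![b, c] := rfl
theorem tail_four (a b c e : Fin 2) : Fin.tail ![a, b, c, e] = ![b, c, e] := rfl
theorem update_one (a K : Fin 2) : Function.update ![a] 0 K = ![K] := by
  ext i; fin_cases i; rfl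
theorem update_two_zero (a b K : Fin 2) : Function.update ![a, b] 0 K = ![K, b] := by
  ext i; fin_cases i <;> rfl
theorem update_two_one (a b K : Fin 2) : Function.update ![a, b] 1 K = ![a, K] := by
  ext i; fin_cases i <;> rfl
theorem update_three_zero (a b c K : Fin 2) : Function.update ![a, b, c] 0 K = ![K, b, c] := by
  ext i; fin_cases i <;> rfl
theorem update_three_one (a b c K : Fin 2) : Function.update ![a, b, c] 1 K = ![a, K, c] := by
  ext i; fin_cases i <;> rfl
theorem update_three_two (a b c K : Fin 2) : Function.update ![a, b, c] 2 K = ![a, b, K] := by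
  ext i; fin_cases i <;> rfl

theorem nabla_three_one (T : (Fin 3 → Fin 2) → (Fin 1 → Fin 2) → R) (a b c e p q : Fin 2) :
    N.nabla T ![a, b, c, e] ![p, q] = N.d a p (T ![b, c, e] ![q])
      - ∑ K, (N.conn a p b K * T ![K, c, e] ![q] + N.conn a p c K * T ![b, K, e] ![q]
        + N.conn a p e K * T ![b, c, K] ![q])
      - ∑ K, N.conj (N.conn p a q K) * T ![b, c, e] ![K] := by
  simp only [nabla, tail_two, tail_four, Fin.sum_univ_three, Fin.sum_univ_two, Fin.sum_univ_one,
    Fin.isValue, update_one, update_three_zero, update_three_one, update_three_two,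
    Matrix.cons_val]
  ring

theorem nabla_three_three (T : (Fin 3 → Fin 2) → (Fin 3 → Fin 2) → R)
    (a b c e p q r s : Fin 2) :
    N.nabla T ![a, b, c, e] ![p, q, r, s] = N.d a p (T ![b, c, e] ![q, r, s])
      - ∑ K, (N.conn a p b K * T ![K, c, e] ![q, r, s] + N.conn a p c K * T ![b, K, e] ![q, r, s]
        + N.conn a p e K * T ![b, c, K] ![q, r, s])
      - ∑ K, (N.conj (N.conn p a q K) * T ![b, c, e] ![K, r, s]
        + N.conj (N.conn p a r K) * T ![b, c, e] ![q, K, s]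
        + N.conj (N.conn p a s K) * T ![b, c, e] ![q, r, K]) := by
  simp only [nabla, tail_four, Fin.sum_univ_three, Fin.sum_univ_two,
    Fin.isValue, update_three_zero, update_three_one, update_three_two, Matrix.cons_val]
  ring

theorem nabla_two_two (T : (Fin 2 → Fin 2) → (Fin 2 → Fin 2) → R) (a b c p q r : Fin 2) :
    N.nabla T ![a, b, c] ![p, q, r] = N.d a p (T ![b, c] ![q, r])
      - ∑ K, (N.conn a p b K * T ![K, c] ![q, r] + N.conn a p c K * T ![b, K] ![q, r])
      - ∑ K, (N.conj (N.conn p a q K) * T ![b, c] ![K, r]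
        + N.conj (N.conn p a r K) * T ![b, c] ![q, K]) := by
  simp only [nabla, tail_three, Fin.sum_univ_two, Fin.isValue, update_two_zero, update_two_one,
    Matrix.cons_val]
  ring

theorem nabla_two_zero (T : (Fin 2 → Fin 2) → (Fin 0 → Fin 2) → R) (a b c p : Fin 2) :
    N.nabla T ![a, b, c] ![p] = N.d a p (T ![b, c] ![])
      - ∑ K, (N.conn a p b K * T ![K, c] ![] + N.conn a p c K * T ![b, K] ![]) := by
  have : Fin.tail ![p] = ![] := rfl
  simp only [nabla, tail_three, this, Fin.sum_univ_two, Fin.isValue, update_two_zero,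
    update_two_one, Matrix.cons_val, Finset.univ_eq_empty, Finset.sum_empty]
  ring

/-- The divergence `∇_B{}^{B'} h_{CDA'B'}`. -/
def div (h : (Fin 2 → Fin 2) → (Fin 2 → Fin 2) → R) (u : Fin 3 → Fin 2) (v : Fin 1 → Fin 2) : R :=
  N.nabla h u ![1, v 0, 0] - N.nabla h u ![0, v 0, 1]

/-- The contraction `∇_A{}^{A'} ∇_B{}^{B'} h_{CDA'B'}` is an iterated divergence. -/
theorem contract_nabla_nabla (h : (Fin 2 → Fin 2) → (Fin 2 → Fin 2) → R) (a b c e : Fin 2) :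
    (N.nabla (N.nabla h) ![a, b, c, e] ![1, 1, 0, 0]
        - N.nabla (N.nabla h) ![a, b, c, e] ![1, 0, 0, 1])
      - (N.nabla (N.nabla h) ![a, b, c, e] ![0, 1, 1, 0]
        - N.nabla (N.nabla h) ![a, b, c, e] ![0, 0, 1, 1])
      = N.nabla (N.div h) ![a, b, c, e] ![1, 0] - N.nabla (N.div h) ![a, b, c, e] ![0, 1] := by
  simp only [nabla_three_three, nabla_three_one, div, Fin.sum_univ_two, Fin.isValue,
    Matrix.cons_val, N.conn_trace, map_neg, map_sub]
  ring

end SpinFrame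

end GHP

end

noncomputable section

namespace GHP

namespace SpinFrame

variable {R : Type*} [CommRing R] [Algebra ℂ R] (N : SpinFrame R)

/-- The tensor `h_{ab} = Z l_a l_b - 2 Y l_{(a} m_{b)} + X m_a m_b` as a spinor field. -/
def metric (X Y Z : R) (u v : Fin 2 → Fin 2) : R :=
  if u 0 = 1 ∧ u 1 = 1 then
    (if v 0 = 0 then (if v 1 = 0 then X else Y) else (if v 1 = 0 then Y else Z))
  else 0

/-- The iterated divergence `∇_A{}^{A'} ∇_B{}^{B'} h_{CDA'B'}`. -/
def ddiv (h : (Fin 2 → Fin 2) → (Fin 2 → Fin 2) → R) (u : Fin 4 → Fin 2) : R :=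
  N.nabla (N.div h) u ![1, 0] - N.nabla (N.div h) u ![0, 1]

variable {N}

theorem div_metric (hk : N.kap = 0) (hs : N.sig = 0) (X Y Z : R) (a : Fin 2) :
    N.div (metric X Y Z) ![0, 0, 0] ![a] = 0 ∧ N.div (metric X Y Z) ![0, 0, 1] ![a] = 0 ∧
    N.div (metric X Y Z) ![0, 1, 0] ![a] = 0 ∧ N.div (metric X Y Z) ![1, 0, 0] ![a] = 0 := by
  fin_cases a <;>
  simp [div, nabla_two_two, metric, Fin.sum_univ_two, conn_0001, conn_0101, hk, hs]

theorem div_metric_two (hk : N.kap = 0) (X Y Z : R) :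
    N.div (metric X Y Z) ![0, 1, 1] ![0] + N.div (metric X Y Z) ![1, 0, 1] ![0]
        + N.div (metric X Y Z) ![1, 1, 0] ![0]
      = N.Th (-2) 2 0 1 X + 2 * N.conj N.rho * Y - N.Th (-2) 0 0 0 Y - N.conj N.tau' * X
        + 2 * N.tau * X - 2 * N.rho * Y ∧
    N.div (metric X Y Z) ![0, 1, 1] ![1] + N.div (metric X Y Z) ![1, 0, 1] ![1]
        + N.div (metric X Y Z) ![1, 1, 0] ![1]
      = N.Th (-2) 0 0 1 Y + N.conj N.sig' * X + N.conj N.rho * Z - N.Th (-2) (-2) 0 0 Z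
        - 2 * N.conj N.tau' * Y + 2 * N.tau * Y - 2 * N.rho * Z := by
  simp [div, nabla_two_two, metric, Fin.sum_univ_two, conn_00, conn_11, conn_0001, conn_0101,
    conn_1001, conn_1101, conn_0010, conn_0110, conn_1010, conn_1110, hk, Th]
  constructor <;> ring

theorem div_metric_three (hs : N.sig = 0) (X Y Z : R) :
    N.div (metric X Y Z) ![1, 1, 1] ![0] = N.Th (-2) 2 1 1 X + 2 * N.conj N.tau * Y
      - N.Th (-2) 0 1 0 Y - N.conj N.rho' * X ∧
    N.div (metric X Y Z) ![1, 1, 1] ![1] = N.Th (-2) 0 1 1 Y + N.conj N.kap' * X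
      + N.conj N.tau * Z - N.Th (-2) (-2) 1 0 Z - 2 * N.conj N.rho' * Y := by
  simp [div, nabla_two_two, metric, Fin.sum_univ_two, conn_00, conn_11, conn_0001, conn_0101,
    conn_1001, conn_1101, conn_0010, conn_0110, conn_1010, conn_1110, hs, Th]
  constructor <;> ring

theorem ddiv_metric (hk : N.kap = 0) (hs : N.sig = 0) (X Y Z : R)
    {h : (Fin 2 → Fin 2) → (Fin 2 → Fin 2) → R} (hh : h = metric X Y Z)
    {S₀ S₁ T₀ T₁ : R}
    (hS₀ : N.div h ![0, 1, 1] ![0] + N.div h ![1, 0, 1] ![0] + N.div h ![1, 1, 0] ![0] = S₀)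
    (hS₁ : N.div h ![0, 1, 1] ![1] + N.div h ![1, 0, 1] ![1] + N.div h ![1, 1, 0] ![1] = S₁)
    (hT₀ : N.div h ![1, 1, 1] ![0] = T₀) (hT₁ : N.div h ![1, 1, 1] ![1] = T₁) :
    N.ddiv h ![0, 0, 0, 0] = 0 ∧
    N.ddiv h ![0, 0, 0, 1] + N.ddiv h ![0, 0, 1, 0] + N.ddiv h ![0, 1, 0, 0]
      + N.ddiv h ![1, 0, 0, 0] = 0 ∧
    N.ddiv h ![0, 0, 1, 1] + N.ddiv h ![0, 1, 0, 1] + N.ddiv h ![0, 1, 1, 0]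
      + N.ddiv h ![1, 0, 0, 1] + N.ddiv h ![1, 0, 1, 0] + N.ddiv h ![1, 1, 0, 0]
      = N.Th (-1) 1 0 1 S₀ + N.conj N.rho * S₁ - N.Th (-1) (-1) 0 0 S₁ - N.conj N.tau' * S₀
        + 2 * N.tau * S₀ - 2 * N.rho * S₁ ∧
    N.ddiv h ![0, 1, 1, 1] + N.ddiv h ![1, 0, 1, 1] + N.ddiv h ![1, 1, 0, 1]
      + N.ddiv h ![1, 1, 1, 0]
      = N.Th (-1) 1 1 1 S₀ + N.conj N.tau * S₁ - N.Th (-1) (-1) 1 0 S₁ - N.conj N.rho' * S₀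
        + 3 * (N.tau * T₀ - N.rho * T₁)
        + N.Th (-3) 1 0 1 T₀ + N.conj N.rho * T₁ - N.Th (-3) (-1) 0 0 T₁ - N.conj N.tau' * T₀
        + N.rho' * S₀ - N.tau' * S₁ ∧
    N.ddiv h ![1, 1, 1, 1]
      = N.Th (-3) 1 1 1 T₀ + N.conj N.tau * T₁ - N.Th (-3) (-1) 1 0 T₁ - N.conj N.rho' * T₀
        + N.kap' * S₀ - N.sig' * S₁ := by
  have e := div_metric hk hs X Y Z
  subst hh hS₀ hS₁ hT₀ hT₁
  simp only [ddiv, nabla_three_one, Fin.sum_univ_two, Fin.isValue, conn_00, conn_11, conn_0001,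
    conn_0101, conn_1001, conn_1101, conn_0010, conn_0110, conn_1010, conn_1110, hk, hs, Th,
    map_neg, map_add, map_zero, neg_zero, zero_mul, mul_zero, add_zero, zero_add, sub_zero,
    (e _).1, (e _).2.1, (e _).2.2.1, (e _).2.2.2, Int.cast_neg, Int.cast_one,
    Int.cast_ofNat]
  refine ⟨trivial, trivial, ?_, ?_, ?_⟩ <;> ring

end SpinFrame

end GHP

end

noncomputable section

namespace GHP

theorem GHPAlgebra.IsDebye.of_debye {A : Type*} [CommRing A] [Algebra ℂ A] {G : GHPAlgebra A}
    {χ : A} (hp : G.p χ = -4 * χ) (hq : G.q χ = 0)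
    (h : G.þ' (G.þ χ + 3 * G.ρ * χ) - G.ρb' * (G.þ χ + 3 * G.ρ * χ)
      - (G.ð' (G.ð χ + 3 * G.τ * χ) - G.τb * (G.ð χ + 3 * G.τ * χ)) - 3 * G.Ψ₂ * χ = 0) :
    G.IsDebye χ where
  p_χ := hp
  q_χ := hq
  þ'_þ := by
    simp only [map_add, Derivation.leibniz, smul_eq_mul, derivation_ofNat, G.þ'_ρ] at h
    linear_combination h

namespace SpinFrame

open Weighted

variable {R : Type*} [CommRing R] [Algebra ℂ R] (N : SpinFrame R)

/-! ### The Debye metric in a spin frame -/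

/-- The component `h_{m̄m̄}` of the Debye metric. -/
def hmm (χ : R) : R := -(N.Th (-3) 1 0 0 (N.Th (-4) 0 0 0 χ) + 2 * N.rho * N.Th (-4) 0 0 0 χ)

/-- The component `h_{nm̄}` of the Debye metric. -/
def hnm (χ : R) : R := -(N.Th (-3) (-1) 0 0 (N.Th (-4) 0 0 1 χ) + N.rho * N.Th (-4) 0 0 1 χ)
  - (N.tau + N.conj N.tau') * N.Th (-4) 0 0 0 χ

/-- The component `h_{nn}` of the Debye metric. -/
def hnn (χ : R) : R := -(N.Th (-3) (-1) 0 1 (N.Th (-4) 0 0 1 χ) + 2 * N.tau * N.Th (-4) 0 0 1 χ)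
  - N.conj N.sig' * N.Th (-4) 0 0 0 χ

/-- The Debye equation. -/
def IsDebye (Ψ₂ χ : R) : Prop :=
  N.Th (-3) 1 1 1 (N.Th (-4) 0 0 0 χ + 3 * N.rho * χ)
    - N.conj N.rho' * (N.Th (-4) 0 0 0 χ + 3 * N.rho * χ)
    - (N.Th (-3) (-1) 1 0 (N.Th (-4) 0 0 1 χ + 3 * N.tau * χ)
      - N.conj N.tau * (N.Th (-4) 0 0 1 χ + 3 * N.tau * χ)) - 3 * Ψ₂ * χ = 0

namespace IsTypeII

variable {N} {Ψ₂ Ψ₃ : R} {Λ : ℂ} (H : N.IsTypeII Ψ₂ Ψ₃ Λ)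

theorem ghp_þ : H.ghp.þ = N.wd 0 0 1 1 := rfl
theorem ghp_ð : H.ghp.ð = N.wd 0 1 1 (-1) := rfl
theorem ghp_ð' : H.ghp.ð' = N.wd 1 0 (-1) 1 := rfl
theorem ghp_þ' : H.ghp.þ' = N.wd 1 1 (-1) (-1) := rfl
theorem ghp_p : H.ghp.p = wtp := rfl
theorem ghp_q : H.ghp.q = wtq := rfl
theorem ghp_ρ : H.ghp.ρ = hom 1 1 N.rho := rfl
theorem ghp_τ : H.ghp.τ = hom 1 (-1) N.tau := rfl
theorem ghp_ρ' : H.ghp.ρ' = hom (-1) (-1) N.rho' := rfl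
theorem ghp_τ' : H.ghp.τ' = hom (-1) 1 N.tau' := rfl
theorem ghp_σ' : H.ghp.σ' = hom (-3) 1 N.sig' := rfl
theorem ghp_κ' : H.ghp.κ' = hom (-3) (-1) N.kap' := rfl
theorem ghp_ρb : H.ghp.ρb = hom 1 1 (N.conj N.rho) := rfl
theorem ghp_τb : H.ghp.τb = hom (-1) 1 (N.conj N.tau) := rfl
theorem ghp_ρb' : H.ghp.ρb' = hom (-1) (-1) (N.conj N.rho') := rfl
theorem ghp_τb' : H.ghp.τb' = hom 1 (-1) (N.conj N.tau') := rfl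
theorem ghp_σb' : H.ghp.σb' = hom 1 (-3) (N.conj N.sig') := rfl
theorem ghp_κb' : H.ghp.κb' = hom (-1) (-3) (N.conj N.kap') := rfl
theorem ghp_Ψ₂ : H.ghp.Ψ₂ = hom 0 0 Ψ₂ := rfl
theorem ghp_Ψ₃ : H.ghp.Ψ₃ = hom (-2) 0 Ψ₃ := rfl
theorem ghp_Λ : H.ghp.Λ = Λ := rfl

theorem ghp_metric (χ : R) :
    H.ghp.hmm (hom (-4) 0 χ) = hom (-2) 2 (N.hmm χ) ∧
    H.ghp.hnm (hom (-4) 0 χ) = hom (-2) 0 (N.hnm χ) ∧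
    H.ghp.hnn (hom (-4) 0 χ) = hom (-2) (-2) (N.hnn χ) := by
  refine ⟨?_, ?_, ?_⟩ <;>
  simp only [
    GHPAlgebra.hmm, GHPAlgebra.hnm, GHPAlgebra.hnn, hmm, hnm, hnn, ghp_þ, ghp_ð, ghp_ð', ghp_þ',
    ghp_p, ghp_q, ghp_ρ, ghp_τ, ghp_ρ', ghp_τ', ghp_σ', ghp_κ', ghp_ρb, ghp_τb, ghp_ρb', ghp_τb',
    ghp_σb', ghp_κb', ghp_Ψ₂, ghp_Ψ₃, ghp_Λ, wd_hom, wtp_hom, wtq_hom, hom_mul, hom_add, hom_sub,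
    hom_neg, algebraMap_eq, ofNat_eq, pow_two, Int.reduceAdd, Int.reduceNeg, add_zero, zero_add]

theorem ghp_div {χ S₀ S₁ T₀ T₁ : R}
    (hS₀ : S₀ = N.Th (-2) 2 0 1 (N.hmm χ) + 2 * N.conj N.rho * N.hnm χ
      - N.Th (-2) 0 0 0 (N.hnm χ) - N.conj N.tau' * N.hmm χ + 2 * N.tau * N.hmm χ
      - 2 * N.rho * N.hnm χ)
    (hS₁ : S₁ = N.Th (-2) 0 0 1 (N.hnm χ) + N.conj N.sig' * N.hmm χ + N.conj N.rho * N.hnn χ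
      - N.Th (-2) (-2) 0 0 (N.hnn χ) - 2 * N.conj N.tau' * N.hnm χ + 2 * N.tau * N.hnm χ
      - 2 * N.rho * N.hnn χ)
    (hT₀ : T₀ = N.Th (-2) 2 1 1 (N.hmm χ) + 2 * N.conj N.tau * N.hnm χ
      - N.Th (-2) 0 1 0 (N.hnm χ) - N.conj N.rho' * N.hmm χ)
    (hT₁ : T₁ = N.Th (-2) 0 1 1 (N.hnm χ) + N.conj N.kap' * N.hmm χ + N.conj N.tau * N.hnn χ
      - N.Th (-2) (-2) 1 0 (N.hnn χ) - 2 * N.conj N.rho' * N.hnm χ) :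
    H.ghp.div20 (hom (-4) 0 χ) = hom (-1) 1 S₀ ∧
    H.ghp.div21 (hom (-4) 0 χ) = hom (-1) (-1) S₁ ∧
    H.ghp.div30 (hom (-4) 0 χ) = hom (-3) 1 T₀ ∧
    H.ghp.div31 (hom (-4) 0 χ) = hom (-3) (-1) T₁ := by
  refine ⟨?_, ?_, ?_, ?_⟩ <;>
  simp only [
    hS₀, hS₁, hT₀, hT₁, GHPAlgebra.div20, GHPAlgebra.div21, GHPAlgebra.div30, GHPAlgebra.div31,
    ghp_metric, ghp_þ, ghp_ð, ghp_ð', ghp_þ', ghp_p, ghp_q, ghp_ρ, ghp_τ, ghp_ρ', ghp_τ', ghp_σ',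
    ghp_κ', ghp_ρb, ghp_τb, ghp_ρb', ghp_τb', ghp_σb', ghp_κb', ghp_Ψ₂, ghp_Ψ₃, ghp_Λ, wd_hom,
    wtp_hom, wtq_hom, hom_mul, hom_add, hom_sub, hom_neg, algebraMap_eq, ofNat_eq, pow_two,
    Int.reduceAdd, Int.reduceNeg, add_zero, zero_add]

theorem ghp_isDebye {χ : R} (h : N.IsDebye Ψ₂ χ) : H.ghp.IsDebye (hom (-4) 0 χ) := by
  refine .of_debye ?_ ?_ ?_
  · simp [ghp_p, wtp_hom, ofNat_eq, hom_neg, hom_mul]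
  · simp [ghp_q, wtq_hom, hom_zero]
  rw [IsDebye] at h
  simp only [
    ghp_þ, ghp_ð, ghp_ð', ghp_þ', ghp_p, ghp_q, ghp_ρ, ghp_τ, ghp_ρ', ghp_τ', ghp_σ', ghp_κ',
    ghp_ρb, ghp_τb, ghp_ρb', ghp_τb', ghp_σb', ghp_κb', ghp_Ψ₂, ghp_Ψ₃, ghp_Λ, wd_hom, wtp_hom,
    wtq_hom, hom_mul, hom_add, hom_sub, hom_neg, algebraMap_eq, ofNat_eq, pow_two, Int.reduceAdd,
    Int.reduceNeg, add_zero, zero_add]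
  rw [h, hom_zero]

include H in
/-- The iterated divergence of the Debye metric, symmetrized. -/
theorem ddiv_debye {χ : R} (hχ : N.IsDebye Ψ₂ χ) {h : (Fin 2 → Fin 2) → (Fin 2 → Fin 2) → R}
    (hh : h = metric (N.hmm χ) (N.hnm χ) (N.hnn χ)) :
    N.ddiv h ![0, 0, 0, 0] = 0 ∧
    N.ddiv h ![0, 0, 0, 1] + N.ddiv h ![0, 0, 1, 0] + N.ddiv h ![0, 1, 0, 0]
      + N.ddiv h ![1, 0, 0, 0] = 0 ∧
    N.ddiv h ![0, 0, 1, 1] + N.ddiv h ![0, 1, 0, 1] + N.ddiv h ![0, 1, 1, 0]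
      + N.ddiv h ![1, 0, 0, 1] + N.ddiv h ![1, 0, 1, 0] + N.ddiv h ![1, 1, 0, 0] = 0 ∧
    N.ddiv h ![0, 1, 1, 1] + N.ddiv h ![1, 0, 1, 1] + N.ddiv h ![1, 1, 0, 1]
      + N.ddiv h ![1, 1, 1, 0] = 0 ∧
    N.ddiv h ![1, 1, 1, 1] = -12 * algebraMap ℂ R Λ * Ψ₂ * χ - 3 * Ψ₂ * N.tau * N.Th (-4) 0 1 0 χ
      + 3 * Ψ₂ * N.rho * N.Th (-4) 0 1 1 χ - 6 * Ψ₂ ^ 2 * χ - 2 * Ψ₃ * N.rho * N.Th (-4) 0 0 1 χ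
      + 2 * Ψ₃ * N.tau * N.Th (-4) 0 0 0 χ + N.Th (-4) 0 0 1 χ * N.d 1 0 Ψ₂
      - N.Th (-4) 0 0 0 χ * N.d 1 1 Ψ₂ := by
  obtain ⟨hk, hs, -⟩ := H.bianchi_eqs
  obtain ⟨d0, d1⟩ := div_metric_two hk (N.hmm χ) (N.hnm χ) (N.hnn χ)
  obtain ⟨d2, d3⟩ := div_metric_three hs (N.hmm χ) (N.hnm χ) (N.hnn χ)
  have hD := H.ghp_isDebye hχ
  obtain ⟨w2, w3, w4⟩ := hD.weyl_eq
  obtain ⟨v0, v1, v2, v3⟩ := H.ghp_div d0 d1 d2 d3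
  rw [v0, v1] at w2
  rw [v0, v1, v2, v3] at w3 w4
  simp only [
    ghp_þ, ghp_ð, ghp_ð', ghp_þ', ghp_p, ghp_q, ghp_ρ, ghp_τ, ghp_ρ', ghp_τ', ghp_σ', ghp_κ',
    ghp_ρb, ghp_τb, ghp_ρb', ghp_τb', ghp_σb', ghp_κb', ghp_Ψ₂, ghp_Ψ₃, ghp_Λ, wd_hom, wtp_hom,
    wtq_hom, hom_mul, hom_add, hom_sub, hom_neg, algebraMap_eq, ofNat_eq, pow_two, Int.reduceAdd,
    Int.reduceNeg, add_zero, zero_add] at w2 w3 w4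
  replace w2 := congrArg forget w2
  replace w3 := congrArg forget w3
  replace w4 := congrArg forget w4
  rw [forget_hom] at w2 w3 w4
  rw [forget_hom] at w4
  rw [map_zero] at w2 w3
  subst hh
  obtain ⟨e0, e1, e2, e3, e4⟩ :=
    ddiv_metric hk hs (N.hmm χ) (N.hnm χ) (N.hnn χ) rfl rfl rfl rfl rfl
  refine ⟨e0, e1, e2.trans w2, e3.trans w3, e4.trans (w4.trans ?_)⟩
  simp only [Th, Int.cast_zero, zero_mul, sub_zero]
  ring

end IsTypeII

end SpinFrame

end GHP

end

noncomputable section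

namespace GHP

namespace SpinFrame

variable {R : Type*} [CommRing R] [Algebra ℂ R] (N : SpinFrame R)

/-! ### The projected Killing spinor and vector in a spin frame -/

/-- The projected Killing spinor, where `ψ = Ψ₂^{-1/3}`. -/
def killing (ψ Ψ₃ : R) (u : Fin 2 → Fin 2) (_ : Fin 0 → Fin 2) : R :=
  if u 0 = 0 then (if u 1 = 0 then 0 else -(algebraMap ℂ R (1 / 2) * ψ))
  else (if u 1 = 0 then -(algebraMap ℂ R (1 / 2) * ψ) else -(algebraMap ℂ R (1 / 3) * ψ ^ 4 * Ψ₃))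

/-- The projected Killing vector `ξ_{AA'} = ∇^B{}_{A'} K_{AB}`. -/
def xi (ψ Ψ₃ : R) (A A' : Fin 2) : R :=
  N.nabla (killing ψ Ψ₃) ![1, A, 0] ![A'] - N.nabla (killing ψ Ψ₃) ![0, A, 1] ![A']

/-- The contraction `ξ^a Θ_a` on scalars of weight `{-4,0}`. -/
def xiTh (ψ Ψ₃ χ : R) : R :=
  N.xi ψ Ψ₃ 1 1 * N.Th (-4) 0 0 0 χ - N.xi ψ Ψ₃ 1 0 * N.Th (-4) 0 0 1 χ
    - N.xi ψ Ψ₃ 0 1 * N.Th (-4) 0 1 0 χ + N.xi ψ Ψ₃ 0 0 * N.Th (-4) 0 1 1 χ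

namespace IsTypeII

variable {N} {Ψ₂ Ψ₃ : R} {Λ : ℂ}

theorem xi_eq (H : N.IsTypeII Ψ₂ Ψ₃ Λ) {φ ψ : R} (hφ : Ψ₂ = φ ^ 3) (hψ : φ * ψ = 1) :
    2 * φ ^ 4 * N.xi ψ Ψ₃ 0 0 = -(3 * Ψ₂ * N.rho) ∧ 2 * φ ^ 4 * N.xi ψ Ψ₃ 0 1 = -(3 * Ψ₂ * N.tau) ∧
    2 * φ ^ 4 * N.xi ψ Ψ₃ 1 0 = N.d 1 0 Ψ₂ - 2 * Ψ₃ * N.rho ∧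
    2 * φ ^ 4 * N.xi ψ Ψ₃ 1 1 = N.d 1 1 Ψ₂ - 2 * Ψ₃ * N.tau := by
  obtain ⟨hk, hs, b1, b2, b3, b4⟩ := H.bianchi_eqs
  have c2 : 2 * algebraMap ℂ R (1 / 2) = 1 := by
    rw [← map_ofNat (algebraMap ℂ R) 2, ← map_mul]; norm_num
  have c3 : 3 * algebraMap ℂ R (1 / 3) = 1 := by
    rw [← map_ofNat (algebraMap ℂ R) 3, ← map_mul]; norm_num
  have e1 : φ ^ 4 * ψ = φ ^ 3 := by linear_combination φ ^ 3 * hψ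
  have e2 : φ ^ 4 * ψ ^ 2 = φ ^ 2 := by linear_combination φ ^ 2 * (φ * ψ + 1) * hψ
  have e4 : φ ^ 4 * ψ ^ 4 = 1 := by
    linear_combination (φ ^ 3 * ψ ^ 3 + φ ^ 2 * ψ ^ 2 + φ * ψ + 1) * hψ
  have dψ (A A' : Fin 2) : N.d A A' ψ = -(ψ ^ 2 * N.d A A' φ) := by
    have h := congrArg (N.d A A') hψ
    rw [Derivation.leibniz, Derivation.map_one_eq_zero, smul_eq_mul, smul_eq_mul] at h
    linear_combination ψ * h - N.d A A' ψ * hψ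
  have dΨ (A A' : Fin 2) : N.d A A' Ψ₂ = 3 * φ ^ 2 * N.d A A' φ := by
    rw [hφ, Derivation.leibniz_pow]; simp [mul_assoc]
  have d3 : ψ ^ 2 * φ ^ 2 = 1 := by linear_combination (φ * ψ + 1) * hψ
  have dφ0 : N.d 0 0 φ = N.rho * φ := by
    rw [dΨ, hφ] at b1
    linear_combination algebraMap ℂ R (1 / 3) * ψ ^ 2 * b1
      + (N.rho * φ - N.d 0 0 φ) * (ψ ^ 2 * φ ^ 2 * c3 + d3)
  have dφ1 : N.d 0 1 φ = N.tau * φ := by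
    rw [dΨ, hφ] at b2
    linear_combination algebraMap ℂ R (1 / 3) * ψ ^ 2 * b2
      + (N.tau * φ - N.d 0 1 φ) * (ψ ^ 2 * φ ^ 2 * c3 + d3)
  have dψ0 : N.d 0 0 ψ = -(N.rho * ψ) := by
    rw [dψ, dφ0]; linear_combination -N.rho * ψ * hψ
  have dψ1 : N.d 0 1 ψ = -(N.tau * ψ) := by
    rw [dψ, dφ1]; linear_combination -N.tau * ψ * hψ
  rw [dΨ, dΨ]
  simp only [xi, nabla_two_zero, killing, Fin.sum_univ_two, Fin.isValue, Matrix.cons_val,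
    reduceIte, zero_ne_one, one_ne_zero, conn_00, conn_11, conn_0001, conn_0101, conn_1001,
    conn_1101, conn_0010, conn_0110, conn_1010, conn_1110, hk, hs, map_neg, map_zero,
    Derivation.leibniz, Derivation.leibniz_pow, Derivation.map_algebraMap, smul_eq_mul,
    nsmul_eq_mul, dψ0, dψ1, dψ 1 0, dψ 1 1, b3, b4, dΨ, hφ]
  push_cast
  refine ⟨?_, ?_, ?_, ?_⟩
  · linear_combination -6 * algebraMap ℂ R (1 / 2) * N.rho * e1 - 3 * φ ^ 3 * N.rho * c2
  · linear_combination -6 * algebraMap ℂ R (1 / 2) * N.tau * e1 - 3 * φ ^ 3 * N.tau * c2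
  · linear_combination 2 * algebraMap ℂ R (1 / 2) * N.d 1 0 φ * e2
      + 2 * algebraMap ℂ R (1 / 3) * (-5 * N.rho * Ψ₃ + 3 * φ ^ 2 * N.d 1 0 φ
        - 3 * N.tau' * φ ^ 3 + 2 * N.rho * Ψ₃) * e4
      + 4 * algebraMap ℂ R (1 / 2) * N.tau' * e1
      + (N.d 1 0 φ * φ ^ 2 + 2 * N.tau' * φ ^ 3) * c2
      + (-2 * N.rho * Ψ₃ + 2 * φ ^ 2 * N.d 1 0 φ - 2 * N.tau' * φ ^ 3) * c3
  · linear_combination 2 * algebraMap ℂ R (1 / 2) * N.d 1 1 φ * e2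
      + 2 * algebraMap ℂ R (1 / 3) * (-5 * N.tau * Ψ₃ + 3 * φ ^ 2 * N.d 1 1 φ
        - 3 * N.rho' * φ ^ 3 + 2 * N.tau * Ψ₃) * e4
      + 4 * algebraMap ℂ R (1 / 2) * N.rho' * e1
      + (N.d 1 1 φ * φ ^ 2 + 2 * N.rho' * φ ^ 3) * c2
      + (-2 * N.tau * Ψ₃ + 2 * φ ^ 2 * N.d 1 1 φ - 2 * N.rho' * φ ^ 3) * c3

theorem ddiv_debye_one (H : N.IsTypeII Ψ₂ Ψ₃ Λ) {φ ψ : R} (hφ : Ψ₂ = φ ^ 3) (hψ : φ * ψ = 1)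
    {χ : R} (hχ : N.IsDebye Ψ₂ χ) :
    N.ddiv (metric (N.hmm χ) (N.hnm χ) (N.hnn χ)) ![1, 1, 1, 1]
      = -(2 * φ ^ 4 * N.xiTh ψ Ψ₃ χ + 6 * Ψ₂ ^ 2 * χ + 12 * algebraMap ℂ R Λ * Ψ₂ * χ) := by
  obtain ⟨x0, x1, x2, x3⟩ := H.xi_eq hφ hψ
  rw [(H.ddiv_debye hχ rfl).2.2.2.2, xiTh]
  linear_combination N.Th (-4) 0 0 0 χ * x3 - N.Th (-4) 0 0 1 χ * x2
    - N.Th (-4) 0 1 0 χ * x1 + N.Th (-4) 0 1 1 χ * x0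

end IsTypeII

end SpinFrame

end GHP

end

noncomputable section

namespace GHP

variable {M : Type*} [TopologicalSpace M] [ChartedSpace (EuclideanSpace ℝ (Fin 4)) M]
  [IsManifold (𝓡 4) ∞ M]

namespace SpinDyad

variable {S : Spacetime M} (D : SpinDyad S)

/-! ### From the spin frame to the spacetime -/

omit [IsManifold (𝓡 4) ∞ M] in
theorem coe_algebraMap (z : ℂ) (x : M) : (algebraMap ℂ (smoothAlg M) z : M → ℂ) x = z := rfl

omit [IsManifold (𝓡 4) ∞ M] in
theorem coe_ofNat (n : ℕ) [n.AtLeastTwo] (x : M) :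
    ((no_index (OfNat.ofNat n : smoothAlg M) : smoothAlg M) : M → ℂ) x = OfNat.ofNat n := rfl

theorem rho_eq : D.rho = D.frame.rho := by
  ext x; exact (neg_neg (D.rho x)).symm

theorem tau_eq : D.tau = D.frame.tau := by
  ext x; exact (neg_neg (D.tau x)).symm

theorem rho'_eq : D.rho' = D.frame.rho' := by
  ext x; exact (neg_neg (D.rho' x)).symm

theorem tau'_eq : D.tau' = D.frame.tau' := by
  ext x; exact (neg_neg (D.tau' x)).symm

theorem sigma'_eq : D.sigma' = D.frame.sig' := by
  ext x; exact (neg_neg (D.sigma' x)).symm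

theorem bar_coe (f : smoothAlg M) : bar (f : M → ℂ) = D.frame.conj f := rfl

theorem Theta_coe (p q : ℤ) (A A' : Fin 2) (f : smoothAlg M) :
    D.Theta p q A A' f = D.frame.Th p q A A' f := by
  ext x
  have hi (n : ℤ) : ((n : smoothAlg M) : M → ℂ) x = n := by
    rw [← map_intCast (algebraMap ℂ (smoothAlg M)), coe_algebraMap]
  simp only [SpinFrame.Th, AddSubgroupClass.coe_sub, MulMemClass.coe_mul, Pi.sub_apply,
    Pi.mul_apply, hi]
  rfl

theorem nablaSp_coe {k k' : ℕ} (T : (Fin k → Fin 2) → (Fin k' → Fin 2) → smoothAlg M) :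
    D.nablaSp (fun u v => (T u v : M → ℂ)) = fun u v => (D.frame.nabla T u v : M → ℂ) := by
  ext u v x
  simp only [SpinFrame.nabla, AddSubgroupClass.coe_sub, AddSubmonoidClass.coe_finsetSum,
    MulMemClass.coe_mul, Pi.sub_apply, Finset.sum_apply, Pi.mul_apply]
  rfl

/-- The Weyl scalar `Ψ₂` of an Einstein metric as a smooth function. -/
def psi2 (Λ : ℝ) : smoothAlg M := D.frame.F 0 0 1 1 0 0 + algebraMap ℂ _ (Λ : ℂ)

/-- The Weyl scalar `Ψ₃` of an Einstein metric as a smooth function. -/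
def psi3 : smoothAlg M := D.frame.F 1 0 1 1 0 0

variable {Λ : ℝ}

theorem Psi2_eq (hE : D.IsEinstein Λ) : D.Psi2 = D.psi2 Λ := by
  ext x
  have h := (D.einstein_curvature hE x).2.1.2.1
  simp only [psi2, AddMemClass.coe_add, Pi.add_apply, coe_algebraMap]
  linear_combination -h

theorem Psi3_eq (hE : D.IsEinstein Λ) : D.Psi3 = D.psi3 := by
  ext x
  exact (D.einstein_curvature hE x).2.2.2.2.2.2.symm

theorem frame_isTypeII (hE : D.IsEinstein Λ) (hII : D.IsTypeII) :
    D.frame.IsTypeII (D.psi2 Λ) D.psi3 (Λ : ℂ) := by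
  have h2 (x : M) : (D.psi2 Λ : M → ℂ) x = D.Psi2 x := congrFun (D.Psi2_eq hE).symm x
  have h3 (x : M) : (D.psi3 : M → ℂ) x = D.Psi3 x := congrFun (D.Psi3_eq hE).symm x
  have h (x : M) := D.einstein_curvature hE x
  simp only [(hII _).1, (hII _).2.1] at h
  constructor
  case cancel =>
    intro f hf
    ext x
    have := congrFun (congrArg Subtype.val hf) x
    exact (mul_eq_zero.1 this).resolve_left (by rw [h2]; exact (hII x).2.2)
  case conj_Λ =>
    ext x
    exact Complex.conj_ofReal Λ
  all_goals
    ext x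
    obtain ⟨⟨a1, a2, a3⟩, ⟨b1, b2, b3⟩, ⟨c1, c2, c3⟩, ⟨d1, d2, d3⟩, ⟨e1, e2, e3⟩, f1, f2⟩ := h x
    try simp only [AddMemClass.coe_add, AddSubgroupClass.coe_sub, MulMemClass.coe_mul,
      NegMemClass.coe_neg, Pi.add_apply, Pi.sub_apply, Pi.neg_apply, Pi.mul_apply, h2, h3,
      coe_algebraMap, coe_ofNat]
    first
    | exact a1.trans neg_zero | exact b1.trans neg_zero | exact a2 | exact a3 | exact b2
    | exact b3 | exact c1 | exact c2 | exact c3 | exact d1 | exact d2 | exact d3 | exact e1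
    | exact e2 | exact e3 | exact f1 | exact f2

theorem debyeMetric_coe (χ : smoothAlg M) : D.debyeMetric χ = fun u v =>
    ((SpinFrame.metric (D.frame.hmm χ) (D.frame.hnm χ) (D.frame.hnn χ) u v : smoothAlg M) :
      M → ℂ) := by
  have e1 : D.hmbmb χ = D.frame.hmm χ := by
    simp only [hmbmb, tho, rho_eq, Theta_coe]; rfl
  have e2 : D.hnmb χ = D.frame.hnm χ := by
    simp only [hnmb, tho, edt, rho_eq, tau_eq, tau'_eq, Theta_coe]; rfl
  have e3 : D.hnn χ = D.frame.hnn χ := by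
    simp only [hnn, tho, edt, tau_eq, sigma'_eq, Theta_coe]; rfl
  ext u v x
  simp only [debyeMetric, e1, e2, e3, SpinFrame.metric, lLow, mLow, oLow, iotaLow, eps]
  have h01 (a : Fin 2) : a = 0 ∨ a = 1 := by omega
  rcases h01 (u 0) with h | h <;> rcases h01 (u 1) with h' | h' <;>
    rcases h01 (v 0) with k | k <;> rcases h01 (v 1) with k' | k' <;> simp [h, h', k, k']

theorem isDebye_coe (hE : D.IsEinstein Λ) {χ : smoothAlg M} (h : ∀ x, D.debyeOp χ x = 0) :
    D.frame.IsDebye (D.psi2 Λ) χ := by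
  have ha : D.tho (-4) 0 χ + 3 * D.rho * χ
      = ((D.frame.Th (-4) 0 0 0 χ + 3 * D.frame.rho * χ : smoothAlg M) : M → ℂ) := by
    rw [tho, Theta_coe, rho_eq]; rfl
  have hb : D.edt (-4) 0 χ + 3 * D.tau * χ
      = ((D.frame.Th (-4) 0 0 1 χ + 3 * D.frame.tau * χ : smoothAlg M) : M → ℂ) := by
    rw [edt, Theta_coe, tau_eq]; rfl
  rw [SpinFrame.IsDebye]
  ext x
  have hx := h x
  simp only [debyeOp, ha, hb, tho', edt', Theta_coe, rho'_eq, tau_eq, D.Psi2_eq hE,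
    D.bar_coe] at hx
  exact (mul_eq_zero.1 hx).resolve_left two_ne_zero

theorem trace_debyeMetric (χ : M → ℂ) (x : M) : trace (D.debyeMetric χ) x = 0 := by
  simp [trace, debyeMetric, Fin.sum_univ_two, eps, lLow, mLow, oLow, iotaLow]

/-- A symmetrized spinor vanishes off `ι^A ι^B ι^C ι^D` if the sums of its components with a given
number of indices `1` do. -/
theorem sym_eq_zero {g : Fin 2 → Fin 2 → Fin 2 → Fin 2 → ℂ} (h0 : g 0 0 0 0 = 0)
    (h1 : g 0 0 0 1 + g 0 0 1 0 + g 0 1 0 0 + g 1 0 0 0 = 0)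
    (h2 : g 0 0 1 1 + g 0 1 0 1 + g 0 1 1 0 + g 1 0 0 1 + g 1 0 1 0 + g 1 1 0 0 = 0)
    (h3 : g 0 1 1 1 + g 1 0 1 1 + g 1 1 0 1 + g 1 1 1 0 = 0) {a b c e : Fin 2}
    (hn : ¬(a = 1 ∧ b = 1 ∧ c = 1 ∧ e = 1)) :
    (g a b c e + g a b e c + g a c b e + g a c e b + g a e b c + g a e c b)
      + (g b a c e + g b a e c + g b c a e + g b c e a + g b e a c + g b e c a)
      + (g c a b e + g c a e b + g c b a e + g c b e a + g c e a b + g c e b a)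
      + (g e a b c + g e a c b + g e b a c + g e b c a + g e c a b + g e c b a) = 0 := by
  have h01 (a : Fin 2) : a = 0 ∨ a = 1 := by omega
  rcases h01 a with rfl | rfl <;> rcases h01 b with rfl | rfl <;>
    rcases h01 c with rfl | rfl <;> rcases h01 e with rfl | rfl
  case inr.inr.inr.inr => exact absurd ⟨rfl, rfl, rfl, rfl⟩ hn
  all_goals first
    | linear_combination 24 * h0 | linear_combination 6 * h1 | linear_combination 4 * h2
    | linear_combination 6 * h3

theorem oLow_mul_eq_zero {a b c e : Fin 2} (hn : ¬(a = 1 ∧ b = 1 ∧ c = 1 ∧ e = 1)) :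
    oLow a * oLow b * oLow c * oLow e = 0 := by
  have h (i : Fin 2) (hi : oLow i ≠ 0) : i = 1 := by
    by_contra h'
    exact hi (by simp [oLow, eps, h'])
  by_contra h'
  simp only [mul_eq_zero, not_or] at h'
  exact hn ⟨h _ h'.1.1.1, h _ h'.1.1.2, h _ h'.1.2, h _ h'.2⟩

theorem linWeyl_debyeMetric (χ : smoothAlg M) (a b c e : Fin 2) (x : M) :
    let g := fun a b c e => (D.frame.ddiv (SpinFrame.metric (D.frame.hmm χ) (D.frame.hnm χ)
      (D.frame.hnn χ)) ![a, b, c, e] : M → ℂ) x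
    D.linWeyl (D.debyeMetric χ) ![a, b, c, e] x = (1 / 48 : ℂ) *
      ((g a b c e + g a b e c + g a c b e + g a c e b + g a e b c + g a e c b)
        + (g b a c e + g b a e c + g b c a e + g b c e a + g b e a c + g b e c a)
        + (g c a b e + g c a e b + g c b a e + g c b e a + g c e a b + g c e b a)
        + (g e a b c + g e a c b + g e b a c + g e b c a + g e c a b + g e c b a)) := by
  intro g
  have hg (a b c e : Fin 2) : (∑ A' : Fin 2, ∑ P' : Fin 2, ∑ B' : Fin 2, ∑ Q' : Fin 2,
      eps A' P' * eps B' Q' * D.nablaSp (D.nablaSp (D.debyeMetric χ)) ![a, b, c, e]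
        ![P', Q', A', B'] x) = g a b c e := by
    rw [debyeMetric_coe, nablaSp_coe, nablaSp_coe]
    have h := congrFun (congrArg Subtype.val (D.frame.contract_nabla_nabla
      (SpinFrame.metric (D.frame.hmm χ) (D.frame.hnm χ) (D.frame.hnn χ)) a b c e)) x
    refine Eq.trans ?_ h
    simp [eps, Fin.sum_univ_two]
    ring
  rw [linWeyl, trace_debyeMetric, sym4_apply]
  simp only [hg]
  ring

theorem xi_coe (hE : D.IsEinstein Λ) {φ : M → ℂ} {ψ : smoothAlg M}
    (hψ : ∀ x, (φ x)⁻¹ = (ψ : M → ℂ) x) (A A' : Fin 2) :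
    D.xi φ A A' = D.frame.xi ψ D.psi3 A A' := by
  have hK : D.killingSpinor φ
      = fun u v => ((SpinFrame.killing ψ D.psi3 u v : smoothAlg M) : M → ℂ) := by
    ext u v x
    simp only [killingSpinor, SpinFrame.killing, oLow, iotaLow, eps, ← inv_pow, hψ,
      congrFun (D.Psi3_eq hE) x]
    have h01 (a : Fin 2) : a = 0 ∨ a = 1 := by omega
    rcases h01 (u 0) with h | h <;> rcases h01 (u 1) with h' | h' <;>
      simp [h, h', coe_algebraMap] <;> ring
  ext x
  simp only [xi, hK, nablaSp_coe, SpinFrame.xi]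
  simp [eps, Fin.sum_univ_two]
  ring

theorem xiTheta_coe (hE : D.IsEinstein Λ) {φ : M → ℂ} {ψ : smoothAlg M}
    (hψ : ∀ x, (φ x)⁻¹ = (ψ : M → ℂ) x) (χ : smoothAlg M) (x : M) :
    D.xiTheta φ (-4) 0 χ x = (D.frame.xiTh ψ D.psi3 χ : M → ℂ) x := by
  simp [xiTheta, SpinFrame.xiTh, D.xi_coe hE hψ, Theta_coe, eps, Fin.sum_univ_two]
  ring

end SpinDyad

end GHP

end

theorem debye_metric_dotPsi4
    {M : Type*} [TopologicalSpace M] [ChartedSpace (EuclideanSpace ℝ (Fin 4)) M]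
    [IsManifold (𝓡 4) ∞ M]
    (S : GHP.Spacetime M) (D : GHP.SpinDyad S) (Λ : ℝ)
    (hEinstein : D.IsEinstein Λ) (hTypeII : D.IsTypeII)
    -- a smooth branch `φ` of `Ψ₂^{1/3}`
    (φ : M → ℂ) (hφ : GHP.SmoothFn φ) (hφ3 : ∀ x, φ x ^ 3 = D.Psi2 x)
    (χ : M → ℂ) (hχ : GHP.SmoothFn χ) (hDebye : ∀ x, D.debyeOp χ x = 0) :
    (∀ (A B C E : Fin 2) (x : M),
      D.linWeyl (D.debyeMetric χ) ![A, B, C, E] x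
        = GHP.oLow A * GHP.oLow B * GHP.oLow C * GHP.oLow E
          * D.linWeyl (D.debyeMetric χ) ![1, 1, 1, 1] x) ∧
    ∀ x : M, D.linWeyl (D.debyeMetric χ) ![1, 1, 1, 1] x
      = -(φ x ^ 4 * D.xiTheta φ (-4) 0 χ x + 3 * D.Psi2 x ^ 2 * χ x
          + 6 * D.Psi2 x * (Λ : ℂ) * χ x) := by
  lift χ to GHP.smoothAlg M using hχ
  lift φ to GHP.smoothAlg M using hφ
  have H := D.frame_isTypeII hEinstein hTypeII
  have hD := D.isDebye_coe hEinstein hDebye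
  refine ⟨fun A B C E x => ?_, fun x => ?_⟩
  · by_cases h : A = 1 ∧ B = 1 ∧ C = 1 ∧ E = 1
    · obtain ⟨rfl, rfl, rfl, rfl⟩ := h
      simp [GHP.oLow, GHP.eps]
    obtain ⟨h0, h1, h2, h3, -⟩ := H.ddiv_debye hD rfl
    have hx {f : GHP.smoothAlg M} (hf : f = 0) : (f : M → ℂ) x = 0 := by rw [hf]; rfl
    rw [GHP.SpinDyad.oLow_mul_eq_zero h, zero_mul, D.linWeyl_debyeMetric χ,
      GHP.SpinDyad.sym_eq_zero (g := fun a b c e => (D.frame.ddiv (GHP.SpinFrame.metric (D.frame.hmm χ)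
        (D.frame.hnm χ) (D.frame.hnn χ)) ![a, b, c, e] : M → ℂ) x) (hx h0) (hx h1) (hx h2) (hx h3) h,
      mul_zero]
  · have hφ0 (x : M) : (φ : M → ℂ) x ≠ 0 := fun h => (hTypeII x).2.2 (by simp [← hφ3, h])
    obtain ⟨ψ, hψ⟩ : ∃ ψ : GHP.smoothAlg M, ∀ x, ((φ : M → ℂ) x)⁻¹ = (ψ : M → ℂ) x :=
      ⟨⟨_, GHP.SmoothFn.inv φ.2 hφ0⟩, fun _ => rfl⟩
    have e1 : D.psi2 Λ = φ ^ 3 := by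
      ext y
      rw [← D.Psi2_eq hEinstein, ← hφ3]; rfl
    have e2 : φ * ψ = 1 := by
      ext y
      change (φ : M → ℂ) y * (ψ : M → ℂ) y = 1
      rw [← hψ, mul_inv_cancel₀ (hφ0 y)]
    have key := congrFun (congrArg Subtype.val (H.ddiv_debye_one e1 e2 hD)) x
    replace key : (D.frame.ddiv _ _ : M → ℂ) x = -(2 * (φ : M → ℂ) x ^ 4
        * (D.frame.xiTh ψ D.psi3 χ : M → ℂ) x + 6 * (D.psi2 Λ : M → ℂ) x ^ 2 * (χ : M → ℂ) x
        + 12 * Λ * (D.psi2 Λ : M → ℂ) x * (χ : M → ℂ) x) := key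
    rw [D.xiTheta_coe hEinstein hψ, D.linWeyl_debyeMetric χ, D.Psi2_eq hEinstein]
    linear_combination (1 / 2) * key
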